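/- Let B ⊆ P be a faithfully flat Hopf–Galois extension such that P is also a right H-module algebra with pq = q₍₀₎(p ◁ q₍₁₎) for all p,q ∈ P (◁-commutativity). Define Z̃²(H,P) as the subset of Z²_{◁,as}(H,P) consisting of those γ that are H-colinear in the sense γ(h,g)₍₀₎ ⊗ γ(h,g)₍₁₎ = γ(h₍₂₎,g₍₂₎) ⊗ S(g₍₁₎h₍₁₎) g₍₃₎h₍₃₎. Then Z̃²(H,P) is in one-to-one correspondence with Z²(L(P,H),B), via γ ↦ Γ_γ with Γ_γ(p⊗p', q⊗q') = p₍₀₎q₍₀₎ γ(q₍₁₎, p₍₁₎) q'p'. -/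

import Mathlib

open scoped TensorProduct
open TensorProduct

noncomputable section
attribute [local instance] Classical.propDecidable

/-- Choice-based lift of a (bilinear) function to the tensor product: if a linear map agreeing
with `f` on pure tensors exists, this is it (it is then unique); otherwise `0`. -/
def tlift (R : Type*) [CommRing R] {M N Q : Type*} [AddCommGroup M] [Module R M]
    [AddCommGroup N] [Module R N] [AddCommGroup Q] [Module R Q]
    (f : M → N → Q) : M ⊗[R] N →ₗ[R] Q :=
  if h : ∃ F : M ⊗[R] N →ₗ[R] Q, ∀ x y, F (x ⊗ₜ[R] y) = f x y then h.choose else 0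

/-- Choice-based lift of a (bilinear, balanced) function to a quotient of the tensor product. -/
def qtlift (R : Type*) [CommRing R] {M N Q : Type*} [AddCommGroup M] [Module R M]
    [AddCommGroup N] [Module R N] [AddCommGroup Q] [Module R Q]
    (p : Submodule R (M ⊗[R] N)) (f : M → N → Q) : ((M ⊗[R] N) ⧸ p) →ₗ[R] Q :=
  if h : ∃ F : ((M ⊗[R] N) ⧸ p) →ₗ[R] Q,
      ∀ x y, F (Submodule.Quotient.mk (x ⊗ₜ[R] y)) = f x y then h.choose else 0

variable (k : Type*) [Field k]

/-- Source and target data for a left bialgebroid over `B`: an algebra map `s : B → L` and an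
anti-algebra map `t : B → L` with commuting ranges. -/
structure BgdST (B L : Type*) [Ring B] [Algebra k B] [Ring L] [Algebra k L] where
  s : B →ₐ[k] L
  t : B →ₗ[k] L
  t_one : t 1 = 1
  t_mul : ∀ a b : B, t (a * b) = t b * t a
  st_comm : ∀ a b : B, s a * t b = t b * s a

namespace BgdST

variable {k} {B L : Type*} [Ring B] [Algebra k B] [Ring L] [Algebra k L]
variable (st : BgdST k B L)

/-- The relations defining `L ⊗_B L`: `t a · X ⊗ Y  ~  X ⊗ s a · Y`. -/
def rel : Submodule k (L ⊗[k] L) :=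
  Submodule.span k {z | ∃ (a : B) (X Y : L), z = (st.t a * X) ⊗ₜ[k] Y - X ⊗ₜ[k] (st.s a * Y)}

/-- `L ⊗_B L` (the coring tensor square). -/
abbrev T2 := (L ⊗[k] L) ⧸ st.rel

/-- Class of a pure tensor in `L ⊗_B L`. -/
def mk2 (X Y : L) : st.T2 := Submodule.Quotient.mk (X ⊗ₜ[k] Y)

/-- Evaluate a balanced bilinear expression on an element of `L ⊗_B L`. -/
def lift2 {Q : Type*} [AddCommGroup Q] [Module k Q] (f : L → L → Q) : st.T2 →ₗ[k] Q :=
  qtlift k st.rel f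

/-- The relations defining `L ⊗_{B^{op}} L`: `X·t a ⊗ Y ~ X ⊗ t a · Y`. -/
def relOp : Submodule k (L ⊗[k] L) :=
  Submodule.span k {z | ∃ (a : B) (X Y : L), z = (X * st.t a) ⊗ₜ[k] Y - X ⊗ₜ[k] (st.t a * Y)}

/-- `L ⊗_{B^{op}} L` (domain of the canonical map `λ`). -/
abbrev TOp := (L ⊗[k] L) ⧸ st.relOp

def mkOp (X Y : L) : st.TOp := Submodule.Quotient.mk (X ⊗ₜ[k] Y)

def liftOp {Q : Type*} [AddCommGroup Q] [Module k Q] (f : L → L → Q) : st.TOp →ₗ[k] Q :=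
  qtlift k st.relOp f

/-- The relations defining `L ⊗^{B^{op}} L`: `s a · X ⊗ Y ~ X ⊗ Y · s a`. -/
def relA : Submodule k (L ⊗[k] L) :=
  Submodule.span k {z | ∃ (a : B) (X Y : L), z = (st.s a * X) ⊗ₜ[k] Y - X ⊗ₜ[k] (Y * st.s a)}

/-- `L ⊗^{B^{op}} L` (domain of the canonical map `μ`). -/
abbrev TA := (L ⊗[k] L) ⧸ st.relA

def mkA (X Y : L) : st.TA := Submodule.Quotient.mk (X ⊗ₜ[k] Y)

def liftA {Q : Type*} [AddCommGroup Q] [Module k Q] (f : L → L → Q) : st.TA →ₗ[k] Q :=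
  qtlift k st.relA f

/-- Relations for the triple tensor `L ⊗_B L ⊗_B L`. -/
def rel3 : Submodule k (L ⊗[k] (L ⊗[k] L)) :=
  Submodule.span k
    ({z | ∃ (a : B) (X Y Z : L),
        z = (st.t a * X) ⊗ₜ[k] (Y ⊗ₜ[k] Z) - X ⊗ₜ[k] ((st.s a * Y) ⊗ₜ[k] Z)} ∪
     {z | ∃ (a : B) (X Y Z : L),
        z = X ⊗ₜ[k] ((st.t a * Y) ⊗ₜ[k] Z) - X ⊗ₜ[k] (Y ⊗ₜ[k] (st.s a * Z))})

/-- `L ⊗_B L ⊗_B L`. -/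
abbrev T3 := (L ⊗[k] (L ⊗[k] L)) ⧸ st.rel3

def mk3 (X Y Z : L) : st.T3 := Submodule.Quotient.mk (X ⊗ₜ[k] (Y ⊗ₜ[k] Z))

/-- The factorwise product of two elements of `L ⊗_B L`, whenever it is well defined
on representatives (as it is when the left factor lies in the Takeuchi product);
junk value `0` otherwise. -/
def mulT2 (z w : st.T2) : st.T2 :=
  if h : ∃ u : st.T2, ∀ zr wr : L ⊗[k] L, Submodule.Quotient.mk zr = z →
      Submodule.Quotient.mk wr = w → Submodule.Quotient.mk (zr * wr) = u
  then h.choose else 0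

variable (cop : L →ₗ[k] st.T2) (cou : L →ₗ[k] B)

/-- The axioms of a left bialgebroid over `B` with structure `(s,t,Δ,ε) = (st.s, st.t, cop, cou)`
(Definition 2.3 of the paper): `L` is a `B^e`-ring and a `B`-coring, the coproduct corestricts
to an algebra map into the Takeuchi product, and the counit is a left character. -/
structure IsLeftBialgebroid : Prop where
  comul_one : cop 1 = st.mk2 1 1
  comul_mul : ∀ X Y : L, cop (X * Y) = st.mulT2 (cop X) (cop Y)
  comul_s : ∀ (b : B) (X : L),
    cop (st.s b * X) = st.lift2 (fun x y => st.mk2 (st.s b * x) y) (cop X)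
  comul_t : ∀ (b : B) (X : L),
    cop (st.t b * X) = st.lift2 (fun x y => st.mk2 x (st.t b * y)) (cop X)
  takeuchi : ∀ (b : B) (X : L),
    st.lift2 (fun x y => st.mk2 (x * st.t b) y) (cop X) =
      st.lift2 (fun x y => st.mk2 x (y * st.s b)) (cop X)
  coassoc : ∀ X : L,
    st.lift2 (fun x1 x2 => st.lift2 (fun y1 y2 => st.mk3 x1 y1 y2) (cop x2)) (cop X) =
      st.lift2 (fun x12 x3 => st.lift2 (fun x1 x2 => st.mk3 x1 x2 x3) (cop x12)) (cop X)
  counit_comul_left : ∀ X : L, st.lift2 (fun x1 x2 => st.s (cou x1) * x2) (cop X) = X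
  counit_comul_right : ∀ X : L, st.lift2 (fun x1 x2 => st.t (cou x2) * x1) (cop X) = X
  counit_one : cou 1 = 1
  counit_s : ∀ (b : B) (X : L), cou (st.s b * X) = b * cou X
  counit_t : ∀ (b : B) (X : L), cou (st.t b * X) = cou X * b
  counit_char_s : ∀ X Y : L, cou (X * st.s (cou Y)) = cou (X * Y)
  counit_char_t : ∀ X Y : L, cou (X * st.t (cou Y)) = cou (X * Y)

/-- The canonical map `λ : L ⊗_{B^{op}} L → L ⊗_B L`, `X ⊗ Y ↦ X₍₁₎ ⊗ X₍₂₎Y`. -/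
def lam : st.TOp →ₗ[k] st.T2 :=
  st.liftOp (fun X Y => st.lift2 (fun x1 x2 => st.mk2 x1 (x2 * Y)) (cop X))

/-- A left bialgebroid is a left Hopf algebroid if `λ` is bijective. -/
def IsLeftHopf : Prop := Function.Bijective (st.lam cop)

/-- The canonical map `μ : L ⊗^{B^{op}} L → L ⊗_B L`, `X ⊗ Y ↦ Y₍₁₎X ⊗ Y₍₂₎`. -/
def mu : st.TA →ₗ[k] st.T2 :=
  st.liftA (fun X Y => st.lift2 (fun y1 y2 => st.mk2 (y1 * X) y2) (cop Y))

/-- A left bialgebroid is an anti-left Hopf algebroid if `μ` is bijective. -/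
def IsAntiLeftHopf : Prop := Function.Bijective (st.mu cop)

/-- `X₊ ⊗_{B^{op}} X₋ := λ⁻¹(X ⊗_B 1)` (meaningful when `λ` is bijective). -/
def plusMinus (X : L) : st.TOp := Function.invFun (st.lam cop) (st.mk2 X 1)

/-- `X₍₋₎ ⊗^{B^{op}} X₍₊₎ := μ⁻¹(1 ⊗_B X)` (meaningful when `μ` is bijective). -/
def minusPlus (X : L) : st.TA := Function.invFun (st.mu cop) (st.mk2 1 X)

/-- A left bisection of a left bialgebroid (Definition 3.1). -/
structure IsLeftBisection (σ : L →ₗ[k] B) : Prop where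
  unital : σ 1 = 1
  t_prop : ∀ (b : B) (X : L), σ (st.t b * X) = σ X * b
  s_mul : ∀ a b : B, σ (st.s (a * b)) = σ (st.s a) * σ (st.s b)
  s_bij : Function.Bijective (fun b => σ (st.s b))
  prod_t : ∀ X Y : L, σ (X * Y) = σ (X * st.t (σ Y))
  prod_s : ∀ X Y : L,
    σ (X * Y) = σ (X * st.s (Function.invFun (fun b => σ (st.s b)) (σ Y)))

/-- Convolution of left bisections:  `(σ * η)(X) := σ(s(η(X₍₁₎)) X₍₂₎)`. -/
def bconv (σ η : L →ₗ[k] B) : L →ₗ[k] B :=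
  (st.lift2 (fun x1 x2 => σ (st.s (η x1) * x2))).comp cop

/-- A right bisection of a left bialgebroid (Definition 3.6). -/
structure IsRightBisection (σ : L →ₗ[k] B) : Prop where
  unital : σ 1 = 1
  s_prop : ∀ (b : B) (X : L), σ (st.s b * X) = b * σ X
  t_mul : ∀ a b : B, σ (st.t (a * b)) = σ (st.t b) * σ (st.t a)
  t_bij : Function.Bijective (fun b => σ (st.t b))
  prod_s : ∀ X Y : L, σ (X * Y) = σ (X * st.s (σ Y))
  prod_t : ∀ X Y : L,
    σ (X * Y) = σ (X * st.t (Function.invFun (fun b => σ (st.t b)) (σ Y)))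

/-- Convolution of right bisections:  `(σ • η)(X) := σ(t(η(X₍₂₎)) X₍₁₎)`. -/
def rconv (σ η : L →ₗ[k] B) : L →ₗ[k] B :=
  (st.lift2 (fun x1 x2 => σ (st.t (η x2) * x1))).comp cop

/-- An automorphism `(Φ, φ)` of a left bialgebroid. -/
structure IsBgdAut (Φ : L →ₐ[k] L) (φ : B →ₐ[k] B) : Prop where
  bijL : Function.Bijective Φ
  bijB : Function.Bijective φ
  comp_s : ∀ b : B, Φ (st.s b) = st.s (φ b)
  comp_t : ∀ b : B, Φ (st.t b) = st.t (φ b)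
  comp_comul : ∀ X : L,
    cop (Φ X) = st.lift2 (fun x1 x2 => st.mk2 (Φ x1) (Φ x2)) (cop X)
  comp_counit : ∀ X : L, cou (Φ X) = φ (cou X)

/-- `Ad^L_σ(X) := s(σ(X₍₁₎)) X₍₂₎₊ t(σ(X₍₂₎₋))`, for a left Hopf algebroid. -/
def adL (σ : L →ₗ[k] B) (X : L) : L :=
  st.lift2 (fun x1 x2 => st.s (σ x1) *
    st.liftOp (fun p m => p * st.t (σ m)) (st.plusMinus cop x2)) (cop X)

/-- `Ad^R_σ(X) := t(σ(X₍₂₎)) X₍₁₎₍₊₎ s(σ(X₍₁₎₍₋₎))`, for an anti-left Hopf algebroid. -/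
def adR (σ : L →ₗ[k] B) (X : L) : L :=
  st.lift2 (fun x1 x2 => st.t (σ x2) *
    st.liftA (fun m p => p * st.s (σ m)) (st.minusPlus cop x1)) (cop X)

/-- The `B`-bimodule-map conditions on a map `L → B` used for `C¹(L,B)`. -/
def IsBimodMap (U : L →ₗ[k] B) : Prop :=
  (∀ (b : B) (X : L), U (st.t b * X) = U X * b) ∧
  (∀ (b : B) (X : L), U (st.s b * X) = b * U X)

/-- Convolution `(U * V)(X) = U(X₍₁₎) V(X₍₂₎)` of `B`-valued maps. -/
def cconv (U V : L →ₗ[k] B) : L →ₗ[k] B :=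
  (st.lift2 (fun x1 x2 => U x1 * V x2)).comp cop

/-- Extended vertical bisections `C¹(L,B)`: unital convolution-invertible `B`-bimodule maps
`U : L → B` with `U(X s(b)) = U(X t(b))`. -/
def IsC1 (U : L →ₗ[k] B) : Prop :=
  U 1 = 1 ∧ st.IsBimodMap U ∧
  (∀ (b : B) (X : L), U (X * st.s b) = U (X * st.t b)) ∧
  ∃ V : L →ₗ[k] B, st.IsBimodMap V ∧ st.cconv cop U V = cou ∧ st.cconv cop V U = cou

/-- Convolution product on `B`-bimodule maps `L ⊗_{B^e} L → B`:
`(f ⋆ g)(X,Y) = f(X₍₁₎,Y₍₁₎) g(X₍₂₎,Y₍₂₎)`. -/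
def conv2 (f g : L → L → B) (X Y : L) : B :=
  st.lift2 (fun y1 y2 =>
    st.lift2 (fun x1 x2 => f x1 y1 * g x2 y2) (cop X)) (cop Y)

/-- The unit `ε̃(X ⊗ Y) = ε(XY)` of the convolution algebra. -/
def unit2 (X Y : L) : B := cou (X * Y)

/-- Left-hand side of the 2-cocycle condition: `Γ(X, s(Γ(Y₍₁₎,Z₍₁₎)) Y₍₂₎Z₍₂₎)`. -/
def cocL (Γ : L → L → B) (X Y Z : L) : B :=
  st.lift2 (fun z1 z2 =>
    st.lift2 (fun y1 y2 => Γ X (st.s (Γ y1 z1) * (y2 * z2))) (cop Y)) (cop Z)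

/-- Right-hand side of the 2-cocycle condition: `Γ(s(Γ(X₍₁₎,Y₍₁₎)) X₍₂₎Y₍₂₎, Z)`. -/
def cocR (Γ : L → L → B) (X Y Z : L) : B :=
  st.lift2 (fun y1 y2 =>
    st.lift2 (fun x1 x2 => Γ (st.s (Γ x1 y1) * (x2 * y2)) Z) (cop X)) (cop Y)

/-- Membership of a bilinear map in `_B Hom_B (L ⊗_{B^e} L, B)`. -/
def IsBihom (Γ : L → L → B) : Prop :=
  (∃ Γ' : L →ₗ[k] L →ₗ[k] B, ∀ X Y, Γ' X Y = Γ X Y) ∧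
  (∀ (b c : B) (X Y : L), Γ (st.s b * (st.t c * X)) Y = b * Γ X Y * c) ∧
  (∀ (b c : B) (X Y : L), Γ (X * st.s b * st.t c) Y = Γ X (st.s b * (st.t c * Y)))

/-- An invertible normalised 2-cocycle on a left bialgebroid (Definition 2.6);
the collection of these is `Z²(L,B)`. -/
structure IsZ2 (Γ : L → L → B) : Prop where
  bihom : st.IsBihom Γ
  norm_left : ∀ X : L, Γ 1 X = cou X
  norm_right : ∀ X : L, Γ X 1 = cou X
  st_indep : ∀ (b : B) (X Y : L), Γ X (Y * st.s b) = Γ X (Y * st.t b)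
  cocycle : ∀ X Y Z : L, st.cocL cop Γ X Y Z = st.cocR cop Γ X Y Z
  inv : ∃ Γi : L → L → B, st.IsBihom Γi ∧
    (∀ X Y, st.conv2 cop Γ Γi X Y = unit2 cou X Y) ∧
    (∀ X Y, st.conv2 cop Γi Γ X Y = unit2 cou X Y)

/-- The coboundary `∂U(X,Y) = U⁻¹(X₍₁₎ t(U⁻¹(Y₍₁₎))) U(X₍₂₎Y₍₂₎)` of `U ∈ C¹(L,B)`. -/
def coboundary (U Ui : L →ₗ[k] B) (X Y : L) : B :=
  st.lift2 (fun y1 y2 =>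
    st.lift2 (fun x1 x2 => Ui (x1 * st.t (Ui y1)) * U (x2 * y2)) (cop X)) (cop Y)

/-- The transform `Γ^U(X,Y) = U⁻¹(X₍₁₎ t(U⁻¹(Y₍₁₎))) Γ(X₍₂₎,Y₍₂₎) U(X₍₃₎Y₍₃₎)`. -/
def gammaU (Γ : L → L → B) (U Ui : L →ₗ[k] B) (X Y : L) : B :=
  st.lift2 (fun y1 y23 => st.lift2 (fun y2 y3 =>
    st.lift2 (fun x1 x23 => st.lift2 (fun x2 x3 =>
      Ui (x1 * st.t (Ui y1)) * Γ x2 y2 * U (x3 * y3)) (cop x23)) (cop X))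
    (cop y23)) (cop Y)

/-- The cotwisted product `X ·_Γ Y := s(Γ(X₍₁₎,Y₍₁₎)) t(Γ⁻¹(X₍₃₎,Y₍₃₎)) X₍₂₎Y₍₂₎`. -/
def prodG (Γ Γi : L → L → B) (X Y : L) : L :=
  st.lift2 (fun y1 y23 => st.lift2 (fun y2 y3 =>
    st.lift2 (fun x1 x23 => st.lift2 (fun x2 x3 =>
      st.s (Γ x1 y1) * (st.t (Γi x3 y3) * (x2 * y2))) (cop x23)) (cop X))
    (cop y23)) (cop Y)

/-- `Ad_U(X) := s(U(X₍₁₎)) t(U⁻¹(X₍₃₎)) X₍₂₎`. -/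
def adU (U Ui : L →ₗ[k] B) (X : L) : L :=
  st.lift2 (fun x1 x23 => st.lift2 (fun x2 x3 =>
    st.s (U x1) * (st.t (Ui x3) * x2)) (cop x23)) (cop X)

end BgdST

end

/-! ## Hopf–Galois extensions and the Ehresmann–Schauenburg bialgebroid -/

noncomputable section
attribute [local instance] Classical.propDecidable

universe u v

open scoped TensorProduct
open TensorProduct

variable {k : Type u} [Field k] {H P : Type v} [Ring H] [HopfAlgebra k H]
  [Ring P] [Algebra k P]

/-- A right `H`-comodule algebra structure on `P`. -/
structure ComodAlg (k : Type u) [Field k] (H P : Type v) [Ring H] [HopfAlgebra k H]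
    [Ring P] [Algebra k P] where
  ρ : P →ₗ[k] P ⊗[k] H
  coassoc : ∀ p : P,
    tlift k (fun p0 p1 => p0 ⊗ₜ[k] (Coalgebra.comul (R := k) p1)) (ρ p) =
      tlift k (fun p0 p1 =>
        tlift k (fun q0 q1 => (q0 ⊗ₜ[k] (q1 ⊗ₜ[k] p1) : P ⊗[k] (H ⊗[k] H))) (ρ p0)) (ρ p)
  counit_coact : ∀ p : P,
    tlift k (fun p0 p1 => (Coalgebra.counit (R := k) p1 : k) • p0) (ρ p) = p
  coact_mul : ∀ p q : P, ρ (p * q) = ρ p * ρ q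
  coact_one : ρ 1 = 1

namespace ComodAlg

variable (ca : ComodAlg k H P)

/-- The subalgebra `B = P^{coH}` of coinvariants. -/
def coinv : Subalgebra k P where
  carrier := {p : P | ca.ρ p = p ⊗ₜ[k] (1 : H)}
  mul_mem' := by
    intro a b ha hb
    have ha' : ca.ρ a = a ⊗ₜ[k] (1 : H) := ha
    have hb' : ca.ρ b = b ⊗ₜ[k] (1 : H) := hb
    show ca.ρ (a * b) = (a * b) ⊗ₜ[k] (1 : H)
    rw [ca.coact_mul, ha', hb', Algebra.TensorProduct.tmul_mul_tmul, one_mul]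
  one_mem' := by
    show ca.ρ 1 = (1 : P) ⊗ₜ[k] (1 : H)
    rw [ca.coact_one, Algebra.TensorProduct.one_def]
  add_mem' := by
    intro a b ha hb
    have ha' : ca.ρ a = a ⊗ₜ[k] (1 : H) := ha
    have hb' : ca.ρ b = b ⊗ₜ[k] (1 : H) := hb
    show ca.ρ (a + b) = (a + b) ⊗ₜ[k] (1 : H)
    rw [map_add, ha', hb', TensorProduct.add_tmul]
  algebraMap_mem' := by
    intro r
    show ca.ρ (algebraMap k P r) = (algebraMap k P r) ⊗ₜ[k] (1 : H)
    rw [Algebra.algebraMap_eq_smul_one, map_smul, ca.coact_one, Algebra.TensorProduct.one_def,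
      TensorProduct.smul_tmul']

/-- The relations defining `P ⊗_B P` over the coinvariants. -/
def relB : Submodule k (P ⊗[k] P) :=
  Submodule.span k {z | ∃ (p q b : P), ca.ρ b = b ⊗ₜ[k] (1 : H) ∧
    z = (p * b) ⊗ₜ[k] q - p ⊗ₜ[k] (b * q)}

/-- `P ⊗_B P`. -/
abbrev PBP := (P ⊗[k] P) ⧸ ca.relB

/-- The canonical (Galois) map `χ : P ⊗_B P → P ⊗ H`, `q ⊗ p ↦ q p₍₀₎ ⊗ p₍₁₎`. -/
def chi : ca.PBP →ₗ[k] P ⊗[k] H :=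
  qtlift k ca.relB (fun p q => tlift k (fun q0 q1 => (p * q0) ⊗ₜ[k] q1) (ca.ρ q))

/-- The extension `B ⊆ P` is Hopf–Galois when `χ` is bijective. -/
def IsGalois : Prop := Function.Bijective ca.chi

/-- The translation map `τ(h) = χ⁻¹(1 ⊗ h) ∈ P ⊗_B P`. -/
def tau (h : H) : ca.PBP := Function.invFun ca.chi ((1 : P) ⊗ₜ[k] h)

/-- Relations for the tensor product `M ⊗_B P` of a right `B`-module with `P`. -/
def ffrel (M : Type v) [AddCommGroup M] [Module (↥ca.coinv)ᵐᵒᵖ M] :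
    Submodule ℤ (M ⊗[ℤ] P) :=
  Submodule.span ℤ {z | ∃ (m : M) (b : ↥ca.coinv) (p : P),
    z = (MulOpposite.op b • m) ⊗ₜ[ℤ] p - m ⊗ₜ[ℤ] ((b : P) * p)}

/-- `M ⊗_B P` for a right `B`-module `M`. -/
abbrev MTP (M : Type v) [AddCommGroup M] [Module (↥ca.coinv)ᵐᵒᵖ M] :=
  (M ⊗[ℤ] P) ⧸ ca.ffrel M

/-- The map `M ⊗_B P → N ⊗_B P` induced by `f : M → N`. -/
def ffmap {M N : Type v} [AddCommGroup M] [Module (↥ca.coinv)ᵐᵒᵖ M]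
    [AddCommGroup N] [Module (↥ca.coinv)ᵐᵒᵖ N] (f : M → N) : ca.MTP M →ₗ[ℤ] ca.MTP N :=
  qtlift ℤ (ca.ffrel M) (fun m p => Submodule.Quotient.mk (f m ⊗ₜ[ℤ] p))

/-- `P` is faithfully flat as a left `B`-module: tensoring right `B`-modules with `P` over `B`
preserves injectivity, and detects triviality. -/
def IsFaithfullyFlat : Prop :=
  (∀ (M N : Type v) [AddCommGroup M] [Module (↥ca.coinv)ᵐᵒᵖ M]
      [AddCommGroup N] [Module (↥ca.coinv)ᵐᵒᵖ N] (f : M →+ N),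
      (∀ (b : ↥ca.coinv) (m : M), f (MulOpposite.op b • m) = MulOpposite.op b • f m) →
      Function.Injective f → Function.Injective (ca.ffmap (⇑f))) ∧
  (∀ (M : Type v) [AddCommGroup M] [Module (↥ca.coinv)ᵐᵒᵖ M],
      Subsingleton (ca.MTP M) → Subsingleton M)

/-- The diagonal coaction `β(p ⊗ q) = p₍₀₎ ⊗ q₍₀₎ ⊗ p₍₁₎q₍₁₎` on `P ⊗ P^{op}`. -/
def betaA : (P ⊗[k] Pᵐᵒᵖ) →ₗ[k] (P ⊗[k] Pᵐᵒᵖ) ⊗[k] H :=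
  tlift k (fun p oq => tlift k (fun p0 p1 => tlift k (fun q0 q1 =>
    ((p0 ⊗ₜ[k] (MulOpposite.op q0) : P ⊗[k] Pᵐᵒᵖ)) ⊗ₜ[k] (p1 * q1))
      (ca.ρ (MulOpposite.unop oq))) (ca.ρ p))

/-- Multiplication `p ⊗ q ↦ pq` on `P ⊗ P^{op}`. -/
def mulA : (P ⊗[k] Pᵐᵒᵖ) →ₗ[k] P :=
  tlift k (fun p oq => p * MulOpposite.unop oq)

/-- A bundle automorphism: a unital algebra endomorphism of `P` which is `H`-equivariant
and restricts to an automorphism of the coinvariant subalgebra. -/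
def IsBundleAut (F : P →ₐ[k] P) : Prop :=
  (∀ p : P, ca.ρ (F p) = tlift k (fun p0 p1 => F p0 ⊗ₜ[k] p1) (ca.ρ p)) ∧
  Set.BijOn F {p : P | ca.ρ p = p ⊗ₜ[k] (1 : H)} {p : P | ca.ρ p = p ⊗ₜ[k] (1 : H)}

/-- Pairing of the Ehresmann–Schauenburg coproduct `Δ(p ⊗ q) = p₍₀₎ ⊗ τ(p₍₁₎) ⊗ q` against a
`B`-balanced bilinear form `G` on `A = P ⊗ P^{op}`. -/
def esDeltaEval (ca : ComodAlg k H P) {V : Type*} [AddCommGroup V] [Module k V]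
    (G : (P ⊗[k] Pᵐᵒᵖ) → (P ⊗[k] Pᵐᵒᵖ) → V) : (P ⊗[k] Pᵐᵒᵖ) →ₗ[k] V :=
  tlift k (fun p oq => tlift k (fun p0 p1 =>
    (qtlift k ca.relB (fun u v =>
      G ((p0 ⊗ₜ[k] MulOpposite.op u : P ⊗[k] Pᵐᵒᵖ)) ((v ⊗ₜ[k] oq : P ⊗[k] Pᵐᵒᵖ))))
      (ca.tau p1)) (ca.ρ p))

/-- The right adjoint coaction applied through `f`:  `h ↦ f(h₍₂₎) ⊗ (Sh₍₁₎)h₍₃₎`. -/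
def adCoaction (f : H → P) (h : H) : P ⊗[k] H :=
  tlift k (fun h1 h23 => tlift k (fun h2 h3 =>
    f h2 ⊗ₜ[k] (HopfAlgebra.antipode (R := k) h1 * h3)) (Coalgebra.comul (R := k) h23))
    (Coalgebra.comul (R := k) h)

/-- Convolution of maps `H → P`. -/
def convH (f g : H →ₗ[k] P) : H →ₗ[k] P :=
  (tlift k (fun h1 h2 => f h1 * g h2)).comp (Coalgebra.comul (R := k) (A := H))

/-- The convolution unit `h ↦ ε(h)1`. -/
def unitH : H →ₗ[k] P :=
  (Algebra.linearMap k P).comp (Coalgebra.counit (R := k) (A := H))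

/-- `Z̃¹(H,P)`: unital `H`-colinear maps `f : H → P` (for the right adjoint coaction on `H`)
with `p₍₀₎q₍₀₎ f(p₍₁₎q₍₁₎) = p₍₀₎ f(p₍₁₎) q₍₀₎ f(q₍₁₎)`. -/
def IsZt1 (ca : ComodAlg k H P) (f : H →ₗ[k] P) : Prop :=
  f 1 = 1 ∧ (∀ h : H, ca.ρ (f h) = adCoaction (⇑f) h) ∧
  (∀ p q : P,
    tlift k (fun p0 p1 => tlift k (fun q0 q1 => p0 * q0 * f (p1 * q1)) (ca.ρ q)) (ca.ρ p) =
    tlift k (fun p0 p1 => tlift k (fun q0 q1 => p0 * f p1 * (q0 * f q1)) (ca.ρ q)) (ca.ρ p))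

/-- Evaluation `h₁ ⊗ (u ⊗ v) ↦ u f(Sh₁) v`, used for the inverse in `Z̃¹(H,P)`. -/
def evalMid (f : H → P) : H ⊗[k] (P ⊗[k] P) →ₗ[k] P :=
  tlift k (fun h1 w => (tlift k (fun u v => u * f (HopfAlgebra.antipode (R := k) h1) * v)) w)

/-- The element `h₍₁₎ ⊗ τ(h₍₂₎) ∈ H ⊗ (P ⊗_B P)`. -/
def tauLeg (ca : ComodAlg k H P) (h : H) : H ⊗[k] ca.PBP :=
  tlift k (fun h1 h2 => h1 ⊗ₜ[k] ca.tau h2) (Coalgebra.comul (R := k) h)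

/-- Convolution of maps `H ⊗ H → P`. -/
def convHH (γ δ : H → H → P) (h g : H) : P :=
  tlift k (fun h1 h2 => tlift k (fun g1 g2 => γ h1 g1 * δ h2 g2)
    (Coalgebra.comul (R := k) g)) (Coalgebra.comul (R := k) h)

/-- `Z̃²(H,P)`:  the `H`-colinear elements of `Z²_{◁,as}(H,P)`. -/
def IsZt2 (ca : ComodAlg k H P) (act : P →ₗ[k] H →ₗ[k] P) (γ : H → H → P) : Prop :=
  (∃ γ' : H →ₗ[k] H →ₗ[k] P, ∀ h g, γ' h g = γ h g) ∧
  (∀ h : H, γ h 1 = algebraMap k P (Coalgebra.counit (R := k) h) ∧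
    γ 1 h = algebraMap k P (Coalgebra.counit (R := k) h)) ∧
  (∀ h g f : H,
    tlift k (fun h1 h2 => tlift k (fun g1 g2 => tlift k (fun f1 f2 =>
      act (γ g1 f1) h1 * γ h2 (f2 * g2)) (Coalgebra.comul (R := k) f))
        (Coalgebra.comul (R := k) g)) (Coalgebra.comul (R := k) h) =
    tlift k (fun h1 h2 => tlift k (fun g1 g2 =>
      γ h1 g1 * γ (g2 * h2) f) (Coalgebra.comul (R := k) g)) (Coalgebra.comul (R := k) h)) ∧
  (∀ (h g : H) (b : P),
    tlift k (fun h1 h2 => tlift k (fun g1 g2 => γ h1 g1 * act b (g2 * h2))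
      (Coalgebra.comul (R := k) g)) (Coalgebra.comul (R := k) h) =
    tlift k (fun h1 h2 => tlift k (fun g1 g2 => act b (g1 * h1) * γ h2 g2)
      (Coalgebra.comul (R := k) g)) (Coalgebra.comul (R := k) h)) ∧
  (∀ h g : H, ca.ρ (γ h g) =
    tlift k (fun h1 h23 => tlift k (fun h2 h3 => tlift k (fun g1 g23 => tlift k (fun g2 g3 =>
      γ h2 g2 ⊗ₜ[k] (HopfAlgebra.antipode (R := k) (g1 * h1) * (g3 * h3)))
        (Coalgebra.comul (R := k) g23)) (Coalgebra.comul (R := k) g))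
      (Coalgebra.comul (R := k) h23)) (Coalgebra.comul (R := k) h)) ∧
  (∃ γi : H → H → P, (∃ γi' : H →ₗ[k] H →ₗ[k] P, ∀ h g, γi' h g = γi h g) ∧
    (∀ h g : H, convHH (k := k) γ γi h g =
      algebraMap k P (Coalgebra.counit (R := k) h * Coalgebra.counit (R := k) g)) ∧
    (∀ h g : H, convHH (k := k) γi γ h g =
      algebraMap k P (Coalgebra.counit (R := k) h * Coalgebra.counit (R := k) g)))

/-- `C̃¹(H,P)`: unital convolution-invertible `H`-colinear maps `f : H → P`, commuting
with `B` in the sense `p₍₀₎ b f(p₍₁₎) = p₍₀₎ f(p₍₁₎) b`. -/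
def IsCt1 (ca : ComodAlg k H P) (f : H →ₗ[k] P) : Prop :=
  f 1 = 1 ∧ (∀ h : H, ca.ρ (f h) = adCoaction (⇑f) h) ∧
  (∀ p b : P, ca.ρ b = b ⊗ₜ[k] (1 : H) →
    tlift k (fun p0 p1 => p0 * b * f p1) (ca.ρ p) =
      tlift k (fun p0 p1 => p0 * f p1 * b) (ca.ρ p)) ∧
  ∃ fi : H →ₗ[k] P, convH f fi = unitH ∧ convH fi f = unitH

/-- `γ^f(h,g) := (f⁻¹(g₍₁₎) ◁ h₍₁₎) f⁻¹(h₍₂₎) γ(h₍₃₎, g₍₂₎) f(g₍₃₎ h₍₄₎)`. -/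
def gamF (act : P →ₗ[k] H →ₗ[k] P) (f fi : H → P) (γ : H → H → P) (h g : H) : P :=
  tlift k (fun h1 h234 => tlift k (fun h2 h34 => tlift k (fun h3 h4 =>
    tlift k (fun g1 g23 => tlift k (fun g2 g3 =>
      act (fi g1) h1 * fi h2 * γ h3 g2 * f (g3 * h4)) (Coalgebra.comul (R := k) g23))
      (Coalgebra.comul (R := k) g))
    (Coalgebra.comul (R := k) h34)) (Coalgebra.comul (R := k) h234)) (Coalgebra.comul (R := k) h)

end ComodAlg

section ES

variable {B0 L0 : Type v} [Ring B0] [Algebra k B0] [Ring L0] [Algebra k L0]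

/-- The value of the 2-cocycle `Γ_γ(p ⊗ p', q ⊗ q') = p₍₀₎ q₍₀₎ γ(q₍₁₎, p₍₁₎) q' p'` on the
Ehresmann–Schauenburg bialgebroid, computed in `P` through an embedding `ι`. -/
def GammaOf (ca : ComodAlg k H P) (ι : L0 →ₐ[k] (P ⊗[k] Pᵐᵒᵖ)) (γ : H → H → P)
    (z w : L0) : P :=
  tlift k (fun p op' => tlift k (fun q oq' => tlift k (fun p0 p1 => tlift k (fun q0 q1 =>
    p0 * q0 * γ q1 p1 * MulOpposite.unop oq' * MulOpposite.unop op') (ca.ρ q)) (ca.ρ p))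
      (ι w)) (ι z)

end ES

end

noncomputable section

universe u v

open Coalgebra (comul counit)

/-- The function `f` is `k`-linear. -/
@[fun_prop]
structure Lin (k : Type*) [CommRing k] {M N : Type*} [AddCommGroup M] [Module k M]
    [AddCommGroup N] [Module k N] (f : M → N) : Prop where
  map_add : ∀ x y, f (x + y) = f x + f y
  map_smul : ∀ (c : k) x, f (c • x) = c • f x

namespace Lin
variable {k : Type*} [CommRing k] {M N Q M' A : Type*}
  [AddCommGroup M] [Module k M] [AddCommGroup N] [Module k N]
  [AddCommGroup Q] [Module k Q] [AddCommGroup M'] [Module k M']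
  [Ring A] [Algebra k A]

@[fun_prop] theorem id' : Lin k (fun x : M => x) := ⟨fun _ _ => rfl, fun _ _ => rfl⟩
@[fun_prop] theorem comp' {f : N → Q} {g : M → N} (hf : Lin k f) (hg : Lin k g) :
    Lin k (fun x => f (g x)) :=
  ⟨fun x y => by rw [hg.map_add, hf.map_add], fun c x => by rw [hg.map_smul, hf.map_smul]⟩
@[fun_prop] theorem linMap (f : M →ₗ[k] N) : Lin k (fun x => f x) := ⟨f.map_add, f.map_smul⟩
@[fun_prop] theorem linEquiv (f : M ≃ₗ[k] N) : Lin k (fun x => f x) :=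
  ⟨_root_.map_add f, _root_.map_smul f⟩
@[fun_prop] theorem linMap_apply {f : M → (N →ₗ[k] Q)} (hf : Lin k f) (y : N) :
    Lin k (fun x => f x y) :=
  ⟨fun a b => by rw [hf.map_add]; rfl, fun c x => by rw [hf.map_smul]; rfl⟩
@[fun_prop] theorem sub' {f g : M → N} (hf : Lin k f) (hg : Lin k g) : Lin k (fun x => f x - g x) :=
  ⟨fun x y => by rw [hg.map_add, hf.map_add]; abel,
    fun c x => by rw [hg.map_smul, hf.map_smul, smul_sub]⟩
@[fun_prop] theorem mul_left' {f : M → A} (hf : Lin k f) (a : A) : Lin k (fun x => f x * a) :=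
  ⟨fun x y => by rw [hf.map_add, add_mul], fun c x => by rw [hf.map_smul, smul_mul_assoc]⟩
@[fun_prop] theorem mul_right' {f : M → A} (hf : Lin k f) (a : A) : Lin k (fun x => a * f x) :=
  ⟨fun x y => by rw [hf.map_add, mul_add], fun c x => by rw [hf.map_smul, mul_smul_comm]⟩
@[fun_prop] theorem tmul_left' {f : M → N} (hf : Lin k f) (a : Q) : Lin k (fun x => f x ⊗ₜ[k] a) :=
  ⟨fun x y => by rw [hf.map_add, add_tmul], fun c x => by rw [hf.map_smul, smul_tmul']⟩
@[fun_prop] theorem tmul_right' {f : M → N} (hf : Lin k f) (a : Q) : Lin k (fun x => a ⊗ₜ[k] f x) :=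
  ⟨fun x y => by rw [hf.map_add, tmul_add], fun c x => by rw [hf.map_smul, tmul_smul]⟩
@[fun_prop] theorem smul_left' {f : M → k} (hf : Lin k f) (a : N) : Lin k (fun x => f x • a) :=
  ⟨fun x y => by rw [hf.map_add, add_smul], fun c x => by rw [hf.map_smul, smul_eq_mul, mul_smul]⟩
@[fun_prop] theorem smul_right' {f : M → N} (hf : Lin k f) (a : k) : Lin k (fun x => a • f x) :=
  ⟨fun x y => by rw [hf.map_add, smul_add], fun c x => by rw [hf.map_smul, smul_comm]⟩
@[fun_prop] theorem algHom {B : Type*} [Ring B] [Algebra k B] (f : A →ₐ[k] B) :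
    Lin k (fun x => f x) :=
  ⟨_root_.map_add f, _root_.map_smul f⟩
@[fun_prop] theorem op' : Lin k (fun x : A => MulOpposite.op x) := ⟨fun _ _ => rfl, fun _ _ => rfl⟩
@[fun_prop] theorem unop' : Lin k (fun x : Aᵐᵒᵖ => MulOpposite.unop x) :=
  ⟨fun _ _ => rfl, fun _ _ => rfl⟩
end Lin

section
variable {k : Type*} [CommRing k] {M N Q M' A R : Type*}
  [AddCommGroup M] [Module k M] [AddCommGroup N] [Module k N]
  [AddCommGroup Q] [Module k Q] [AddCommGroup M'] [Module k M'] [AddCommGroup R] [Module k R]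

theorem tlift_tmul {f : M → N → Q} (h1 : ∀ y, Lin k (fun x => f x y))
    (h2 : ∀ x, Lin k (fun y => f x y)) (x : M) (y : N) : tlift k f (x ⊗ₜ[k] y) = f x y := by
  have h : ∃ F : M ⊗[k] N →ₗ[k] Q, ∀ x y, F (x ⊗ₜ[k] y) = f x y :=
    ⟨TensorProduct.lift (LinearMap.mk₂ k f (fun a b y => (h1 y).map_add a b)
      (fun c a y => (h1 y).map_smul c a) (fun x a b => (h2 x).map_add a b) (fun c x a => (h2 x).map_smul c a)), fun x y => by simp⟩
  rw [tlift, dif_pos h]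
  exact h.choose_spec x y

@[fun_prop] theorem Lin.tlift_of {f : M → N → Q} {z : M' → M ⊗[k] N} (hz : Lin k z) :
    Lin k (fun a => tlift k f (z a)) :=
  (Lin.linMap (tlift k f)).comp' hz

@[fun_prop] theorem Lin.tlift_fun {f : M' → M → N → Q}
    (h0 : ∀ x y, Lin k (fun a => f a x y)) (h1 : ∀ a y, Lin k (fun x => f a x y))
    (h2 : ∀ a x, Lin k (fun y => f a x y))
  (z : M ⊗[k] N) : Lin k (fun a => tlift k (f a) z) := by
  constructor
  · intro a b
    induction z with
    | zero => simp
    | add x y hx hy => simp only [_root_.map_add, hx, hy]; abel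
    | tmul x y =>
      rw [tlift_tmul (h1 _) (h2 _), tlift_tmul (h1 _) (h2 _), tlift_tmul (h1 _) (h2 _),
        (h0 x y).map_add]
  · intro a b
    induction z with
    | zero => simp
    | add x y hx hy => simp only [_root_.map_add, hx, hy, smul_add]
    | tmul x y => rw [tlift_tmul (h1 _) (h2 _), tlift_tmul (h1 _) (h2 _), (h0 x y).map_smul]
end

section
variable {k : Type*} [CommRing k] {M N Q M' N' A R : Type*} [AddCommGroup M] [Module k M]
  [AddCommGroup N] [Module k N] [AddCommGroup Q] [Module k Q] [AddCommGroup M'] [Module k M']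
  [AddCommGroup N'] [Module k N'] [AddCommGroup R] [Module k R] [Ring A] [Algebra k A]

/-- The linear map underlying a linear function. -/
def Lin.toMap {f : M → N} (h : Lin k f) : M →ₗ[k] N where
  toFun := f
  map_add' := h.map_add
  map_smul' := h.map_smul

@[simp] theorem Lin.toMap_apply {f : M → N} (h : Lin k f) (x : M) : h.toMap x = f x := rfl

/-- The bilinear map underlying a bilinear function. -/
def Lin.toMap₂ {f : M → N → Q} (h1 : ∀ y, Lin k (fun x => f x y))
    (h2 : ∀ x, Lin k (fun y => f x y)) : M →ₗ[k] N →ₗ[k] Q :=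
  LinearMap.mk₂ k f (fun a b y => (h1 y).map_add a b) (fun c a y => (h1 y).map_smul c a)
       (fun x a b => (h2 x).map_add a b) (fun c x a => (h2 x).map_smul c a)

@[simp] theorem Lin.toMap₂_apply {f : M → N → Q} (h1 : ∀ y, Lin k (fun x => f x y))
    (h2 : ∀ x, Lin k (fun y => f x y)) (x : M) (y : N) : Lin.toMap₂ h1 h2 x y = f x y := rfl

theorem tensor_hom_ext {f g : M ⊗[k] N → Q} (z : M ⊗[k] N) (hf : Lin k f) (hg : Lin k g)
    (h : ∀ x y, f (x ⊗ₜ y) = g (x ⊗ₜ y)) : f z = g z :=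
  LinearMap.congr_fun (TensorProduct.ext' (g := hf.toMap) (h := hg.toMap) h) z

theorem map_tlift {L : Q → R} (hL : Lin k L) {f : M → N → Q} (h1 : ∀ y, Lin k (fun x => f x y))
    (h2 : ∀ x, Lin k (fun y => f x y)) (z : M ⊗[k] N) :
    L (tlift k f z) = tlift k (fun x y => L (f x y)) z := by
  apply tensor_hom_ext z (hf := by fun_prop) (hg := by fun_prop)
  intro x y
  simp (disch := fun_prop) only [tlift_tmul]

theorem mul_tlift (a : A) {f : M → N → A} (h1 : ∀ y, Lin k (fun x => f x y))
    (h2 : ∀ x, Lin k (fun y => f x y)) (z : M ⊗[k] N) :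
    a * tlift k f z = tlift k (fun x y => a * f x y) z :=
  map_tlift (L := fun b => a * b) (by fun_prop) h1 h2 z

theorem tlift_mul (a : A) {f : M → N → A} (h1 : ∀ y, Lin k (fun x => f x y))
    (h2 : ∀ x, Lin k (fun y => f x y)) (z : M ⊗[k] N) :
    tlift k f z * a = tlift k (fun x y => f x y * a) z :=
  map_tlift (L := fun b => b * a) (by fun_prop) h1 h2 z

theorem tlift_tlift {f : M' → N' → Q} {g : M → N → M' ⊗[k] N'} (g1 : ∀ y, Lin k (fun x => g x y))
    (g2 : ∀ x, Lin k (fun y => g x y)) (z : M ⊗[k] N) :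
    tlift k f (tlift k g z) = tlift k (fun x y => tlift k f (g x y)) z :=
  map_tlift (L := fun b => tlift k f b) (by fun_prop) g1 g2 z

theorem tlift_swap {f : M → N → M' → N' → Q} (h1 : ∀ y z w, Lin k (fun x => f x y z w))
    (h2 : ∀ x z w, Lin k (fun y => f x y z w)) (h3 : ∀ x y w, Lin k (fun z => f x y z w))
    (h4 : ∀ x y z, Lin k (fun w => f x y z w)) (z : M ⊗[k] N) (w : M' ⊗[k] N') :
    tlift k (fun x y => tlift k (fun a b => f x y a b) w) z =
      tlift k (fun a b => tlift k (fun x y => f x y a b) z) w := by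
  apply tensor_hom_ext z (hf := by fun_prop) (hg := by fun_prop)
  intro x y
  simp (disch := fun_prop) only [tlift_tmul]

theorem tlift_tmul_self (z : M ⊗[k] N) : tlift k (fun x y => x ⊗ₜ[k] y) z = z := by
  apply tensor_hom_ext z (hf := by fun_prop) (hg := by fun_prop)
  intro x y
  simp (disch := fun_prop) only [tlift_tmul]

theorem qtlift_mk {p : Submodule k (M ⊗[k] N)} {f : M → N → Q} (h1 : ∀ y, Lin k (fun x => f x y))
    (h2 : ∀ x, Lin k (fun y => f x y)) (hp : ∀ z ∈ p, tlift k f z = 0) (z : M ⊗[k] N) :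
    qtlift k p f (Submodule.Quotient.mk z) = tlift k f z := by
  have h : ∃ F : ((M ⊗[k] N) ⧸ p) →ₗ[k] Q,
      ∀ x y, F (Submodule.Quotient.mk (x ⊗ₜ[k] y)) = f x y := by
    refine ⟨p.liftQ (tlift k f) (fun z hz => hp z hz), fun x y => ?_⟩
    exact (Submodule.liftQ_apply p (tlift k f) _).trans (tlift_tmul h1 h2 x y)
  rw [qtlift, dif_pos h]
  have h3 := h.choose_spec
  revert h3
  generalize h.choose = F
  intro h3
  refine tensor_hom_ext (f := fun z => F (Submodule.Quotient.mk z))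
    z ((Lin.linMap F).comp' (Lin.linMap p.mkQ)) (by fun_prop) (fun x y => ?_)
  rw [h3, tlift_tmul h1 h2]

end

namespace ComodAlg
variable {k : Type u} [Field k] {H P : Type v} [Ring H] [HopfAlgebra k H]
  [Ring P] [Algebra k P] (ca : ComodAlg k H P)
  {V W : Type*} [AddCommGroup V] [Module k V] [AddCommGroup W] [Module k W]

theorem coact_coassoc {φ : P → H → H → V} (h1 : ∀ y z, Lin k (fun x => φ x y z))
    (h2 : ∀ x z, Lin k (fun y => φ x y z)) (h3 : ∀ x y, Lin k (fun z => φ x y z)) (p : P) :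
    tlift k (fun p0 p1 => tlift k (fun q0 q1 => φ q0 q1 p1) (ca.ρ p0)) (ca.ρ p) =
      tlift k (fun p0 p1 => tlift k (fun a b => φ p0 a b) (comul (R := k) p1)) (ca.ρ p) := by
  have h := congrArg (tlift k (fun p hh => tlift k (fun a b => φ p a b) hh)) (ca.coassoc p)
  simp (disch := fun_prop) only [tlift_tlift, tlift_tmul] at h
  exact h.symm

theorem tensor_mul {A B : Type*} [Ring A] [Algebra k A] [Ring B] [Algebra k B] {φ : A → B → V}
    (h1 : ∀ y, Lin k (fun x => φ x y)) (h2 : ∀ x, Lin k (fun y => φ x y)) (z w : A ⊗[k] B) :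
    tlift k φ (z * w) = tlift k (fun x y => tlift k (fun a b => φ (x * a) (y * b)) w) z := by
  apply tensor_hom_ext z (hf := by fun_prop) (hg := by fun_prop)
  intro x y
  simp (disch := fun_prop) only [tlift_tmul]
  apply tensor_hom_ext w (hf := by fun_prop) (hg := by fun_prop)
  intro a b
  simp (disch := fun_prop) only [tlift_tmul, Algebra.TensorProduct.tmul_mul_tmul]

theorem tlift_coact_mul {φ : P → H → V}
    (h1 : ∀ y, Lin k (fun x => φ x y)) (h2 : ∀ x, Lin k (fun y => φ x y)) (p q : P) :
    tlift k φ (ca.ρ (p * q)) =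
      tlift k (fun p0 p1 => tlift k (fun q0 q1 => φ (p0 * q0) (p1 * q1)) (ca.ρ q)) (ca.ρ p) := by
  rw [ca.coact_mul, tensor_mul h1 h2]

theorem tlift_coinv_mul {φ : P → H → V}
    (h1 : ∀ y, Lin k (fun x => φ x y)) (h2 : ∀ x, Lin k (fun y => φ x y)) {b : P}
    (hb : ca.ρ b = b ⊗ₜ[k] (1 : H)) (q : P) :
    tlift k φ (ca.ρ (b * q)) = tlift k (fun q0 q1 => φ (b * q0) q1) (ca.ρ q) := by
  rw [ca.tlift_coact_mul h1 h2, hb]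
  simp (disch := fun_prop) only [tlift_tmul, one_mul]

theorem tlift_mul_coinv {φ : P → H → V}
    (h1 : ∀ y, Lin k (fun x => φ x y)) (h2 : ∀ x, Lin k (fun y => φ x y)) {b : P}
    (hb : ca.ρ b = b ⊗ₜ[k] (1 : H)) (q : P) :
    tlift k φ (ca.ρ (q * b)) = tlift k (fun q0 q1 => φ (q0 * b) q1) (ca.ρ q) := by
  rw [ca.tlift_coact_mul h1 h2, hb]
  simp (disch := fun_prop) only [tlift_tmul, mul_one]

/-- The canonical map before passing to the quotient. -/
def chiLift : P ⊗[k] P →ₗ[k] P ⊗[k] H :=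
  tlift k (fun p q => tlift k (fun q0 q1 => (p * q0) ⊗ₜ[k] q1) (ca.ρ q))

theorem tlift_relB {f : P → P → V} (h1 : ∀ y, Lin k (fun x => f x y))
    (h2 : ∀ x, Lin k (fun y => f x y))
    (hb : ∀ b, ca.ρ b = b ⊗ₜ[k] (1 : H) → ∀ p q, f (p * b) q = f p (b * q))
    (z : P ⊗[k] P) (hz : z ∈ ca.relB) : tlift k f z = 0 := by
  rw [← LinearMap.mem_ker]
  revert z
  change ca.relB ≤ _
  rw [relB, Submodule.span_le]
  rintro z ⟨p, q, b, h, rfl⟩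
  rw [SetLike.mem_coe, LinearMap.mem_ker, map_sub, tlift_tmul h1 h2, tlift_tmul h1 h2, hb b h,
    sub_self]

theorem chi_mk (z : P ⊗[k] P) : ca.chi (Submodule.Quotient.mk z) = ca.chiLift z := by
  refine qtlift_mk (by fun_prop) (by fun_prop) (ca.tlift_relB (by fun_prop) (by fun_prop) ?_) z
  intro b hb p q
  simp (disch := fun_prop) only [ca.tlift_coinv_mul _ _ hb, mul_assoc]

theorem exists_tauLift (hGal : ca.IsGalois) :
    ∃ T : H →ₗ[k] P ⊗[k] P, ∀ h, Submodule.Quotient.mk (T h) = ca.tau h := by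
  obtain ⟨s, hs⟩ := LinearMap.exists_rightInverse_of_surjective ca.relB.mkQ
    (LinearMap.range_eq_top.2 (Submodule.mkQ_surjective _))
  let e := LinearEquiv.ofBijective ca.chi hGal
  refine ⟨s ∘ₗ e.symm.toLinearMap ∘ₗ TensorProduct.mk k P H 1, fun h => ?_⟩
  have h1 := LinearMap.congr_fun hs (e.symm (1 ⊗ₜ h))
  refine h1.trans (hGal.1 ?_)
  have h2 : ca.chi (ca.tau h) = 1 ⊗ₜ h := Function.invFun_eq (hGal.2 _)
  rw [h2]
  exact e.apply_symm_apply _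

/-- A linear lift of the translation map to `P ⊗ P`. -/
def tauLift (hGal : ca.IsGalois) : H →ₗ[k] P ⊗[k] P := (ca.exists_tauLift hGal).choose

theorem mk_tauLift (hGal : ca.IsGalois) (h : H) :
    Submodule.Quotient.mk (ca.tauLift hGal h) = ca.tau h :=
  (ca.exists_tauLift hGal).choose_spec h

theorem chiLift_tauLift (hGal : ca.IsGalois) (h : H) :
    ca.chiLift (ca.tauLift hGal h) = 1 ⊗ₜ h := by
  rw [← chi_mk, mk_tauLift]
  exact Function.invFun_eq (hGal.2 _)

theorem tauLift_coact (hGal : ca.IsGalois) {φ : P → H → V} (h1 : ∀ y, Lin k (fun x => φ x y))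
    (h2 : ∀ x, Lin k (fun y => φ x y)) (h : H) :
    tlift k (fun u v => tlift k (fun v0 v1 => φ (u * v0) v1) (ca.ρ v)) (ca.tauLift hGal h) =
      φ 1 h := by
  have h := congrArg (tlift k φ) (ca.chiLift_tauLift hGal h)
  simp (disch := fun_prop) only [chiLift, tlift_tlift, tlift_tmul] at h
  exact h

theorem tauLift_mul (hGal : ca.IsGalois) {f : P → V} (hf : Lin k f) (h : H) :
    tlift k (fun u v => f (u * v)) (ca.tauLift hGal h) = counit (R := k) h • f 1 := by
  have h1 := ca.tauLift_coact hGal (φ := fun p h => counit (R := k) h • f p) (by fun_prop)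
    (by fun_prop) h
  rw [← h1]
  congr 2
  ext u v
  have h2 := congrArg (fun v => f (u * v)) (ca.counit_coact v)
  beta_reduce at h2
  rw [mul_tlift _ (by fun_prop) (by fun_prop), map_tlift hf (by fun_prop) (by fun_prop)] at h2
  rw [← h2]
  congr 2
  ext a b
  rw [mul_smul_comm, hf.map_smul]

theorem coact_tauLift (hGal : ca.IsGalois) {f : P → P → V} (h1 : ∀ y, Lin k (fun x => f x y))
    (h2 : ∀ x, Lin k (fun y => f x y))
    (hb : ∀ b, ca.ρ b = b ⊗ₜ[k] (1 : H) → ∀ p q, f (p * b) q = f p (b * q)) (p : P) :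
    tlift k (fun p0 p1 => tlift k (fun u v => f (p0 * u) v) (ca.tauLift hGal p1)) (ca.ρ p) =
      f 1 p := by
  have key : tlift k (fun p0 p1 => tlift k (fun u v => (p0 * u) ⊗ₜ[k] v) (ca.tauLift hGal p1))
      (ca.ρ p) - 1 ⊗ₜ p ∈ ca.relB := by
    rw [← Submodule.Quotient.eq]
    refine hGal.1 ?_
    rw [chi_mk, chi_mk, map_tlift (L := fun z => ca.chiLift z) (by fun_prop) (by fun_prop)
      (by fun_prop)]
    have h3 : ∀ p0 p1, ca.chiLift (tlift k (fun u v => (p0 * u) ⊗ₜ[k] v) (ca.tauLift hGal p1)) =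
        p0 ⊗ₜ p1 := by
      intro p0 p1
      rw [map_tlift (L := fun z => ca.chiLift z) (by fun_prop) (by fun_prop) (by fun_prop)]
      have h4 := ca.tauLift_coact hGal (φ := fun p h => (p0 * p) ⊗ₜ[k] h) (by fun_prop)
        (by fun_prop) p1
      rw [mul_one] at h4
      rw [← h4]
      simp (disch := fun_prop) only [chiLift, tlift_tmul, mul_assoc]
    simp only [h3]
    simp (disch := fun_prop) only [chiLift, tlift_tmul, one_mul]
  have h5 := ca.tlift_relB h1 h2 hb _ key
  rw [map_sub, sub_eq_zero] at h5
  simp (disch := fun_prop) only [tlift_tlift, tlift_tmul] at h5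
  exact h5

section cancel
variable {V : Type*} [Ring V] [Algebra k V]

theorem coact_cancel (hGal : ca.IsGalois) (j : P →ₐ[k] V) {φ ψ : H → V} (hφ : Lin k φ)
    (hψ : Lin k ψ) (h : ∀ q, tlift k (fun q0 q1 => j q0 * φ q1) (ca.ρ q) =
      tlift k (fun q0 q1 => j q0 * ψ q1) (ca.ρ q)) (x : H) : φ x = ψ x := by
  have key : ∀ φ : H → V, Lin k φ → φ x = tlift k (fun u v =>
      j u * tlift k (fun q0 q1 => j q0 * φ q1) (ca.ρ v)) (ca.tauLift hGal x) := by
    intro φ hφ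
    have := ca.tauLift_coact hGal (φ := fun p h => j p * φ h) (by fun_prop) (by fun_prop) x
    rw [map_one, one_mul] at this
    rw [← this]
    simp (disch := fun_prop) only [map_mul, mul_tlift, mul_assoc]
  rw [key φ hφ, key ψ hψ]
  simp only [h]

/-- The map `(p, q) ↦ p₍₀₎ q₍₀₎ f(q₍₁₎ ⊗ p₍₁₎)`. -/
def twist (j : P →ₐ[k] V) (f : H ⊗[k] H →ₗ[k] V) : P →ₗ[k] P →ₗ[k] V :=
  Lin.toMap₂ (f := fun p q => tlift k (fun p0 p1 => tlift k (fun q0 q1 =>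
    j p0 * j q0 * f (q1 ⊗ₜ p1)) (ca.ρ q)) (ca.ρ p)) (by fun_prop) (by fun_prop)

theorem twist_apply (j : P →ₐ[k] V) (f : H ⊗[k] H →ₗ[k] V) (p q : P) :
    ca.twist j f p q = tlift k (fun p0 p1 => tlift k (fun q0 q1 =>
      j p0 * j q0 * f (q1 ⊗ₜ p1)) (ca.ρ q)) (ca.ρ p) := rfl

theorem twist_apply' (j : P →ₐ[k] V) (f : H ⊗[k] H →ₗ[k] V) (p q : P) :
    ca.twist j f p q = tlift k (fun p0 p1 => j p0 * tlift k (fun q0 q1 =>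
      j q0 * f (q1 ⊗ₜ p1)) (ca.ρ q)) (ca.ρ p) := by
  simp (disch := fun_prop) only [twist_apply, mul_tlift, mul_assoc]

theorem twist_cancel (hGal : ca.IsGalois) (j : P →ₐ[k] V) {f g : H ⊗[k] H →ₗ[k] V}
    (h : ∀ p q, ca.twist j f p q = ca.twist j g p q) : f = g := by
  refine TensorProduct.ext' fun a b => ?_
  refine ca.coact_cancel hGal j (φ := fun a => f (a ⊗ₜ b)) (ψ := fun a => g (a ⊗ₜ b))
    (by fun_prop) (by fun_prop) (fun q => ?_) a
  refine ca.coact_cancel hGal j (φ := fun b => tlift k (fun q0 q1 => j q0 * f (q1 ⊗ₜ b)) (ca.ρ q))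
    (ψ := fun b => tlift k (fun q0 q1 => j q0 * g (q1 ⊗ₜ b)) (ca.ρ q))
    (by fun_prop) (by fun_prop) (fun p => ?_) b
  rw [← twist_apply', ← twist_apply', h]

end cancel
end ComodAlg

section Conv
variable {k : Type u} [Field k] {H : Type v} [Ring H] [HopfAlgebra k H]
  {V W : Type*} [Ring V] [Algebra k V] [Ring W] [Algebra k W]

/-- The convolution product of linear maps on `H ⊗ H`. -/
def cv (f g : H ⊗[k] H →ₗ[k] V) : H ⊗[k] H →ₗ[k] V :=
  (WithConv.toConv f * WithConv.toConv g).ofConv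

/-- The convolution unit. -/
def cvOne (k : Type u) [Field k] (H : Type v) [Ring H] [HopfAlgebra k H] (V : Type*) [Ring V]
    [Algebra k V] : H ⊗[k] H →ₗ[k] V :=
  (1 : WithConv (H ⊗[k] H →ₗ[k] V)).ofConv

theorem cv_assoc (f g h : H ⊗[k] H →ₗ[k] V) : cv (cv f g) h = cv f (cv g h) :=
  congrArg WithConv.ofConv (mul_assoc (WithConv.toConv f) (WithConv.toConv g) (WithConv.toConv h))

theorem cv_one (f : H ⊗[k] H →ₗ[k] V) : cv f (cvOne k H V) = f :=
  congrArg WithConv.ofConv (mul_one (WithConv.toConv f))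

theorem one_cv (f : H ⊗[k] H →ₗ[k] V) : cv (cvOne k H V) f = f :=
  congrArg WithConv.ofConv (one_mul (WithConv.toConv f))

theorem cvOne_tmul (a b : H) : cvOne k H V (a ⊗ₜ b) =
    algebraMap k V (counit (R := k) a * counit (R := k) b) := by
  rw [cvOne, LinearMap.convOne_apply, TensorProduct.counit_tmul, smul_eq_mul, mul_comm]

theorem cv_tmul (f g : H ⊗[k] H →ₗ[k] V) (a b : H) : cv f g (a ⊗ₜ b) =
    tlift k (fun a1 a2 => tlift k (fun b1 b2 => f (a1 ⊗ₜ b1) * g (a2 ⊗ₜ b2))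
      (comul (R := k) b)) (comul (R := k) a) := by
  rw [cv, LinearMap.convMul_apply, TensorProduct.comul_tmul]
  generalize comul (R := k) a = z
  generalize comul (R := k) b = w
  apply tensor_hom_ext z (hf := by fun_prop) (hg := by fun_prop)
  intro a1 a2
  apply tensor_hom_ext w (hf := by fun_prop) (hg := by fun_prop)
  intro b1 b2
  simp (disch := fun_prop) [tlift_tmul]

theorem algHom_cv (φ : V →ₐ[k] W) (f g : H ⊗[k] H →ₗ[k] V) :
    φ.toLinearMap ∘ₗ cv f g = cv (φ.toLinearMap ∘ₗ f) (φ.toLinearMap ∘ₗ g) := by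
  refine TensorProduct.ext' fun a b => ?_
  rw [LinearMap.comp_apply, cv_tmul, cv_tmul, map_tlift (L := fun x => φ.toLinearMap x)
    (by fun_prop) (by fun_prop) (by fun_prop)]
  congr 2
  ext a1 a2
  rw [map_tlift (L := fun x => φ.toLinearMap x) (by fun_prop) (by fun_prop) (by fun_prop)]
  simp

theorem algHom_cvOne (φ : V →ₐ[k] W) : φ.toLinearMap ∘ₗ cvOne k H V = cvOne k H W := by
  refine TensorProduct.ext' fun a b => ?_
  simp [cvOne_tmul]

end Conv

namespace ComodAlg
variable {k : Type u} [Field k] {H P : Type v} [Ring H] [HopfAlgebra k H]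
  [Ring P] [Algebra k P] (ca : ComodAlg k H P) {V : Type*} [Ring V] [Algebra k V]

theorem twist_cv (j : P →ₐ[k] V) (f g : H ⊗[k] H →ₗ[k] V) (p q : P) :
    ca.twist j (cv f g) p q = tlift k (fun p0 p1 => tlift k (fun q0 q1 =>
      ca.twist j f p0 q0 * g (q1 ⊗ₜ p1)) (ca.ρ q)) (ca.ρ p) := by
  have h1 : ∀ p0 p1, tlift k (fun q0 q1 => j p0 * j q0 * cv f g (q1 ⊗ₜ p1)) (ca.ρ q) =
      tlift k (fun b1 b2 => tlift k (fun q0 q1 => tlift k (fun a0 a1 =>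
        j p0 * j a0 * (f (a1 ⊗ₜ b1) * g (q1 ⊗ₜ b2))) (ca.ρ q0)) (ca.ρ q))
        (comul (R := k) p1) := by
    intro p0 p1
    rw [← tlift_swap (by fun_prop) (by fun_prop) (by fun_prop) (by fun_prop)]
    simp (disch := fun_prop) only [cv_tmul, mul_tlift]
    rw [← ca.coact_coassoc (φ := fun q0 a1 a2 => tlift k (fun b1 b2 =>
      j p0 * j q0 * (f (a1 ⊗ₜ b1) * g (a2 ⊗ₜ b2))) (comul (R := k) p1)) (by fun_prop)
      (by fun_prop) (by fun_prop)]
    congr 2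
    ext q0 q1
    rw [tlift_swap (by fun_prop) (by fun_prop) (by fun_prop) (by fun_prop)]
  rw [twist_apply]
  simp only [h1]
  rw [← ca.coact_coassoc (φ := fun p0 b1 b2 => tlift k (fun q0 q1 => tlift k (fun a0 a1 =>
        j p0 * j a0 * (f (a1 ⊗ₜ b1) * g (q1 ⊗ₜ b2))) (ca.ρ q0)) (ca.ρ q)) (by fun_prop)
      (by fun_prop) (by fun_prop)]
  congr 2
  ext p0 p1
  rw [tlift_swap (by fun_prop) (by fun_prop) (by fun_prop) (by fun_prop)]
  simp (disch := fun_prop) only [twist_apply, tlift_mul, mul_assoc]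

end ComodAlg

namespace ComodAlg
variable {k : Type u} [Field k] {H P : Type v} [Ring H] [HopfAlgebra k H]
  [Ring P] [Algebra k P] (ca : ComodAlg k H P) {V : Type*} [Ring V] [Algebra k V]

/-- The coaction as an algebra homomorphism. -/
def coactHom : P →ₐ[k] P ⊗[k] H := AlgHom.ofLinearMap ca.ρ ca.coact_one ca.coact_mul

theorem coactHom_apply (p : P) : ca.coactHom p = ca.ρ p := rfl

/-- The map `p ↦ p ⊗ 1`. -/
abbrev inl (k : Type u) [Field k] (H P : Type v) [Ring H] [HopfAlgebra k H] [Ring P]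
    [Algebra k P] : P →ₐ[k] P ⊗[k] H := Algebra.TensorProduct.includeLeft

/-- The map `a ⊗ b ↦ 1 ⊗ ba`. -/
def flipMul (k : Type u) [Field k] (H P : Type v) [Ring H] [HopfAlgebra k H] [Ring P]
    [Algebra k P] : H ⊗[k] H →ₗ[k] P ⊗[k] H :=
  tlift k (fun a b => 1 ⊗ₜ (b * a))

/-- The map `a ⊗ b ↦ 1 ⊗ S(ba)`. -/
def flipMulInv (k : Type u) [Field k] (H P : Type v) [Ring H] [HopfAlgebra k H] [Ring P]
    [Algebra k P] : H ⊗[k] H →ₗ[k] P ⊗[k] H :=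
  tlift k (fun a b => 1 ⊗ₜ HopfAlgebra.antipode (R := k) (b * a))

theorem flipMul_tmul (a b : H) : flipMul k H P (a ⊗ₜ b) = 1 ⊗ₜ (b * a) :=
  tlift_tmul (by fun_prop) (by fun_prop) a b

theorem flipMulInv_tmul (a b : H) :
    flipMulInv k H P (a ⊗ₜ b) = 1 ⊗ₜ HopfAlgebra.antipode (R := k) (b * a) :=
  tlift_tmul (by fun_prop) (by fun_prop) a b

theorem tlift_comul_mul {W : Type*} [AddCommGroup W] [Module k W] {φ : H → H → W}
    (h1 : ∀ y, Lin k (fun x => φ x y)) (h2 : ∀ x, Lin k (fun y => φ x y)) (a b : H) :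
    tlift k φ (comul (R := k) (b * a)) = tlift k (fun a1 a2 => tlift k (fun b1 b2 =>
      φ (b1 * a1) (b2 * a2)) (comul (R := k) b)) (comul (R := k) a) := by
  rw [Bialgebra.comul_mul, tensor_mul h1 h2, tlift_swap (by fun_prop) (by fun_prop) (by fun_prop)
    (by fun_prop)]

theorem cv_flipMulInv_flipMul : cv (flipMulInv k H P) (flipMul k H P) = cvOne k H (P ⊗[k] H) := by
  refine TensorProduct.ext' fun a b => ?_
  rw [cv_tmul, cvOne_tmul]
  simp only [flipMul_tmul, flipMulInv_tmul, Algebra.TensorProduct.tmul_mul_tmul, one_mul]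
  have h := tlift_comul_mul (k := k) (φ := fun x y => (1 : P) ⊗ₜ[k]
    (HopfAlgebra.antipode (R := k) x * y)) (by fun_prop) (by fun_prop) a b
  rw [← h, ← map_tlift (L := fun x => (1 : P) ⊗ₜ[k] x) (by fun_prop) (by fun_prop) (by fun_prop)]
  have h2 : ∀ z, tlift k (fun x y => HopfAlgebra.antipode (R := k) x * y) z =
      LinearMap.mul' k H ((HopfAlgebra.antipode k).rTensor H z) := by
    intro z
    apply tensor_hom_ext z (hf := by fun_prop) (hg := by fun_prop)
    intro x y
    simp (disch := fun_prop) [tlift_tmul]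
  rw [h2, HopfAlgebra.mul_antipode_rTensor_comul_apply, Bialgebra.counit_mul,
    Algebra.algebraMap_eq_smul_one, tmul_smul, Algebra.algebraMap_eq_smul_one, mul_comm]
  rfl

theorem cv_flipMul_flipMulInv : cv (flipMul k H P) (flipMulInv k H P) = cvOne k H (P ⊗[k] H) := by
  refine TensorProduct.ext' fun a b => ?_
  rw [cv_tmul, cvOne_tmul]
  simp only [flipMul_tmul, flipMulInv_tmul, Algebra.TensorProduct.tmul_mul_tmul, one_mul]
  have h := tlift_comul_mul (k := k) (φ := fun x y => (1 : P) ⊗ₜ[k]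
    (x * HopfAlgebra.antipode (R := k) y)) (by fun_prop) (by fun_prop) a b
  rw [← h, ← map_tlift (L := fun x => (1 : P) ⊗ₜ[k] x) (by fun_prop) (by fun_prop) (by fun_prop)]
  have h2 : ∀ z, tlift k (fun x y => x * HopfAlgebra.antipode (R := k) y) z =
      LinearMap.mul' k H ((HopfAlgebra.antipode k).lTensor H z) := by
    intro z
    apply tensor_hom_ext z (hf := by fun_prop) (hg := by fun_prop)
    intro x y
    simp (disch := fun_prop) [tlift_tmul]
  rw [h2, HopfAlgebra.mul_antipode_lTensor_comul_apply, Bialgebra.counit_mul,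
    Algebra.algebraMap_eq_smul_one, tmul_smul, Algebra.algebraMap_eq_smul_one, mul_comm]
  rfl

/-- Colinearity of the map `(p, q) ↦ p₍₀₎ q₍₀₎ f(q₍₁₎ ⊗ p₍₁₎)`. -/
def Colin (f : H ⊗[k] H →ₗ[k] P) : Prop :=
  ∀ p q, ca.ρ (ca.twist (AlgHom.id k P) f p q) = tlift k (fun p0 p1 => tlift k (fun q0 q1 =>
    ca.twist (AlgHom.id k P) f p0 q0 ⊗ₜ (p1 * q1)) (ca.ρ q)) (ca.ρ p)

theorem algHom_twist {W : Type*} [Ring W] [Algebra k W] (φ : V →ₐ[k] W) (j : P →ₐ[k] V)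
    (f : H ⊗[k] H →ₗ[k] V) (p q : P) :
    φ (ca.twist j f p q) = ca.twist (φ.comp j) (φ.toLinearMap ∘ₗ f) p q := by
  rw [twist_apply, twist_apply, map_tlift (L := fun x => φ x)
    (by fun_prop) (by fun_prop) (by fun_prop)]
  congr 2
  ext a1 a2
  rw [map_tlift (L := fun x => φ x) (by fun_prop) (by fun_prop) (by fun_prop)]
  simp

theorem twist_coactHom (a : H ⊗[k] H →ₗ[k] P ⊗[k] H) (p q : P) :
    ca.twist ca.coactHom a p q = ca.twist (inl k H P) (cv (flipMul k H P) a) p q := by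
  rw [twist_cv, twist_apply]
  congr 2
  ext p0 p1
  congr 2
  ext q0 q1
  congr 1
  rw [twist_apply, coactHom_apply, coactHom_apply]
  conv_lhs => rw [← tlift_tmul_self (ca.ρ p0), ← tlift_tmul_self (ca.ρ q0)]
  simp (disch := fun_prop) only [mul_tlift, tlift_mul, flipMul_tmul,
    Algebra.TensorProduct.includeLeft_apply, Algebra.TensorProduct.tmul_mul_tmul, one_mul, mul_one]
  rw [tlift_swap (by fun_prop) (by fun_prop) (by fun_prop) (by fun_prop)]

theorem colin_iff (hGal : ca.IsGalois) (f : H ⊗[k] H →ₗ[k] P) : ca.Colin f ↔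
    cv (flipMul k H P) (ca.ρ ∘ₗ f) = cv ((inl k H P).toLinearMap ∘ₗ f) (flipMul k H P) := by
  have h1 : ∀ p q, ca.ρ (ca.twist (AlgHom.id k P) f p q) =
      ca.twist (inl k H P) (cv (flipMul k H P) (ca.ρ ∘ₗ f)) p q := by
    intro p q
    rw [← twist_coactHom]
    exact ca.algHom_twist ca.coactHom _ f p q
  have h2 : ∀ p q, tlift k (fun p0 p1 => tlift k (fun q0 q1 =>
      ca.twist (AlgHom.id k P) f p0 q0 ⊗ₜ (p1 * q1)) (ca.ρ q)) (ca.ρ p) =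
      ca.twist (inl k H P) (cv ((inl k H P).toLinearMap ∘ₗ f) (flipMul k H P)) p q := by
    intro p q
    rw [twist_cv]
    have h3 : ∀ p0 q0, ca.twist (inl k H P) ((inl k H P).toLinearMap ∘ₗ f) p0 q0 =
      ca.twist (AlgHom.id k P) f p0 q0 ⊗ₜ 1 := fun p0 q0 =>
        (ca.algHom_twist (inl k H P) (AlgHom.id k P) f p0 q0).symm
    simp only [h3, flipMul_tmul, Algebra.TensorProduct.tmul_mul_tmul, one_mul, mul_one]
  simp only [Colin, h1, h2]
  exact ⟨fun h => ca.twist_cancel hGal _ h, fun h p q => by rw [h]⟩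

theorem colin_iff' (hGal : ca.IsGalois) (f : H ⊗[k] H →ₗ[k] P) : ca.Colin f ↔
    ∀ h g : H, ca.ρ (f (h ⊗ₜ g)) =
      tlift k (fun h1 h23 => tlift k (fun h2 h3 => tlift k (fun g1 g23 => tlift k (fun g2 g3 =>
      f (h2 ⊗ₜ g2) ⊗ₜ[k] (HopfAlgebra.antipode (R := k) (g1 * h1) * (g3 * h3)))
        (Coalgebra.comul (R := k) g23)) (Coalgebra.comul (R := k) g))
      (Coalgebra.comul (R := k) h23)) (Coalgebra.comul (R := k) h) := by
  have h1 : ∀ h g : H, cv (flipMulInv k H P) (cv ((inl k H P).toLinearMap ∘ₗ f) (flipMul k H P))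
      (h ⊗ₜ g) = tlift k (fun h1 h23 => tlift k (fun h2 h3 => tlift k (fun g1 g23 =>
        tlift k (fun g2 g3 =>
        f (h2 ⊗ₜ g2) ⊗ₜ[k] (HopfAlgebra.antipode (R := k) (g1 * h1) * (g3 * h3)))
        (Coalgebra.comul (R := k) g23)) (Coalgebra.comul (R := k) g))
        (Coalgebra.comul (R := k) h23)) (Coalgebra.comul (R := k) h) := by
    intro h g
    simp (disch := fun_prop) only [cv_tmul, mul_tlift, flipMulInv_tmul, flipMul_tmul,
      LinearMap.comp_apply, AlgHom.toLinearMap_apply, Algebra.TensorProduct.includeLeft_apply,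
      Algebra.TensorProduct.tmul_mul_tmul, one_mul, mul_one]
    congr 2
    ext h1 h23
    rw [tlift_swap (by fun_prop) (by fun_prop) (by fun_prop) (by fun_prop)]
  simp only [← h1]
  rw [colin_iff ca hGal]
  constructor
  · intro h a b
    rw [← h, ← cv_assoc, cv_flipMulInv_flipMul, one_cv]
    rfl
  · intro h
    have : ca.ρ ∘ₗ f =
        cv (flipMulInv k H P) (cv ((inl k H P).toLinearMap ∘ₗ f) (flipMul k H P)) :=
      TensorProduct.ext' h
    rw [this, ← cv_assoc, cv_flipMul_flipMulInv, one_cv]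

theorem Colin.inv (hGal : ca.IsGalois) {f fi : H ⊗[k] H →ₗ[k] P} (hf : ca.Colin f)
    (h1 : cv f fi = cvOne k H P) (h2 : cv fi f = cvOne k H P) : ca.Colin fi := by
  rw [colin_iff ca hGal] at hf ⊢
  have e1 := algHom_cv ca.coactHom f fi
  have e2 := algHom_cv (inl k H P) fi f
  rw [h1, algHom_cvOne] at e1
  rw [h2, algHom_cvOne] at e2
  change _ = cv (ca.ρ ∘ₗ f) (ca.ρ ∘ₗ fi) at e1
  rw [← one_cv (cv (flipMul k H P) (ca.ρ ∘ₗ fi)), e2, cv_assoc, ← cv_assoc _ (flipMul k H P) _,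
    ← hf, cv_assoc, ← e1, cv_one]

end ComodAlg

namespace ComodAlg
variable {k : Type u} [Field k] {H P : Type v} [Ring H] [HopfAlgebra k H]
  [Ring P] [Algebra k P] (ca : ComodAlg k H P) {W : Type*} [AddCommGroup W] [Module k W]

theorem Colin.tlift_eq {ca : ComodAlg k H P} {f : H ⊗[k] H →ₗ[k] P} (hf : ca.Colin f)
    {φ : P → H → W} (h1 : ∀ y, Lin k (fun x => φ x y)) (h2 : ∀ x, Lin k (fun y => φ x y))
    (p q : P) : tlift k φ (ca.ρ (ca.twist (AlgHom.id k P) f p q)) =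
      tlift k (fun p0 p1 => tlift k (fun q0 q1 =>
        φ (ca.twist (AlgHom.id k P) f p0 q0) (p1 * q1)) (ca.ρ q)) (ca.ρ p) := by
  rw [hf]
  simp (disch := fun_prop) only [tlift_tlift, tlift_tmul]

/-- The map `a ⊗ b ↦ p ◁ (ba)`. -/
def actMul (act : P →ₗ[k] H →ₗ[k] P) (p : P) : H ⊗[k] H →ₗ[k] P :=
  tlift k (fun a b => act p (b * a))

theorem actMul_tmul (act : P →ₗ[k] H →ₗ[k] P) (p : P) (a b : H) :
    actMul act p (a ⊗ₜ b) = act p (b * a) := tlift_tmul (by fun_prop) (by fun_prop) a b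

theorem Colin.cv_actMul {ca : ComodAlg k H P} {f : H ⊗[k] H →ₗ[k] P} (hf : ca.Colin f)
    (hGal : ca.IsGalois) {act : P →ₗ[k] H →ₗ[k] P}
    (hbraid : ∀ p q : P, p * q = tlift k (fun q0 q1 => q0 * act p q1) (ca.ρ q)) (b : P) :
    cv f (actMul act b) = cv (actMul act b) f := by
  refine ca.twist_cancel hGal (AlgHom.id k P) fun p q => ?_
  have h1 : ∀ p q, ca.twist (AlgHom.id k P) (actMul act b) p q = b * (p * q) := by
    intro p q
    rw [hbraid, ca.tlift_coact_mul (by fun_prop) (by fun_prop), twist_apply]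
    simp only [actMul_tmul, AlgHom.id_apply]
  rw [ca.twist_cv, ca.twist_cv]
  simp only [actMul_tmul, h1]
  rw [← hf.tlift_eq (φ := fun x y => x * act b y) (by fun_prop) (by fun_prop), ← hbraid,
    twist_apply]
  simp (disch := fun_prop) only [mul_tlift, AlgHom.id_apply, mul_assoc]

/-- The map `a ⊗ b ↦ f(ba ⊗ x)`. -/
def precompMul (f : H ⊗[k] H →ₗ[k] P) (x : H) : H ⊗[k] H →ₗ[k] P :=
  tlift k (fun a b => f ((b * a) ⊗ₜ x))

theorem precompMul_tmul (f : H ⊗[k] H →ₗ[k] P) (x a b : H) :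
    precompMul f x (a ⊗ₜ b) = f ((b * a) ⊗ₜ x) := tlift_tmul (by fun_prop) (by fun_prop) a b

/-- The map `a ⊗ b ↦ r₍₀₎ f(r₍₁₎ ⊗ ba)`. -/
def precompMulR (f : H ⊗[k] H →ₗ[k] P) (r : P) : H ⊗[k] H →ₗ[k] P :=
  tlift k (fun a b => tlift k (fun r0 r1 => r0 * f (r1 ⊗ₜ (b * a))) (ca.ρ r))

theorem precompMulR_tmul (f : H ⊗[k] H →ₗ[k] P) (r : P) (a b : H) :
    ca.precompMulR f r (a ⊗ₜ b) = tlift k (fun r0 r1 => r0 * f (r1 ⊗ₜ (b * a))) (ca.ρ r) :=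
  tlift_tmul (by fun_prop) (by fun_prop) a b

theorem Colin.twist_twist_right {ca : ComodAlg k H P} {f : H ⊗[k] H →ₗ[k] P} (hf : ca.Colin f)
    (p q r : P) :
    tlift k (fun p0 p1 => p0 * tlift k (fun q0 q1 => q0 * tlift k (fun r0 r1 => r0 *
      tlift k (fun h1 h2 => tlift k (fun g1 g2 =>
        f (h1 ⊗ₜ g1) * f ((g2 * h2) ⊗ₜ p1)) (comul (R := k) q1)) (comul (R := k) r1))
        (ca.ρ r)) (ca.ρ q)) (ca.ρ p) =
      ca.twist (AlgHom.id k P) f p (ca.twist (AlgHom.id k P) f q r) := by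
  have h1 : ∀ x : H, tlift k (fun q0 q1 => q0 * tlift k (fun r0 r1 => r0 *
      tlift k (fun h1 h2 => tlift k (fun g1 g2 =>
        f (h1 ⊗ₜ g1) * f ((g2 * h2) ⊗ₜ x)) (comul (R := k) q1)) (comul (R := k) r1))
        (ca.ρ r)) (ca.ρ q) = ca.twist (AlgHom.id k P) (cv f (precompMul f x)) q r := by
    intro x
    rw [twist_apply']
    simp only [cv_tmul, precompMul_tmul, AlgHom.id_apply]
  simp only [h1, twist_cv, precompMul_tmul]
  rw [twist_apply']
  congr 2
  ext p0 p1
  rw [hf.tlift_eq (by fun_prop) (by fun_prop)]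
  rfl

theorem Colin.twist_twist_left {ca : ComodAlg k H P} {f : H ⊗[k] H →ₗ[k] P} (hf : ca.Colin f)
    {act : P →ₗ[k] H →ₗ[k] P}
    (hbraid : ∀ p q : P, p * q = tlift k (fun q0 q1 => q0 * act p q1) (ca.ρ q)) (p q r : P) :
    tlift k (fun p0 p1 => p0 * tlift k (fun q0 q1 => q0 * tlift k (fun r0 r1 => r0 *
      tlift k (fun h1 h2 => tlift k (fun g1 g2 => tlift k (fun f1 f2 =>
        act (f (g1 ⊗ₜ f1)) h1 * f (h2 ⊗ₜ (f2 * g2))) (comul (R := k) p1))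
        (comul (R := k) q1)) (comul (R := k) r1))
        (ca.ρ r)) (ca.ρ q)) (ca.ρ p) =
      ca.twist (AlgHom.id k P) f (ca.twist (AlgHom.id k P) f p q) r := by
  have h0 : ∀ (y : P) (z : H), tlift k (fun r0 r1 => r0 * tlift k (fun h1 h2 =>
      act y h1 * f (h2 ⊗ₜ z)) (comul (R := k) r1)) (ca.ρ r) =
      y * tlift k (fun r0 r1 => r0 * f (r1 ⊗ₜ z)) (ca.ρ r) := by
    intro y z
    simp (disch := fun_prop) only [mul_tlift, ← mul_assoc]
    rw [← ca.coact_coassoc (φ := fun r0 a b => r0 * act y a * f (b ⊗ₜ z)) (by fun_prop)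
      (by fun_prop) (by fun_prop)]
    congr 2
    ext r0 r1
    rw [← tlift_mul _ (by fun_prop) (by fun_prop), ← hbraid]
  have h1 : ∀ x y : H, tlift k (fun r0 r1 => r0 *
      tlift k (fun h1 h2 => tlift k (fun g1 g2 => tlift k (fun f1 f2 =>
        act (f (g1 ⊗ₜ f1)) h1 * f (h2 ⊗ₜ (f2 * g2))) (comul (R := k) x))
        (comul (R := k) y)) (comul (R := k) r1)) (ca.ρ r) =
        cv f (ca.precompMulR f r) (y ⊗ₜ x) := by
    intro x y
    rw [cv_tmul]
    simp only [precompMulR_tmul, ← h0]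
    generalize comul (R := k) x = x'
    generalize comul (R := k) y = y'
    have h2 : ∀ r1, tlift k (fun h1 h2 => tlift k (fun g1 g2 => tlift k (fun f1 f2 =>
        act (f (g1 ⊗ₜ f1)) h1 * f (h2 ⊗ₜ (f2 * g2))) x') y') r1 =
        tlift k (fun g1 g2 => tlift k (fun f1 f2 => tlift k (fun h1 h2 =>
        act (f (g1 ⊗ₜ f1)) h1 * f (h2 ⊗ₜ (f2 * g2))) r1) x') y' := by
      intro r1
      rw [tlift_swap (by fun_prop) (by fun_prop) (by fun_prop) (by fun_prop)]
      congr 2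
      ext a b
      rw [tlift_swap (by fun_prop) (by fun_prop) (by fun_prop) (by fun_prop)]
    simp only [h2]
    apply tensor_hom_ext y' (hf := by fun_prop) (hg := by fun_prop)
    intro a b
    simp (disch := fun_prop) only [tlift_tmul]
    apply tensor_hom_ext x' (hf := by fun_prop) (hg := by fun_prop)
    intro c d
    simp (disch := fun_prop) only [tlift_tmul]
  simp only [h1]
  have h3 := ca.twist_apply' (AlgHom.id k P) (cv f (ca.precompMulR f r)) p q
  simp only [AlgHom.id_apply] at h3
  rw [← h3, twist_cv, ca.twist_apply' _ _ _ r]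
  simp only [AlgHom.id_apply]
  rw [hf.tlift_eq (by fun_prop) (by fun_prop)]
  simp only [precompMulR_tmul]

theorem Colin.cocycle_iff {ca : ComodAlg k H P} {f : H ⊗[k] H →ₗ[k] P} (hf : ca.Colin f)
    (hGal : ca.IsGalois) {act : P →ₗ[k] H →ₗ[k] P}
    (hbraid : ∀ p q : P, p * q = tlift k (fun q0 q1 => q0 * act p q1) (ca.ρ q)) :
    (∀ h g x : H, tlift k (fun h1 h2 => tlift k (fun g1 g2 => tlift k (fun f1 f2 =>
        act (f (g1 ⊗ₜ f1)) h1 * f (h2 ⊗ₜ (f2 * g2))) (comul (R := k) x))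
        (comul (R := k) g)) (comul (R := k) h) =
      tlift k (fun h1 h2 => tlift k (fun g1 g2 =>
        f (h1 ⊗ₜ g1) * f ((g2 * h2) ⊗ₜ x)) (comul (R := k) g)) (comul (R := k) h)) ↔
    ∀ p q r, ca.twist (AlgHom.id k P) f p (ca.twist (AlgHom.id k P) f q r) =
      ca.twist (AlgHom.id k P) f (ca.twist (AlgHom.id k P) f p q) r := by
  constructor
  · intro h p q r
    rw [← hf.twist_twist_right, ← hf.twist_twist_left hbraid]
    simp only [h]
  · intro h a b c
    refine ca.coact_cancel hGal (AlgHom.id k P)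
      (φ := fun a => tlift k (fun h1 h2 => tlift k (fun g1 g2 => tlift k (fun f1 f2 =>
        act (f (g1 ⊗ₜ f1)) h1 * f (h2 ⊗ₜ (f2 * g2))) (comul (R := k) c))
        (comul (R := k) b)) (comul (R := k) a))
      (ψ := fun a => tlift k (fun h1 h2 => tlift k (fun g1 g2 =>
        f (h1 ⊗ₜ g1) * f ((g2 * h2) ⊗ₜ c)) (comul (R := k) b)) (comul (R := k) a))
      (by fun_prop) (by fun_prop) (fun r => ?_) a
    refine ca.coact_cancel hGal (AlgHom.id k P) (φ := fun b => tlift k (fun r0 r1 => r0 *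
        tlift k (fun h1 h2 => tlift k (fun g1 g2 => tlift k (fun f1 f2 =>
        act (f (g1 ⊗ₜ f1)) h1 * f (h2 ⊗ₜ (f2 * g2))) (comul (R := k) c))
        (comul (R := k) b)) (comul (R := k) r1)) (ca.ρ r))
      (ψ := fun b => tlift k (fun r0 r1 => r0 * tlift k (fun h1 h2 => tlift k (fun g1 g2 =>
        f (h1 ⊗ₜ g1) * f ((g2 * h2) ⊗ₜ c)) (comul (R := k) b)) (comul (R := k) r1)) (ca.ρ r))
      (by fun_prop) (by fun_prop) (fun q => ?_) b
    refine ca.coact_cancel hGal (AlgHom.id k P) (φ := fun c => tlift k (fun q0 q1 => q0 *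
        tlift k (fun r0 r1 => r0 *
        tlift k (fun h1 h2 => tlift k (fun g1 g2 => tlift k (fun f1 f2 =>
        act (f (g1 ⊗ₜ f1)) h1 * f (h2 ⊗ₜ (f2 * g2))) (comul (R := k) c))
        (comul (R := k) q1)) (comul (R := k) r1)) (ca.ρ r)) (ca.ρ q))
      (ψ := fun c => tlift k (fun q0 q1 => q0 * tlift k (fun r0 r1 => r0 *
        tlift k (fun h1 h2 => tlift k (fun g1 g2 =>
        f (h1 ⊗ₜ g1) * f ((g2 * h2) ⊗ₜ c)) (comul (R := k) q1)) (comul (R := k) r1)) (ca.ρ r))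
        (ca.ρ q))
      (by fun_prop) (by fun_prop) (fun p => ?_) c
    exact (hf.twist_twist_left hbraid p q r).trans
      ((h p q r).symm.trans (hf.twist_twist_right p q r).symm)

end ComodAlg

namespace ComodAlg
variable {k : Type u} [Field k] {H P : Type v} [Ring H] [HopfAlgebra k H]
  [Ring P] [Algebra k P] (ca : ComodAlg k H P)

theorem twist_one_left_iff (hGal : ca.IsGalois) (f : H ⊗[k] H →ₗ[k] P) :
    (∀ q, ca.twist (AlgHom.id k P) f 1 q = q) ↔
      ∀ h : H, f (h ⊗ₜ 1) = algebraMap k P (counit (R := k) h) := by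
  have h1 : ∀ q, ca.twist (AlgHom.id k P) f 1 q =
      tlift k (fun q0 q1 => q0 * f (q1 ⊗ₜ 1)) (ca.ρ q) := by
    intro q
    rw [twist_apply, ca.coact_one, Algebra.TensorProduct.one_def]
    simp (disch := fun_prop) only [tlift_tmul, AlgHom.id_apply, one_mul]
  have h2 : ∀ q, tlift k (fun q0 q1 => q0 * algebraMap k P (counit (R := k) q1)) (ca.ρ q) = q := by
    intro q
    conv_rhs => rw [← ca.counit_coact q]
    simp only [← Algebra.commutes, ← Algebra.smul_def]
  constructor
  · intro h x
    refine ca.coact_cancel hGal (AlgHom.id k P) (φ := fun x => f (x ⊗ₜ 1))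
      (ψ := fun x => algebraMap k P (counit (R := k) x)) (by fun_prop)
      ((Lin.linMap (Algebra.linearMap k P)).comp' (Lin.linMap (counit (R := k)))) (fun q => ?_) x
    simp only [AlgHom.id_apply]
    rw [← h1, h, h2]
  · intro h q
    rw [h1]
    simp only [h, h2]

theorem twist_one_right_iff (hGal : ca.IsGalois) (f : H ⊗[k] H →ₗ[k] P) :
    (∀ q, ca.twist (AlgHom.id k P) f q 1 = q) ↔
      ∀ h : H, f (1 ⊗ₜ h) = algebraMap k P (counit (R := k) h) := by
  have h1 : ∀ q, ca.twist (AlgHom.id k P) f q 1 =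
      tlift k (fun q0 q1 => q0 * f (1 ⊗ₜ q1)) (ca.ρ q) := by
    intro q
    rw [twist_apply, ca.coact_one, Algebra.TensorProduct.one_def]
    simp (disch := fun_prop) only [tlift_tmul, AlgHom.id_apply, mul_one]
  have h2 : ∀ q, tlift k (fun q0 q1 => q0 * algebraMap k P (counit (R := k) q1)) (ca.ρ q) = q := by
    intro q
    conv_rhs => rw [← ca.counit_coact q]
    simp only [← Algebra.commutes, ← Algebra.smul_def]
  constructor
  · intro h x
    refine ca.coact_cancel hGal (AlgHom.id k P) (φ := fun x => f (1 ⊗ₜ x))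
      (ψ := fun x => algebraMap k P (counit (R := k) x)) (by fun_prop)
      ((Lin.linMap (Algebra.linearMap k P)).comp' (Lin.linMap (counit (R := k)))) (fun q => ?_) x
    simp only [AlgHom.id_apply]
    rw [← h1, h, h2]
  · intro h q
    rw [h1]
    simp only [h, h2]

/-- The conditions on `f : H ⊗ H → P` equivalent to `f` defining an element of `Z̃²(H,P)`, in
terms of the product `(p, q) ↦ p₍₀₎ q₍₀₎ f(q₍₁₎ ⊗ p₍₁₎)`. -/
structure IsTwist (f : H ⊗[k] H →ₗ[k] P) : Prop where
  colin : ca.Colin f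
  one_left : ∀ q, ca.twist (AlgHom.id k P) f 1 q = q
  one_right : ∀ q, ca.twist (AlgHom.id k P) f q 1 = q
  assoc : ∀ p q r, ca.twist (AlgHom.id k P) f p (ca.twist (AlgHom.id k P) f q r) =
      ca.twist (AlgHom.id k P) f (ca.twist (AlgHom.id k P) f p q) r
  inv : ∃ fi, cv f fi = cvOne k H P ∧ cv fi f = cvOne k H P

theorem convHH_eq_cv (f g : H ⊗[k] H →ₗ[k] P) (a b : H) :
    convHH (k := k) (fun a b => f (a ⊗ₜ b)) (fun a b => g (a ⊗ₜ b)) a b = cv f g (a ⊗ₜ b) := by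
  rw [cv_tmul]
  rfl

theorem convHH_iff (f g : H ⊗[k] H →ₗ[k] P) :
    (∀ a b, convHH (k := k) (fun a b => f (a ⊗ₜ b)) (fun a b => g (a ⊗ₜ b)) a b =
      algebraMap k P (counit (R := k) a * counit (R := k) b)) ↔ cv f g = cvOne k H P := by
  simp only [convHH_eq_cv, ← cvOne_tmul]
  exact ⟨fun h => TensorProduct.ext' h, fun h a b => by rw [h]⟩

theorem isZt2_tmul_iff (hGal : ca.IsGalois) {act : P →ₗ[k] H →ₗ[k] P}
    (hbraid : ∀ p q : P, p * q = tlift k (fun q0 q1 => q0 * act p q1) (ca.ρ q))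
    (f : H ⊗[k] H →ₗ[k] P) :
    IsZt2 ca act (fun a b => f (a ⊗ₜ b)) ↔ ca.IsTwist f := by
  constructor
  · rintro ⟨-, h1, h2, -, h3, γi, ⟨γi', h4⟩, h5, h6⟩
    have hf := (ca.colin_iff' hGal f).2 h3
    have h7 : γi = fun a b => TensorProduct.lift γi' (a ⊗ₜ b) := by
      funext a b
      rw [TensorProduct.lift.tmul, h4]
    subst h7
    exact ⟨hf, (ca.twist_one_left_iff hGal f).2 fun h => (h1 h).1,
      (ca.twist_one_right_iff hGal f).2 fun h => (h1 h).2, (hf.cocycle_iff hGal hbraid).1 h2,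
      TensorProduct.lift γi', (convHH_iff _ _).1 h5, (convHH_iff _ _).1 h6⟩
  · rintro ⟨h1, h2, h3, h4, fi, h5, h6⟩
    refine ⟨⟨TensorProduct.curry f, fun _ _ => rfl⟩, fun h =>
      ⟨(ca.twist_one_left_iff hGal f).1 h2 h, (ca.twist_one_right_iff hGal f).1 h3 h⟩,
      (h1.cocycle_iff hGal hbraid).2 h4, fun h g b => ?_, (ca.colin_iff' hGal f).1 h1,
      fun a b => fi (a ⊗ₜ b), ⟨TensorProduct.curry fi, fun _ _ => rfl⟩, (convHH_iff _ _).2 h5,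
      (convHH_iff _ _).2 h6⟩
    have h7 := LinearMap.congr_fun (h1.cv_actMul hGal hbraid b) (h ⊗ₜ g)
    simpa only [cv_tmul, actMul_tmul] using h7

theorem exists_eq_tmul {act : P →ₗ[k] H →ₗ[k] P} {γ : H → H → P} (hγ : IsZt2 ca act γ) :
    ∃ f : H ⊗[k] H →ₗ[k] P, γ = fun a b => f (a ⊗ₜ b) := by
  obtain ⟨⟨γ', h⟩, -⟩ := hγ
  refine ⟨TensorProduct.lift γ', ?_⟩
  funext a b
  rw [TensorProduct.lift.tmul, h]

theorem twist_coinv_mul (f : H ⊗[k] H →ₗ[k] P) {b : P} (hb : ca.ρ b = b ⊗ₜ[k] (1 : H)) (p q : P) :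
    ca.twist (AlgHom.id k P) f (b * p) q = b * ca.twist (AlgHom.id k P) f p q := by
  rw [twist_apply, ca.tlift_coinv_mul (by fun_prop) (by fun_prop) hb, twist_apply]
  simp (disch := fun_prop) only [mul_tlift, AlgHom.id_apply, mul_assoc]

theorem twist_mul_coinv (f : H ⊗[k] H →ₗ[k] P) {b : P} (hb : ca.ρ b = b ⊗ₜ[k] (1 : H)) (p q : P) :
    ca.twist (AlgHom.id k P) f (p * b) q = ca.twist (AlgHom.id k P) f p (b * q) := by
  rw [twist_apply, ca.tlift_mul_coinv (by fun_prop) (by fun_prop) hb, twist_apply]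
  congr 2
  ext p0 p1
  rw [ca.tlift_coinv_mul (by fun_prop) (by fun_prop) hb]
  simp (disch := fun_prop) only [AlgHom.id_apply, mul_assoc]

theorem coinv_comm {act : P →ₗ[k] H →ₗ[k] P} (hact_one : ∀ p : P, act p 1 = p)
    (hbraid : ∀ p q : P, p * q = tlift k (fun q0 q1 => q0 * act p q1) (ca.ρ q)) {b : P}
    (hb : ca.ρ b = b ⊗ₜ[k] (1 : H)) (p : P) : p * b = b * p := by
  rw [hbraid, hb, tlift_tmul (by fun_prop) (by fun_prop), hact_one]

end ComodAlg

namespace ComodAlg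
variable {k : Type u} [Field k] {H P : Type v} [Ring H] [HopfAlgebra k H]
  [Ring P] [Algebra k P] (ca : ComodAlg k H P)
  {M N : Type v} [AddCommGroup M] [Module k M] [AddCommGroup N] [Module k N]

/-- The relations defining `M ⊗_B P` inside `M ⊗_k P`, for a right action of the coinvariants
on the vector space `M`. -/
def relOf (a : (↥ca.coinv)ᵐᵒᵖ →ₐ[k] Module.End k M) : Submodule k (M ⊗[k] P) :=
  Submodule.span k {z | ∃ (m : M) (b : ↥ca.coinv) (p : P),
    z = (a (MulOpposite.op b) m) ⊗ₜ[k] p - m ⊗ₜ[k] ((b : P) * p)}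

theorem relOf_le_ker (a : (↥ca.coinv)ᵐᵒᵖ →ₐ[k] Module.End k M) (F : M ⊗[k] P →ₗ[k] N)
    (h : ∀ m (b : ↥ca.coinv) p, F ((a (MulOpposite.op b) m) ⊗ₜ p) = F (m ⊗ₜ ((b : P) * p))) :
    ca.relOf a ≤ LinearMap.ker F := by
  rw [relOf, Submodule.span_le]
  rintro z ⟨m, b, p, rfl⟩
  rw [SetLike.mem_coe, LinearMap.mem_ker, map_sub, h, sub_self]

theorem exists_toMTP (a : (↥ca.coinv)ᵐᵒᵖ →ₐ[k] Module.End k M) :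
    letI := Module.compHom M a.toRingHom
    ∃ q : M ⊗[k] P →+ ca.MTP M, (∀ m p, q (m ⊗ₜ p) = Submodule.Quotient.mk (m ⊗ₜ[ℤ] p)) ∧
      ∀ z, q z = 0 ↔ z ∈ ca.relOf a := by
  let _ := Module.compHom M a.toRingHom
  have hrel : ∀ (m : M) (b : ↥ca.coinv) (p : P), (Submodule.Quotient.mk
      ((a (MulOpposite.op b) m) ⊗ₜ[ℤ] p) : ca.MTP M) = Submodule.Quotient.mk
        (m ⊗ₜ[ℤ] ((b : P) * p)) := by
    intro m b p
    rw [Submodule.Quotient.eq]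
    exact Submodule.subset_span ⟨m, b, p, rfl⟩
  have hadd : ∀ x y, (Submodule.Quotient.mk (x + y) : ca.MTP M) =
      Submodule.Quotient.mk x + Submodule.Quotient.mk y := fun x y => rfl
  let q : M ⊗[k] P →+ ca.MTP M := TensorProduct.liftAddHom
    (AddMonoidHom.mk' (fun m => AddMonoidHom.mk' (fun p => Submodule.Quotient.mk (m ⊗ₜ[ℤ] p))
      (fun x y => by rw [tmul_add, hadd])) (fun x y => by ext p; simp [add_tmul])) (by
      intro c m p
      have h := hrel m (algebraMap k _ c) p
      have h2 : a (MulOpposite.op (algebraMap k (↥ca.coinv) c)) = algebraMap k _ c :=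
        a.commutes c
      rw [h2] at h
      simp only [Module.algebraMap_end_apply, Subalgebra.coe_algebraMap] at h
      rw [← Algebra.smul_def] at h
      exact h)
  have hq : ∀ m p, q (m ⊗ₜ p) = Submodule.Quotient.mk (m ⊗ₜ[ℤ] p) := fun _ _ => rfl
  refine ⟨q, hq, fun z => ⟨fun hz => ?_, fun hz => ?_⟩⟩
  · let r0 : M ⊗[ℤ] P →+ (M ⊗[k] P) ⧸ ca.relOf a := TensorProduct.liftAddHom
      (AddMonoidHom.mk' (fun m => AddMonoidHom.mk' (fun p => Submodule.Quotient.mk (m ⊗ₜ[k] p))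
      (fun x y => by rw [tmul_add]; rfl)) (fun x y => by
        ext p
        change Submodule.Quotient.mk ((x + y) ⊗ₜ[k] p) = Submodule.Quotient.mk (x ⊗ₜ[k] p + _)
        rw [add_tmul])) (by
        intro c m p
        change Submodule.Quotient.mk ((c • m) ⊗ₜ[k] p) = Submodule.Quotient.mk (m ⊗ₜ[k] (c • p))
        rw [TensorProduct.smul_tmul])
    have hr0 : ∀ m p, r0 (m ⊗ₜ p) = Submodule.Quotient.mk (m ⊗ₜ[k] p) := fun _ _ => rfl
    let r : ca.MTP M →ₗ[ℤ] (M ⊗[k] P) ⧸ ca.relOf a :=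
      (ca.ffrel M).liftQ r0.toIntLinearMap (by
        rw [ffrel, Submodule.span_le]
        rintro z ⟨m, b, p, rfl⟩
        rw [SetLike.mem_coe, LinearMap.mem_ker, map_sub, sub_eq_zero]
        refine (hr0 (a (MulOpposite.op b) m) p).trans (Eq.trans ?_ (hr0 m ((b : P) * p)).symm)
        rw [Submodule.Quotient.eq]
        exact Submodule.subset_span ⟨m, b, p, rfl⟩)
    have hrq : ∀ z, r (q z) = Submodule.Quotient.mk z := by
      intro z
      induction z with
      | zero => rw [map_zero, map_zero]; rfl
      | add x y hx hy => rw [map_add, map_add, hx, hy]; rfl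
      | tmul m p =>
        rw [hq]
        exact (Submodule.liftQ_apply _ _ _).trans (hr0 m p)
    have h := hrq z
    rw [hz, map_zero] at h
    exact (Submodule.Quotient.mk_eq_zero _).1 h.symm
  · have key : ∀ z ∈ ca.relOf a, ∀ c : k, q (c • z) = 0 := by
      intro z hz
      rw [relOf] at hz
      induction hz using Submodule.span_induction with
      | mem z hz =>
        obtain ⟨m, b, p, rfl⟩ := hz
        intro c
        rw [smul_sub, map_sub, ← tmul_smul, ← tmul_smul, hq, hq, hrel, mul_smul_comm, sub_self]
      | zero => simp
      | add x y _ _ hx hy => intro c; rw [smul_add, map_add, hx, hy, add_zero]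
      | smul d x _ hx => intro c; rw [smul_smul, hx]
    simpa using key z hz 1

theorem mem_relOf_of_injective (hFF : ca.IsFaithfullyFlat)
    (a : (↥ca.coinv)ᵐᵒᵖ →ₐ[k] Module.End k M) (b : (↥ca.coinv)ᵐᵒᵖ →ₐ[k] Module.End k N)
    (f : M →ₗ[k] N) (hf : ∀ c m, f (a c m) = b c (f m)) (hinj : Function.Injective f)
    {z : M ⊗[k] P} (hz : f.rTensor P z ∈ ca.relOf b) : z ∈ ca.relOf a := by
  obtain ⟨q, hq, hq0⟩ := ca.exists_toMTP a
  obtain ⟨q', hq', hq0'⟩ := ca.exists_toMTP b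
  let _ := Module.compHom M a.toRingHom
  let _ := Module.compHom N b.toRingHom
  have h1 : ∀ m p, ca.ffmap f (Submodule.Quotient.mk (m ⊗ₜ[ℤ] p)) =
      Submodule.Quotient.mk (f m ⊗ₜ[ℤ] p) := by
    intro m p
    have e1 : ∀ y : P, Lin ℤ (fun m : M => (Submodule.Quotient.mk (f m ⊗ₜ[ℤ] y) : ca.MTP N)) := by
      intro y
      refine (Lin.linMap (ca.ffrel N).mkQ).comp' (Lin.tmul_left' ⟨map_add f, fun c x => ?_⟩ y)
      exact map_zsmul f c x
    have e2 : ∀ m : M, Lin ℤ (fun y : P => (Submodule.Quotient.mk (f m ⊗ₜ[ℤ] y) : ca.MTP N)) :=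
      fun m => (Lin.linMap (ca.ffrel N).mkQ).comp' (Lin.tmul_right' Lin.id' _)
    refine (qtlift_mk e1 e2 ?_ _).trans (tlift_tmul e1 e2 _ _)
    intro z hz
    replace hz : z ∈ ca.ffrel M := hz
    rw [ffrel] at hz
    induction hz using Submodule.span_induction with
    | mem z hz =>
      obtain ⟨m, b', p, rfl⟩ := hz
      rw [map_sub, tlift_tmul e1 e2, tlift_tmul e1 e2, sub_eq_zero, Submodule.Quotient.eq]
      exact Submodule.subset_span ⟨f m, b', p, by rw [show f (MulOpposite.op b' • m) =
        MulOpposite.op b' • f m from hf _ m]⟩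
    | zero => exact map_zero _
    | add x y _ _ hx hy => rw [map_add, hx, hy, add_zero]
    | smul c x _ hx => exact (map_zsmul _ c x).trans (by rw [hx, smul_zero])
  have h2 : ∀ z, ca.ffmap f (q z) = q' (f.rTensor P z) := by
    intro z
    induction z with
    | zero => simp
    | add x y hx hy => simp only [map_add, hx, hy]
    | tmul m p => rw [hq, h1, LinearMap.rTensor_tmul, hq']
  rw [← hq0]
  refine hFF.1 M N f.toAddMonoidHom (fun b m => hf _ m) hinj ?_
  change ca.ffmap f (q z) = ca.ffmap f 0
  rw [h2, map_zero, hq0']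
  exact hz

theorem exists_sub_mem_relOf (hFF : ca.IsFaithfullyFlat)
    (a : (↥ca.coinv)ᵐᵒᵖ →ₐ[k] Module.End k M) (b : (↥ca.coinv)ᵐᵒᵖ →ₐ[k] Module.End k N)
    (f : M →ₗ[k] N) (hf : ∀ c m, f (a c m) = b c (f m))
    {z : M ⊗[k] P} (hz : f.rTensor P z ∈ ca.relOf b) :
    ∃ w : (LinearMap.ker f) ⊗[k] P, z - (LinearMap.ker f).subtype.rTensor P w ∈ ca.relOf a := by
  have hst : ∀ c, ∀ y ∈ LinearMap.range f, b c y ∈ LinearMap.range f := by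
    rintro c _ ⟨m, rfl⟩
    exact ⟨a c m, hf c m⟩
  let b' : (↥ca.coinv)ᵐᵒᵖ →ₐ[k] Module.End k (LinearMap.range f) :=
    { toFun := fun c => (b c).restrict (hst c)
      map_one' := by ext x; simp
      map_mul' := fun c d => by ext x; simp
      map_zero' := by ext x; simp
      map_add' := fun c d => by ext x; simp
      commutes' := fun c => by
        ext x
        exact LinearMap.congr_fun (b.commutes c) (x : N) }
  have h1 : f.rangeRestrict.rTensor P z ∈ ca.relOf b' := by
    refine ca.mem_relOf_of_injective hFF b' b (LinearMap.range f).subtype (fun _ _ => rfl)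
      Subtype.val_injective ?_
    rw [← LinearMap.comp_apply, ← LinearMap.rTensor_comp]
    exact hz
  have h2 : ca.relOf b' ≤ (ca.relOf a).map (f.rangeRestrict.rTensor P) := by
    rw [relOf, Submodule.span_le]
    rintro _ ⟨⟨_, m, rfl⟩, d, p, rfl⟩
    refine ⟨_, Submodule.subset_span ⟨m, d, p, rfl⟩, ?_⟩
    rw [map_sub, LinearMap.rTensor_tmul, LinearMap.rTensor_tmul]
    congr 2
    exact Subtype.ext (hf _ m)
  obtain ⟨r, hr, hr2⟩ := h2 h1
  have h3 : f.rangeRestrict.rTensor P (z - r) = 0 := by rw [map_sub, hr2, sub_self]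
  have h4 := rTensor_exact P (f := (LinearMap.ker f).subtype) (g := f.rangeRestrict)
    (by
      rw [LinearMap.exact_iff, LinearMap.ker_rangeRestrict, Submodule.range_subtype])
    f.surjective_rangeRestrict
  obtain ⟨w, hw⟩ := (h4 _).1 h3
  exact ⟨w, by rw [hw, sub_sub_cancel]; exact hr⟩

end ComodAlg

section
variable {k : Type u} [Field k] {H : Type v} [Ring H] [HopfAlgebra k H]
  {W : Type*} [AddCommGroup W] [Module k W]

theorem tlift_comul_assoc {φ : H → H → H → W} (h1 : ∀ y z, Lin k (fun x => φ x y z))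
    (h2 : ∀ x z, Lin k (fun y => φ x y z)) (h3 : ∀ x y, Lin k (fun z => φ x y z)) (h : H) :
    tlift k (fun a b => tlift k (fun c d => φ a c d) (comul (R := k) b)) (comul (R := k) h) =
      tlift k (fun a b => tlift k (fun c d => φ c d b) (comul (R := k) a))
        (comul (R := k) h) := by
  have h4 := Coalgebra.coassoc_apply (R := k) h
  have h5 : ∀ z : H ⊗[k] H, tlift k (fun x w => tlift k (fun y z => φ x y z) w)
      (TensorProduct.assoc k H H H ((comul (R := k)).rTensor H z)) =
      tlift k (fun a b => tlift k (fun c d => φ c d b) (comul (R := k) a)) z := by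
    intro z
    apply tensor_hom_ext z (hf := by fun_prop) (hg := by fun_prop)
    intro a b
    simp (disch := fun_prop) only [tlift_tmul, LinearMap.rTensor_tmul]
    generalize comul (R := k) a = w
    apply tensor_hom_ext w (hf := by fun_prop) (hg := by fun_prop)
    intro c d
    simp (disch := fun_prop) only [tlift_tmul, TensorProduct.assoc_tmul]
  have h6 : ∀ z : H ⊗[k] H, tlift k (fun x w => tlift k (fun y z => φ x y z) w)
      ((comul (R := k)).lTensor H z) =
      tlift k (fun a b => tlift k (fun c d => φ a c d) (comul (R := k) b)) z := by
    intro z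
    apply tensor_hom_ext z (hf := by fun_prop) (hg := by fun_prop)
    intro a b
    simp (disch := fun_prop) only [tlift_tmul, LinearMap.lTensor_tmul]
  rw [← h5, ← h6, h4]

theorem tlift_comul_mul_antipode {φ : H → H → W} (h1 : ∀ y, Lin k (fun x => φ x y))
    (h2 : ∀ x, Lin k (fun y => φ x y)) (g h : H) :
    tlift k (fun a b => tlift k (fun c d => φ (g * a * HopfAlgebra.antipode (R := k) c) d)
      (comul (R := k) b)) (comul (R := k) h) = φ g h := by
  rw [tlift_comul_assoc (φ := fun a c d => φ (g * a * HopfAlgebra.antipode (R := k) c) d)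
    (by fun_prop) (by fun_prop) (by fun_prop)]
  have h3 : ∀ z : H ⊗[k] H, tlift k (fun x y => g * x * HopfAlgebra.antipode (R := k) y) z =
      g * LinearMap.mul' k H ((HopfAlgebra.antipode k).lTensor H z) := by
    intro z
    apply tensor_hom_ext z (hf := by fun_prop) (hg := by fun_prop)
    intro x y
    simp (disch := fun_prop) [tlift_tmul, mul_assoc]
  have h4 : ∀ a b, tlift k (fun c d => φ (g * c * HopfAlgebra.antipode (R := k) d) b)
      (comul (R := k) a) = counit (R := k) a • φ g b := by
    intro a b
    rw [← map_tlift (L := fun x => φ x b) (by fun_prop) (by fun_prop) (by fun_prop), h3,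
      HopfAlgebra.mul_antipode_lTensor_comul_apply, ← Algebra.commutes, ← Algebra.smul_def,
      (h1 b).map_smul]
  simp only [h4]
  have h5 : ∀ z : H ⊗[k] H, tlift k (fun a b => counit (R := k) a • φ g b) z =
      (h2 g).toMap (TensorProduct.lid k H ((counit (R := k)).rTensor H z)) := by
    intro z
    apply tensor_hom_ext z (hf := by fun_prop) (hg := by fun_prop)
    intro x y
    simp (disch := fun_prop) [tlift_tmul]
  rw [h5, Coalgebra.rTensor_counit_comul]
  simp

end

namespace ComodAlg
variable {k : Type u} [Field k] {H P : Type v} [Ring H] [HopfAlgebra k H]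
  [Ring P] [Algebra k P] (ca : ComodAlg k H P) {W : Type*} [AddCommGroup W] [Module k W]

/-- The right action of the coinvariants given by restricting a right action of `P`. -/
def coinvAct {C : Type*} [AddCommGroup C] [Module k C] (j : Pᵐᵒᵖ →ₐ[k] Module.End k C) :
    (↥ca.coinv)ᵐᵒᵖ →ₐ[k] Module.End k C :=
  j.comp (AlgHom.op ca.coinv.val)

theorem coinvAct_apply {C : Type*} [AddCommGroup C] [Module k C]
    (j : Pᵐᵒᵖ →ₐ[k] Module.End k C) (b : ↥ca.coinv) (c : C) :
    ca.coinvAct j (MulOpposite.op b) c = j (MulOpposite.op b) c := rfl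

theorem lin_act {C : Type*} [AddCommGroup C] [Module k C] (j : Pᵐᵒᵖ →ₐ[k] Module.End k C)
    (c : C) : Lin k (fun x => j (MulOpposite.op x) c) :=
  ⟨fun x y => by simp, fun a x => by simp⟩

/-- The map `c ⊗ r ↦ j(r₍₀₎) c ⊗ r₍₁₎`. -/
def opChi {C : Type*} [AddCommGroup C] [Module k C] (j : Pᵐᵒᵖ →ₐ[k] Module.End k C) :
    C ⊗[k] P →ₗ[k] C ⊗[k] H :=
  tlift k (fun c r => tlift k (fun r0 r1 => (j (MulOpposite.op r0) c) ⊗ₜ r1) (ca.ρ r))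

theorem mem_relOf_of_opChi (hGal : ca.IsGalois) {C : Type v} [AddCommGroup C] [Module k C]
    (j : Pᵐᵒᵖ →ₐ[k] Module.End k C) {z : C ⊗[k] P} (hz : ca.opChi j z = 0) :
    z ∈ ca.relOf (ca.coinvAct j) := by
  have hj := lin_act j
  have h : ∀ z, tlift k (fun c h => tlift k (fun u v => (ca.relOf (ca.coinvAct j)).mkQ
      ((j (MulOpposite.op u) c) ⊗ₜ v)) (ca.tauLift hGal h)) (ca.opChi j z) =
      (ca.relOf (ca.coinvAct j)).mkQ z := by
    intro z
    apply tensor_hom_ext z (hf := by fun_prop) (hg := by fun_prop)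
    intro c r
    simp (disch := fun_prop) only [opChi, tlift_tmul, tlift_tlift]
    have h1 := ca.coact_tauLift hGal (f := fun x y => (ca.relOf (ca.coinvAct j)).mkQ
      ((j (MulOpposite.op x) c) ⊗ₜ y)) (by fun_prop) (by fun_prop) (by
        intro b hb p q
        rw [MulOpposite.op_mul, map_mul, Module.End.mul_apply]
        exact (Submodule.Quotient.eq _).2 (Submodule.subset_span
          ⟨j (MulOpposite.op p) c, ⟨b, hb⟩, q, rfl⟩)) r
    simpa only [MulOpposite.op_mul, map_mul, Module.End.mul_apply, MulOpposite.op_one, map_one,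
      Module.End.one_apply] using h1
  have h2 := h z
  rw [hz, map_zero] at h2
  exact (Submodule.Quotient.mk_eq_zero _).1 h2.symm

theorem opChi_rTensor_eq_zero {C C' : Type*} [AddCommGroup C] [Module k C] [AddCommGroup C']
    [Module k C'] (j : Pᵐᵒᵖ →ₐ[k] Module.End k C') {d f g : C →ₗ[k] C'}
    (hd : ∀ x, d x = f x - g x) {z : C ⊗[k] P}
    (hz : tlift k (fun x r => tlift k (fun r0 r1 => j (MulOpposite.op r0) (f x) ⊗ₜ[k] r1)
      (ca.ρ r)) z = tlift k (fun x r => tlift k (fun r0 r1 =>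
        j (MulOpposite.op r0) (g x) ⊗ₜ[k] r1) (ca.ρ r)) z) :
    ca.opChi j (d.rTensor P z) = 0 := by
  have hj := lin_act j
  have h : ∀ y : C ⊗[k] P, ca.opChi j (d.rTensor P y) =
      tlift k (fun x r => tlift k (fun r0 r1 => j (MulOpposite.op r0) (f x) ⊗ₜ[k] r1)
        (ca.ρ r)) y - tlift k (fun x r => tlift k (fun r0 r1 =>
        j (MulOpposite.op r0) (g x) ⊗ₜ[k] r1) (ca.ρ r)) y := by
    intro y
    apply tensor_hom_ext y (hf := by fun_prop) (hg := by fun_prop)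
    intro x r
    simp (disch := fun_prop) only [opChi, tlift_tmul, LinearMap.rTensor_tmul, hd]
    generalize ca.ρ r = w
    apply tensor_hom_ext w (hf := by fun_prop) (hg := by fun_prop)
    intro r0 r1
    simp (disch := fun_prop) only [tlift_tmul, map_sub, sub_tmul]
  rw [h, hz, sub_self]

theorem tauLift_coact_coact (hGal : ca.IsGalois) {φ : P → H → H → W}
    (h1 : ∀ y z, Lin k (fun x => φ x y z)) (h2 : ∀ x z, Lin k (fun y => φ x y z))
    (h3 : ∀ x y, Lin k (fun z => φ x y z)) (h : H) :
    tlift k (fun u v => tlift k (fun u0 u1 => tlift k (fun v0 v1 => φ (u0 * v0) u1 v1) (ca.ρ v))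
      (ca.ρ u)) (ca.tauLift hGal h) =
    tlift k (fun a b => φ 1 (HopfAlgebra.antipode (R := k) a) b) (comul (R := k) h) := by
  have h4 : ∀ x y z, φ x y z = tlift k (fun a b => tlift k (fun c d =>
      φ x (y * a * HopfAlgebra.antipode (R := k) c) d) (comul (R := k) b)) (comul (R := k) z) :=
    fun x y z => (tlift_comul_mul_antipode (φ := fun y z => φ x y z)
      (by fun_prop) (by fun_prop) y z).symm
  have h5 := ca.tauLift_coact hGal (φ := fun p h => tlift k (fun p0 p1 => tlift k (fun c d =>
    φ p0 (p1 * HopfAlgebra.antipode (R := k) c) d) (comul (R := k) h)) (ca.ρ p))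
    (by fun_prop) (by fun_prop) h
  rw [ca.coact_one, Algebra.TensorProduct.one_def] at h5
  simp (disch := fun_prop) only [tlift_tmul, one_mul] at h5
  rw [← h5]
  congr 2
  ext u v
  simp (disch := fun_prop) only [ca.tlift_coact_mul]
  rw [tlift_swap (by fun_prop) (by fun_prop) (by fun_prop) (by fun_prop)]
  refine Eq.trans ?_ ((ca.coact_coassoc (φ := fun v0 v1 v2 => tlift k (fun x y =>
    tlift k (fun c d => φ (x * v0) (y * v1 * HopfAlgebra.antipode (R := k) c) d)
      (comul (R := k) v2)) (ca.ρ u)) (by fun_prop) (by fun_prop) (by fun_prop) v).symm.trans ?_)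
  · congr 2
    ext v0 z
    rw [tlift_swap (by fun_prop) (by fun_prop) (by fun_prop) (by fun_prop)]
    congr 2
    ext x y
    exact h4 _ _ _
  · congr 2
    ext v0 v1
    rw [tlift_swap (by fun_prop) (by fun_prop) (by fun_prop) (by fun_prop)]

/-- The vector space `P ⊗ Pᵐᵒᵖ ⊗ H`. -/
def Triple (k : Type u) [Field k] (H P : Type v) [Ring H] [HopfAlgebra k H] [Ring P]
    [Algebra k P] : Type v := (P ⊗[k] Pᵐᵒᵖ) ⊗[k] H

instance : AddCommGroup (Triple k H P) := inferInstanceAs (AddCommGroup ((P ⊗[k] Pᵐᵒᵖ) ⊗[k] H))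

instance : Module k (Triple k H P) := inferInstanceAs (Module k ((P ⊗[k] Pᵐᵒᵖ) ⊗[k] H))

/-- Pure tensors in `Triple`. -/
def Triple.mk : P ⊗[k] Pᵐᵒᵖ →ₗ[k] H →ₗ[k] Triple k H P :=
  TensorProduct.mk k (P ⊗[k] Pᵐᵒᵖ) H

/-- The coaction on `P ⊗ Pᵐᵒᵖ`. -/
def diagCoact : P ⊗[k] Pᵐᵒᵖ →ₗ[k] Triple k H P :=
  tlift k (fun p oq => tlift k (fun p0 p1 => tlift k (fun q0 q1 =>
    Triple.mk (p0 ⊗ₜ[k] (MulOpposite.op q0)) (p1 * q1))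
      (ca.ρ (MulOpposite.unop oq))) (ca.ρ p))

theorem diagCoact_apply (x : P ⊗[k] Pᵐᵒᵖ) : ca.diagCoact x = ca.betaA x := rfl

theorem diagCoact_tmul (p q : P) : ca.diagCoact (p ⊗ₜ MulOpposite.op q) =
    tlift k (fun p0 p1 => tlift k (fun q0 q1 =>
      Triple.mk (p0 ⊗ₜ[k] (MulOpposite.op q0)) (p1 * q1)) (ca.ρ q)) (ca.ρ p) := by
  simp (disch := fun_prop) only [diagCoact, tlift_tmul, MulOpposite.unop_op]

/-- `(P ⊗ Pᵐᵒᵖ)^{coH}` is the kernel of this map. -/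
def betaSub : P ⊗[k] Pᵐᵒᵖ →ₗ[k] Triple k H P :=
  ca.diagCoact - Triple.mk.flip 1

theorem betaSub_apply (x : P ⊗[k] Pᵐᵒᵖ) :
    ca.betaSub x = ca.diagCoact x - Triple.mk.flip 1 x := rfl

theorem mem_ker_betaSub (x : P ⊗[k] Pᵐᵒᵖ) :
    x ∈ LinearMap.ker ca.betaSub ↔ ca.betaA x = x ⊗ₜ[k] (1 : H) := by
  rw [LinearMap.mem_ker, betaSub_apply, sub_eq_zero]
  rfl

/-- Right multiplication by `P` on the second leg of `P ⊗ Pᵐᵒᵖ`. -/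
def legAct (k : Type u) [Field k] (P : Type v) [Ring P] [Algebra k P] :
    Pᵐᵒᵖ →ₐ[k] Module.End k (P ⊗[k] Pᵐᵒᵖ) :=
  (Algebra.lmul k (P ⊗[k] Pᵐᵒᵖ)).comp Algebra.TensorProduct.includeRight

theorem legAct_tmul (r p q : P) : legAct k P (MulOpposite.op r) (p ⊗ₜ MulOpposite.op q) =
    p ⊗ₜ MulOpposite.op (q * r) := by
  simp [legAct]

/-- Right multiplication by `P` on the second leg of `P ⊗ Pᵐᵒᵖ ⊗ H`. -/
def Triple.act (k : Type u) [Field k] (H P : Type v) [Ring H] [HopfAlgebra k H] [Ring P]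
    [Algebra k P] : Pᵐᵒᵖ →ₐ[k] Module.End k (Triple k H P) :=
  (Module.End.rTensorAlgHom k (P ⊗[k] Pᵐᵒᵖ) H).comp (legAct k P)

theorem Triple.act_mk (r : Pᵐᵒᵖ) (x : P ⊗[k] Pᵐᵒᵖ) (h : H) :
    Triple.act k H P r (Triple.mk x h) = Triple.mk (legAct k P r x) h := rfl

theorem betaSub_coinvAct (b : (↥ca.coinv)ᵐᵒᵖ) (x : P ⊗[k] Pᵐᵒᵖ) :
    ca.betaSub (ca.coinvAct (legAct k P) b x) =
      ca.coinvAct (Triple.act k H P) b (ca.betaSub x) := by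
  obtain ⟨b, rfl⟩ := MulOpposite.op_surjective b
  simp only [coinvAct_apply, betaSub_apply, map_sub, LinearMap.flip_apply, Triple.act_mk]
  congr 1
  apply tensor_hom_ext x (hf := by fun_prop) (hg := by fun_prop)
  intro p q
  obtain ⟨q, rfl⟩ := MulOpposite.op_surjective q
  simp (disch := fun_prop) only [legAct_tmul, diagCoact_tmul, ca.tlift_mul_coinv _ _ b.2]
  rw [map_tlift (L := fun z => Triple.act k H P (MulOpposite.op (b : P)) z) (by fun_prop)
    (by fun_prop) (by fun_prop)]
  congr 2
  ext p0 p1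
  rw [map_tlift (L := fun z => Triple.act k H P (MulOpposite.op (b : P)) z) (by fun_prop)
    (by fun_prop) (by fun_prop)]
  simp only [Triple.act_mk, legAct_tmul]

/-- The multiplication `x ⊗ r ↦ (1 ⊗ r) x` on `A ⊗ P`. -/
def mulLeg : (P ⊗[k] Pᵐᵒᵖ) ⊗[k] P →ₗ[k] P ⊗[k] Pᵐᵒᵖ :=
  tlift k (fun x r => legAct k P (MulOpposite.op r) x)

theorem exists_mulLeg (hGal : ca.IsGalois) (hFF : ca.IsFaithfullyFlat) (p : P) :
    ∃ w : (LinearMap.ker ca.betaSub) ⊗[k] P,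
      mulLeg ((LinearMap.ker ca.betaSub).subtype.rTensor P w) = p ⊗ₜ[k] MulOpposite.op 1 := by
  have hl := lin_act (legAct k P)
  have hl3 := lin_act (Triple.act k H P)
  let z : (P ⊗[k] Pᵐᵒᵖ) ⊗[k] P := tlift k (fun p0 p1 => tlift k (fun u v =>
    ((p0 ⊗ₜ[k] MulOpposite.op u : P ⊗[k] Pᵐᵒᵖ) ⊗ₜ[k] v : (P ⊗[k] Pᵐᵒᵖ) ⊗[k] P))
      (ca.tauLift hGal p1)) (ca.ρ p)
  have h1 : ca.opChi (Triple.act k H P) (ca.betaSub.rTensor P z) = 0 := by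
    apply ca.opChi_rTensor_eq_zero _ ca.betaSub_apply
    trans tlift k (fun p0 p1 => (Triple.mk (p0 ⊗ₜ[k] MulOpposite.op (1 : P)) (1 : H)) ⊗ₜ[k] p1)
      (ca.ρ p)
    · simp (disch := fun_prop) only [z, tlift_tlift, tlift_tmul, diagCoact_tmul]
      have e1 : ∀ (x : P) (y : H), tlift k (fun u v => tlift k (fun r0 r1 =>
          Triple.act k H P (MulOpposite.op r0) (tlift k (fun p0 p1 => tlift k (fun q0 q1 =>
            Triple.mk (p0 ⊗ₜ[k] MulOpposite.op q0) (p1 * q1)) (ca.ρ u)) (ca.ρ x)) ⊗ₜ[k] r1)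
              (ca.ρ v)) (ca.tauLift hGal y) = tlift k (fun x0 x1 => tlift k (fun a b =>
          Triple.mk (x0 ⊗ₜ[k] MulOpposite.op (1 : P))
            (x1 * HopfAlgebra.antipode (R := k) a) ⊗ₜ[k] b) (comul (R := k) y)) (ca.ρ x) := by
        intro x y
        have e2 : ∀ (x0 : P) (x1 : H), _ := fun x0 x1 => ca.tauLift_coact_coact hGal
          (φ := fun r u1 v1 => Triple.mk (x0 ⊗ₜ[k] MulOpposite.op r) (x1 * u1) ⊗ₜ[k] v1)
          (by fun_prop) (by fun_prop) (by fun_prop) y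
        simp only [← e2]
        refine Eq.trans ?_ (tlift_swap (by fun_prop) (by fun_prop) (by fun_prop) (by fun_prop)
          _ _).symm
        congr 2
        ext u v
        have e4 : ∀ (r0 : P) (r1 : H), Triple.act k H P (MulOpposite.op r0)
            (tlift k (fun p0 p1 => tlift k (fun q0 q1 =>
              Triple.mk (p0 ⊗ₜ[k] MulOpposite.op q0) (p1 * q1)) (ca.ρ u)) (ca.ρ x)) ⊗ₜ[k] r1 =
            tlift k (fun p0 p1 => tlift k (fun q0 q1 =>
              Triple.mk (p0 ⊗ₜ[k] MulOpposite.op (q0 * r0)) (p1 * q1) ⊗ₜ[k] r1) (ca.ρ u))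
                (ca.ρ x) := by
          intro r0 r1
          rw [map_tlift (L := fun z => Triple.act k H P (MulOpposite.op r0) z ⊗ₜ[k] r1)
            (by fun_prop) (by fun_prop) (by fun_prop)]
          congr 2
          ext p0 p1
          rw [map_tlift (L := fun z => Triple.act k H P (MulOpposite.op r0) z ⊗ₜ[k] r1)
            (by fun_prop) (by fun_prop) (by fun_prop)]
          simp only [Triple.act_mk, legAct_tmul]
        simp only [e4]
        rw [tlift_swap (by fun_prop) (by fun_prop) (by fun_prop) (by fun_prop)]
        congr 2
        ext x0 x1
        rw [tlift_swap (by fun_prop) (by fun_prop) (by fun_prop) (by fun_prop)]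
      simp only [e1]
      rw [ca.coact_coassoc (φ := fun q0 q1 h => tlift k (fun a b =>
        Triple.mk (q0 ⊗ₜ[k] MulOpposite.op (1 : P)) (q1 * HopfAlgebra.antipode (R := k) a) ⊗ₜ[k] b)
          (comul (R := k) h)) (by fun_prop) (by fun_prop) (by fun_prop)]
      congr 2
      ext p0 p1
      have e3 := tlift_comul_mul_antipode (φ := fun x y =>
        Triple.mk (p0 ⊗ₜ[k] MulOpposite.op (1 : P)) x ⊗ₜ[k] y) (by fun_prop) (by fun_prop) 1 p1
      simpa only [one_mul] using e3
    · simp (disch := fun_prop) only [z, tlift_tlift, tlift_tmul, LinearMap.flip_apply,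
        Triple.act_mk, legAct_tmul]
      congr 2
      ext p0 p1
      rw [ca.tauLift_coact hGal (φ := fun p1 r1 => (Triple.mk (p0 ⊗ₜ[k] MulOpposite.op p1) (1 : H))
        ⊗ₜ[k] r1) (by fun_prop) (by fun_prop)]
  obtain ⟨w, hw⟩ := ca.exists_sub_mem_relOf hFF (ca.coinvAct (legAct k P))
    (ca.coinvAct (Triple.act k H P)) ca.betaSub ca.betaSub_coinvAct
    (ca.mem_relOf_of_opChi hGal _ h1)
  refine ⟨w, ?_⟩
  have h2 := ca.relOf_le_ker (ca.coinvAct (legAct k P)) (mulLeg (k := k)) (by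
    intro x b r
    simp (disch := fun_prop) only [mulLeg, tlift_tmul, coinvAct_apply, MulOpposite.op_mul, map_mul,
      Module.End.mul_apply]) hw
  rw [LinearMap.mem_ker, map_sub, sub_eq_zero] at h2
  rw [← h2]
  simp (disch := fun_prop) only [z, mulLeg, tlift_tlift, tlift_tmul, legAct_tmul]
  have h3 : ∀ (p0 : P) (p1 : H), tlift k (fun u v => p0 ⊗ₜ[k] MulOpposite.op (u * v)) (ca.tauLift hGal p1) =
      (counit (R := k) p1 • p0) ⊗ₜ[k] MulOpposite.op 1 := by
    intro p0 p1
    rw [ca.tauLift_mul hGal (f := fun x => p0 ⊗ₜ[k] MulOpposite.op x) (by fun_prop), smul_tmul']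
  simp only [h3]
  rw [← map_tlift (L := fun x => x ⊗ₜ[k] MulOpposite.op (1 : P)) (by fun_prop) (by fun_prop)
    (by fun_prop), ca.counit_coact]

end ComodAlg

namespace ComodAlg
variable {k : Type u} [Field k] {H P : Type v} [Ring H] [HopfAlgebra k H]
  [Ring P] [Algebra k P] (ca : ComodAlg k H P) {N : Type v} [AddCommGroup N] [Module k N]

theorem betaA_legAct (x : P ⊗[k] Pᵐᵒᵖ) (r : P) :
    ca.diagCoact (legAct k P (MulOpposite.op r) x) = tlift k (fun c h => tlift k (fun r0 r1 =>
      Triple.mk (legAct k P (MulOpposite.op r0) c) (h * r1)) (ca.ρ r)) (ca.betaA x) := by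
  have hl := lin_act (legAct k P)
  apply tensor_hom_ext x (hf := by fun_prop) (hg := by fun_prop)
  intro p q
  obtain ⟨q, rfl⟩ := MulOpposite.op_surjective q
  rw [legAct_tmul, diagCoact_tmul, betaA]
  simp (disch := fun_prop) only [tlift_tmul, tlift_tlift, legAct_tmul, MulOpposite.unop_op,
    ca.tlift_coact_mul, mul_assoc]

section
variable {L0 : Type v} [Ring L0] [Algebra k L0] (ι : L0 →ₐ[k] (P ⊗[k] Pᵐᵒᵖ))

/-- The map `X ⊗ r ↦ X (1 ⊗ r)` on `L ⊗ P`. -/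
def legMul : L0 ⊗[k] P →ₗ[k] P ⊗[k] Pᵐᵒᵖ :=
  tlift k (fun x r => legAct k P (MulOpposite.op r) (ι x))

theorem legMul_tmul (x : L0) (r : P) :
    legMul ι (x ⊗ₜ r) = legAct k P (MulOpposite.op r) (ι x) := by
  have hl := lin_act (legAct k P)
  simp (disch := fun_prop) only [legMul, tlift_tmul]

/-- `L ≅ (P ⊗ Pᵐᵒᵖ)^{coH}`. -/
def equivKer (hι : Function.Injective ι)
    (hιrange : Set.range ι = {z : P ⊗[k] Pᵐᵒᵖ | ca.betaA z = z ⊗ₜ[k] (1 : H)}) :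
    L0 ≃ₗ[k] LinearMap.ker ca.betaSub :=
  LinearEquiv.ofBijective (ι.toLinearMap.codRestrict _ (fun x => (ca.mem_ker_betaSub _).2
    (hιrange.le ⟨x, rfl⟩))) ⟨fun x y h => hι (congrArg Subtype.val h), fun y => by
      obtain ⟨x, hx⟩ := hιrange.ge ((ca.mem_ker_betaSub _).1 y.2)
      exact ⟨x, Subtype.ext hx⟩⟩

variable {ι} (hι : Function.Injective ι)
    (hιrange : Set.range ι = {z : P ⊗[k] Pᵐᵒᵖ | ca.betaA z = z ⊗ₜ[k] (1 : H)})

theorem mulLeg_equivKer (z : L0 ⊗[k] P) : mulLeg ((LinearMap.ker ca.betaSub).subtype.rTensor P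
    ((ca.equivKer ι hι hιrange).toLinearMap.rTensor P z)) = legMul ι z := by
  have hl := lin_act (legAct k P)
  induction z with
  | zero => simp only [map_zero]
  | add x y hx hy => simp only [map_add, hx, hy]
  | tmul x r =>
  rw [LinearMap.rTensor_tmul, LinearMap.rTensor_tmul, legMul_tmul]
  simp (disch := fun_prop) only [mulLeg, tlift_tmul]
  rfl

include hι hιrange in
theorem legMul_surjective (hGal : ca.IsGalois) (hFF : ca.IsFaithfullyFlat) :
    Function.Surjective (legMul (k := k) ι) := by
  rw [← LinearMap.range_eq_top, eq_top_iff]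
  rintro z -
  induction z with
  | zero => exact zero_mem _
  | add x y hx hy => exact add_mem hx hy
  | tmul p q =>
    obtain ⟨q, rfl⟩ := MulOpposite.op_surjective q
    obtain ⟨w, hw⟩ := ca.exists_mulLeg hGal hFF p
    obtain ⟨z, rfl⟩ : ∃ z, (ca.equivKer ι hι hιrange).toLinearMap.rTensor P z = w :=
      ((ca.equivKer ι hι hιrange).rTensor P).surjective w
    rw [mulLeg_equivKer] at hw
    refine ⟨(LinearMap.mulRight k q).lTensor L0 z, ?_⟩
    have h : ∀ z, legMul ι ((LinearMap.mulRight k q).lTensor L0 z) =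
        legAct k P (MulOpposite.op q) (legMul ι z) := by
      intro z
      apply tensor_hom_ext z (hf := by fun_prop) (hg := by fun_prop)
      intro x r
      rw [LinearMap.lTensor_tmul, legMul_tmul, legMul_tmul, LinearMap.mulRight_apply,
        MulOpposite.op_mul, map_mul, Module.End.mul_apply]
    rw [h, hw, legAct_tmul, one_mul]

theorem opChi_rTensor (hιrange : Set.range ι = {z : P ⊗[k] Pᵐᵒᵖ | ca.betaA z = z ⊗ₜ[k] (1 : H)})
    (z : L0 ⊗[k] P) :
    ca.opChi (legAct k P) (ι.toLinearMap.rTensor P z) = ca.betaA (legMul ι z) := by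
  have hl := lin_act (legAct k P)
  apply tensor_hom_ext z (hf := by fun_prop) (hg := by fun_prop)
  intro x r
  rw [LinearMap.rTensor_tmul, legMul_tmul, ← diagCoact_apply, betaA_legAct,
    show ca.betaA (ι x) = ι x ⊗ₜ[k] (1 : H) from hιrange.le ⟨x, rfl⟩]
  simp (disch := fun_prop) only [opChi, tlift_tmul, one_mul]
  rfl

theorem exists_eq_coinvAct
    (hιrange : Set.range ι = {z : P ⊗[k] Pᵐᵒᵖ | ca.betaA z = z ⊗ₜ[k] (1 : H)})
    (c : (↥ca.coinv)ᵐᵒᵖ) (x : L0) : ∃ y, ι y = ca.coinvAct (legAct k P) c (ι x) := by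
  have h := (ca.mem_ker_betaSub _).2 (hιrange.le ⟨x, rfl⟩)
  rw [LinearMap.mem_ker] at h
  apply hιrange.ge
  apply (ca.mem_ker_betaSub _).1
  rw [LinearMap.mem_ker, betaSub_coinvAct]
  exact (congrArg _ h).trans (map_zero _)

include hι hιrange in
theorem exists_legsAct : ∃ a : (↥ca.coinv)ᵐᵒᵖ →ₐ[k] Module.End k L0,
    ∀ c x, ι (a c x) = ca.coinvAct (legAct k P) c (ι x) := by
  choose y hy using ca.exists_eq_coinvAct hιrange
  refine ⟨
    { toFun := fun c => { toFun := y c, map_add' := ?_, map_smul' := ?_ }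
      map_one' := ?_
      map_mul' := ?_
      map_zero' := ?_
      map_add' := ?_
      commutes' := ?_ }, hy⟩
  · intro a b
    apply hι
    simp only [hy, map_add]
  · intro a b
    apply hι
    simp only [hy, map_smul, RingHom.id_apply]
  · ext x
    apply hι
    change ι (y 1 x) = ι x
    rw [hy, map_one]
    rfl
  · intro c d
    ext x
    apply hι
    change ι (y _ x) = ι (y _ (y _ x))
    rw [hy, hy, hy, map_mul]
    rfl
  · ext x
    apply hι
    change ι (y 0 x) = ι 0
    rw [hy, map_zero, map_zero]
    rfl
  · intro c d
    ext x
    apply hι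
    change ι (y _ x) = ι (y _ x + y _ x)
    rw [hy, map_add, map_add, hy, hy]
    rfl
  · intro c
    ext x
    apply hι
    change ι (y _ x) = ι (c • x)
    rw [hy, AlgHom.commutes, map_smul]
    rfl

include hι hιrange in
theorem eq_zero_of_legMul (hGal : ca.IsGalois) (hFF : ca.IsFaithfullyFlat)
    (F : L0 ⊗[k] P →ₗ[k] N)
    (hF : ∀ x y b p, ca.ρ b = b ⊗ₜ[k] (1 : H) → ι y = legAct k P (MulOpposite.op b) (ι x) →
      F (y ⊗ₜ p) = F (x ⊗ₜ (b * p)))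
    {z : L0 ⊗[k] P} (hz : legMul ι z = 0) : F z = 0 := by
  obtain ⟨a, ha⟩ := ca.exists_legsAct hι hιrange
  refine ca.relOf_le_ker a F (fun x b p => hF _ _ _ _ b.2 (ha _ _)) ?_
  refine ca.mem_relOf_of_injective hFF a (ca.coinvAct (legAct k P)) ι.toLinearMap ha hι ?_
  apply ca.mem_relOf_of_opChi hGal
  rw [ca.opChi_rTensor hιrange, hz, map_zero]

end
end ComodAlg

namespace ComodAlg
variable {k : Type u} [Field k] {H P : Type v} [Ring H] [HopfAlgebra k H]
  [Ring P] [Algebra k P] (ca : ComodAlg k H P)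

section
variable {V : Type*} [Ring V] [Algebra k V] {M : Type*} [AddCommGroup M] [Module k M]

/-- The map `p ⊗ q ↦ f(p) j(q)`. -/
def legEval (j : P →ₐ[k] V) (f : P → V) : P ⊗[k] Pᵐᵒᵖ →ₗ[k] V :=
  tlift k (fun p q => f p * j (MulOpposite.unop q))

theorem legEval_tmul (j : P →ₐ[k] V) {f : P → V} (hf : Lin k f) (p : P) (q : Pᵐᵒᵖ) :
    legEval j f (p ⊗ₜ q) = f p * j (MulOpposite.unop q) := by
  simp (disch := fun_prop) only [legEval, tlift_tmul]

@[fun_prop] theorem lin_legEval (j : P →ₐ[k] V) {f : M → P → V} (h1 : ∀ p, Lin k (fun a => f a p))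
    (h2 : ∀ a, Lin k (fun p => f a p)) (z : P ⊗[k] Pᵐᵒᵖ) :
    Lin k (fun a => legEval j (f a) z) := by
  unfold legEval
  fun_prop

theorem legEval_legAct (j : P →ₐ[k] V) {f : P → V} (hf : Lin k f) (r : P) (z : P ⊗[k] Pᵐᵒᵖ) :
    legEval j f (legAct k P (MulOpposite.op r) z) = legEval j f z * j r := by
  apply tensor_hom_ext z (hf := by fun_prop) (hg := by fun_prop)
  intro p q
  obtain ⟨q, rfl⟩ := MulOpposite.op_surjective q
  rw [legAct_tmul, legEval_tmul _ hf, legEval_tmul _ hf, MulOpposite.unop_op, MulOpposite.unop_op,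
    map_mul, mul_assoc]

end

section
variable {L0 : Type v} [Ring L0] [Algebra k L0] {ι : L0 →ₐ[k] (P ⊗[k] Pᵐᵒᵖ)}
  {V : Type*} [Ring V] [Algebra k V]

theorem legEval_legMul (j : P →ₐ[k] V) {f : P → V} (hf : Lin k f) (z : L0 ⊗[k] P) :
    legEval j f (legMul ι z) = tlift k (fun x r => legEval j f (ι x) * j r) z := by
  apply tensor_hom_ext z (hf := by fun_prop) (hg := by fun_prop)
  intro x r
  simp (disch := fun_prop) only [legMul_tmul, tlift_tmul, legEval_legAct]

theorem legEval_cancel (hsurj : Function.Surjective (legMul (k := k) ι)) (j : P →ₐ[k] V)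
    {f g : P → V} (hf : Lin k f) (hg : Lin k g)
    (h : ∀ X, legEval j f (ι X) = legEval j g (ι X)) (p : P) : f p = g p := by
  obtain ⟨z, hz⟩ := hsurj (p ⊗ₜ 1)
  have h1 : legEval j f (legMul ι z) = legEval j g (legMul ι z) := by
    rw [legEval_legMul j hf, legEval_legMul j hg]
    simp only [h]
  rwa [hz, legEval_tmul _ hf, legEval_tmul _ hg, MulOpposite.unop_one, map_one, mul_one,
    mul_one] at h1

/-- The map `(p ⊗ p', q ⊗ q') ↦ F(p, q) j(q'p')`. -/
def legEval₂ (j : P →ₐ[k] V) (F : P → P → V) (z w : P ⊗[k] Pᵐᵒᵖ) : V :=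
  legEval j (fun p => legEval j (F p) w) z

theorem legEval₂_cancel (hsurj : Function.Surjective (legMul (k := k) ι)) (j : P →ₐ[k] V)
    {f g : P → P → V} (hf : ∀ q, Lin k (fun p => f p q)) (hf' : ∀ p, Lin k (fun q => f p q))
    (hg : ∀ q, Lin k (fun p => g p q)) (hg' : ∀ p, Lin k (fun q => g p q))
    (h : ∀ X Y, legEval₂ j f (ι X) (ι Y) = legEval₂ j g (ι X) (ι Y)) (p q : P) :
    f p q = g p q :=
  legEval_cancel hsurj j (hf' p) (hg' p) (fun Y => legEval_cancel hsurj j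
    (f := fun p => legEval j (f p) (ι Y)) (g := fun p => legEval j (g p) (ι Y)) (by fun_prop)
    (by fun_prop) (fun X => h X Y) p) q

end

section
variable {L0 : Type v} [Ring L0] [Algebra k L0] {ι : L0 →ₐ[k] (P ⊗[k] Pᵐᵒᵖ)}

/-- A section of the surjective map `legMul ι`. -/
def legSection (hsurj : Function.Surjective (legMul (k := k) ι)) :
    P ⊗[k] Pᵐᵒᵖ →ₗ[k] L0 ⊗[k] P :=
  ((legMul (k := k) ι).exists_rightInverse_of_surjective (LinearMap.range_eq_top.2 hsurj)).choose

theorem legMul_legSection (hsurj : Function.Surjective (legMul (k := k) ι))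
    (w : P ⊗[k] Pᵐᵒᵖ) : legMul ι (legSection hsurj w) = w :=
  LinearMap.congr_fun ((legMul (k := k) ι).exists_rightInverse_of_surjective
    (LinearMap.range_eq_top.2 hsurj)).choose_spec w

/-- The map `f : P → P` with `legEval f = Λ` on `L`. -/
def legExt (hsurj : Function.Surjective (legMul (k := k) ι)) (Λ : L0 → P) (p : P) : P :=
  tlift k (fun x r => Λ x * r) (legSection hsurj (p ⊗ₜ 1))

theorem lin_legExt (hsurj : Function.Surjective (legMul (k := k) ι)) (Λ : L0 → P) :
    Lin k (fun p => legExt hsurj Λ p) := by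
  unfold legExt
  fun_prop

theorem lin_legExt_fun {M : Type*} [AddCommGroup M] [Module k M]
    (hsurj : Function.Surjective (legMul (k := k) ι)) {Λ : M → L0 → P}
    (h1 : ∀ x, Lin k (fun a => Λ a x)) (h2 : ∀ a, Lin k (fun x => Λ a x)) (p : P) :
    Lin k (fun a => legExt hsurj (Λ a) p) := by
  unfold legExt
  fun_prop

theorem legEval_legExt (hι : Function.Injective ι)
    (hιrange : Set.range ι = {z : P ⊗[k] Pᵐᵒᵖ | ca.betaA z = z ⊗ₜ[k] (1 : H)})
    (hGal : ca.IsGalois) (hFF : ca.IsFaithfullyFlat)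
    (hsurj : Function.Surjective (legMul (k := k) ι)) {Λ : L0 → P} (hΛ : Lin k Λ)
    (hb : ∀ x y b, ca.ρ b = b ⊗ₜ[k] (1 : H) → ι y = legAct k P (MulOpposite.op b) (ι x) →
      Λ y = Λ x * b) (X : L0) : legEval (AlgHom.id k P) (legExt hsurj Λ) (ι X) = Λ X := by
  have key : ∀ z z', legMul ι z = legMul ι z' →
      tlift k (fun x r => Λ x * r) z = tlift k (fun x r => Λ x * r) z' := by
    intro z z' h
    rw [← sub_eq_zero, ← map_sub]
    refine ca.eq_zero_of_legMul hι hιrange hGal hFF _ ?_ (by rw [map_sub, h, sub_self])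
    intro x y b p h1 h2
    simp (disch := fun_prop) only [tlift_tmul, hb x y b h1 h2, mul_assoc]
  have h2 : ∀ w, legEval (AlgHom.id k P) (legExt hsurj Λ) w =
      tlift k (fun x r => Λ x * r) (legSection hsurj w) := by
    intro w
    have hl := lin_legExt hsurj Λ
    apply tensor_hom_ext w (hf := by fun_prop) (hg := by fun_prop)
    intro p q
    obtain ⟨q, rfl⟩ := MulOpposite.op_surjective q
    have h3 : ∀ z, tlift k (fun x r => Λ x * r) z * q =
        tlift k (fun x r => Λ x * r) (tlift k (fun x r => x ⊗ₜ[k] (r * q)) z) := by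
      intro z
      simp (disch := fun_prop) only [tlift_mul, tlift_tlift, tlift_tmul, mul_assoc]
    have h4 : ∀ z, legMul ι (tlift k (fun x r => x ⊗ₜ[k] (r * q)) z) =
        legAct k P (MulOpposite.op q) (legMul ι z) := by
      intro z
      apply tensor_hom_ext z (hf := by fun_prop) (hg := by fun_prop)
      intro x r
      simp (disch := fun_prop) only [tlift_tmul, legMul_tmul]
      rw [MulOpposite.op_mul, map_mul, Module.End.mul_apply]
    rw [legEval_tmul _ hl, legExt, AlgHom.id_apply, MulOpposite.unop_op, h3]
    apply key
    rw [h4, legMul_legSection, legMul_legSection, ← MulOpposite.op_one, legAct_tmul, one_mul]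
  rw [h2, key _ (X ⊗ₜ 1), tlift_tmul (by fun_prop) (by fun_prop), mul_one]
  rw [legMul_legSection, legMul_tmul, MulOpposite.op_one, map_one, Module.End.one_apply]

end
end ComodAlg

namespace ComodAlg
variable {k : Type u} [Field k] {H P : Type v} [Ring H] [HopfAlgebra k H]
  [Ring P] [Algebra k P] (ca : ComodAlg k H P)

theorem algHom_legEval {V W : Type*} [Ring V] [Algebra k V] [Ring W] [Algebra k W]
    (φ : V →ₐ[k] W) (j : P →ₐ[k] V) {f : P → V} (hf : Lin k f) (z : P ⊗[k] Pᵐᵒᵖ) :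
    φ (legEval j f z) = legEval (φ.comp j) (fun p => φ (f p)) z := by
  rw [legEval, map_tlift (L := fun z => φ z) (by fun_prop) (by fun_prop) (by fun_prop)]
  simp only [map_mul]
  rfl

theorem legEval_coactHom {f : P → P} (hf : Lin k f) (c : H) {z : P ⊗[k] Pᵐᵒᵖ}
    (hz : ca.betaA z = z ⊗ₜ[k] (1 : H)) :
    legEval ca.coactHom (fun p => tlift k (fun p0 p1 => f p0 ⊗ₜ[k] (c * p1)) (ca.ρ p)) z =
      legEval (AlgHom.id k P) f z ⊗ₜ c := by
  have h := congrArg (tlift k (fun z h => legEval (AlgHom.id k P) f z ⊗ₜ[k] (c * h))) hz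
  rw [tlift_tmul (by fun_prop) (by fun_prop), mul_one] at h
  rw [← h]
  apply tensor_hom_ext z (hf := by fun_prop) (hg := by fun_prop)
  intro p q
  obtain ⟨q, rfl⟩ := MulOpposite.op_surjective q
  rw [legEval_tmul _ (by fun_prop), betaA, tlift_tmul (by fun_prop) (by fun_prop),
    coactHom_apply, MulOpposite.unop_op]
  conv_lhs => rw [← tlift_tmul_self (ca.ρ q)]
  simp (disch := fun_prop) only [mul_tlift, tlift_mul, tlift_tlift, tlift_tmul, legEval_tmul,
    Algebra.TensorProduct.tmul_mul_tmul, mul_assoc, MulOpposite.unop_op, AlgHom.id_apply]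
  exact tlift_swap (by fun_prop) (by fun_prop) (by fun_prop) (by fun_prop) _ _

theorem legEval₂_coactHom {F : P → P → P} (h1 : ∀ q, Lin k (fun p => F p q))
    (h2 : ∀ p, Lin k (fun q => F p q)) {z w : P ⊗[k] Pᵐᵒᵖ} (hz : ca.betaA z = z ⊗ₜ[k] (1 : H))
    (hw : ca.betaA w = w ⊗ₜ[k] (1 : H)) :
    legEval₂ ca.coactHom (fun p q => tlift k (fun p0 p1 => tlift k (fun q0 q1 =>
      F p0 q0 ⊗ₜ[k] (p1 * q1)) (ca.ρ q)) (ca.ρ p)) z w =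
      legEval₂ (AlgHom.id k P) F z w ⊗ₜ (1 : H) := by
  rw [legEval₂, legEval₂, ← ca.legEval_coactHom (by fun_prop) 1 hz]
  congr 2
  ext p
  rw [legEval]
  simp (disch := fun_prop) only [tlift_mul]
  refine (tlift_swap (by fun_prop) (by fun_prop) (by fun_prop) (by fun_prop) _ _).trans ?_
  congr 2
  ext p0 p1
  rw [one_mul, ← ca.legEval_coactHom (by fun_prop) p1 hw, legEval]
  simp (disch := fun_prop) only [tlift_mul]

theorem coact_legEval₂ {F : P → P → P} (h1 : ∀ q, Lin k (fun p => F p q))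
    (h2 : ∀ p, Lin k (fun q => F p q)) (z w : P ⊗[k] Pᵐᵒᵖ) :
    ca.ρ (legEval₂ (AlgHom.id k P) F z w) =
      legEval₂ ca.coactHom (fun p q => ca.ρ (F p q)) z w := by
  rw [← coactHom_apply, legEval₂, algHom_legEval _ _ (by fun_prop), legEval₂]
  congr 2
  ext p
  rw [algHom_legEval _ _ (by fun_prop)]
  rfl

/-- The map `(p ⊗ p', q ⊗ q') ↦ p₍₀₎ q₍₀₎ f(q₍₁₎ ⊗ p₍₁₎) q' p'`. -/
abbrev pairing (f : H ⊗[k] H →ₗ[k] P) (z w : P ⊗[k] Pᵐᵒᵖ) : P :=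
  legEval₂ (AlgHom.id k P) (fun p q => ca.twist (AlgHom.id k P) f p q) z w

theorem gammaOf_eq {L0 : Type v} [Ring L0] [Algebra k L0] (ι : L0 →ₐ[k] (P ⊗[k] Pᵐᵒᵖ))
    (f : H ⊗[k] H →ₗ[k] P) (X Y : L0) :
    GammaOf ca ι (fun a b => f (a ⊗ₜ b)) X Y = ca.pairing f (ι X) (ι Y) := by
  rw [GammaOf, pairing, legEval₂, legEval]
  congr 2
  ext p q
  rw [legEval, tlift_mul _ (by fun_prop) (by fun_prop)]
  congr 2
  ext p' q'
  rw [twist_apply]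
  simp (disch := fun_prop) only [tlift_mul, AlgHom.id_apply]

section
variable {L0 : Type v} [Ring L0] [Algebra k L0] {ι : L0 →ₐ[k] (P ⊗[k] Pᵐᵒᵖ)}

theorem pairing_cancel (hGal : ca.IsGalois) (hsurj : Function.Surjective (legMul (k := k) ι))
    {f g : H ⊗[k] H →ₗ[k] P} (h : ∀ X Y, ca.pairing f (ι X) (ι Y) = ca.pairing g (ι X) (ι Y)) :
    f = g := by
  apply ca.twist_cancel hGal (AlgHom.id k P)
  exact legEval₂_cancel hsurj (AlgHom.id k P) (by fun_prop) (by fun_prop) (by fun_prop)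
    (by fun_prop) h

theorem colin_iff_pairing (hsurj : Function.Surjective (legMul (k := k) ι))
    (hιrange : Set.range ι = {z : P ⊗[k] Pᵐᵒᵖ | ca.betaA z = z ⊗ₜ[k] (1 : H)})
    (f : H ⊗[k] H →ₗ[k] P) : ca.Colin f ↔
    ∀ X Y, ca.ρ (ca.pairing f (ι X) (ι Y)) = ca.pairing f (ι X) (ι Y) ⊗ₜ[k] (1 : H) := by
  have h0 : ∀ X, ca.betaA (ι X) = ι X ⊗ₜ[k] (1 : H) := fun X => hιrange.le ⟨X, rfl⟩
  constructor
  · intro h X Y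
    rw [coact_legEval₂ ca (by fun_prop) (by fun_prop), ← ca.legEval₂_coactHom (by fun_prop)
      (by fun_prop) (h0 X) (h0 Y)]
    congr 1
    ext p q : 2
    exact h p q
  · intro h
    refine legEval₂_cancel hsurj ca.coactHom (by fun_prop) (by fun_prop) (by fun_prop)
      (by fun_prop) ?_
    intro X Y
    rw [ca.legEval₂_coactHom (by fun_prop) (by fun_prop) (h0 X) (h0 Y), ← h,
      coact_legEval₂ ca (by fun_prop) (by fun_prop)]

end

end ComodAlg

namespace ComodAlg
variable {k : Type u} [Field k] {H P : Type v} [Ring H] [HopfAlgebra k H]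
  [Ring P] [Algebra k P] (ca : ComodAlg k H P)

theorem exists_twist_eq (hGal : ca.IsGalois)
    (hcomm : ∀ b, ca.ρ b = b ⊗ₜ[k] (1 : H) → ∀ p, p * b = b * p) {F : P → P → P}
    (h1 : ∀ q, Lin k (fun p => F p q)) (h2 : ∀ p, Lin k (fun q => F p q))
    (hb1 : ∀ b, ca.ρ b = b ⊗ₜ[k] (1 : H) → ∀ p q, F (b * p) q = b * F p q)
    (hb2 : ∀ b, ca.ρ b = b ⊗ₜ[k] (1 : H) → ∀ p q, F p (b * q) = b * F p q) :
    ∃ f : H ⊗[k] H →ₗ[k] P, ∀ p q, ca.twist (AlgHom.id k P) f p q = F p q := by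
  refine ⟨tlift k (fun h g => tlift k (fun u v => tlift k (fun u' v' => u * (u' * F v' v))
    (ca.tauLift hGal g)) (ca.tauLift hGal h)), fun p q => ?_⟩
  rw [twist_apply]
  have h3 := ca.coact_tauLift hGal (f := fun u v => u * F v q) (by fun_prop) (by fun_prop)
    (fun b hb p p' => by rw [hb1 b hb, mul_assoc]) p
  rw [one_mul] at h3
  rw [← h3]
  congr 2
  ext p0 p1
  have h4 := ca.coact_tauLift hGal (f := fun u v => u * tlift k (fun u' v' => u' * F v' v)
    (ca.tauLift hGal p1)) (by fun_prop) (by fun_prop) (fun b hb p p' => by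
      simp only [hb2 b hb, ← mul_assoc, hcomm b hb]
      simp (disch := fun_prop) only [mul_assoc, mul_tlift]
      simp only [← mul_assoc, hcomm b hb]) q
  rw [one_mul] at h4
  simp (disch := fun_prop) only [tlift_tmul, AlgHom.id_apply, mul_assoc, ← mul_tlift]
  simp (disch := fun_prop) only [mul_assoc, ← mul_tlift] at h4
  rw [h4]

section
variable {L0 : Type v} [Ring L0] [Algebra k L0] {ι : L0 →ₐ[k] (P ⊗[k] Pᵐᵒᵖ)}

theorem legEval_mul_left {f : P → P} (hf : Lin k f) (b : P) (z : P ⊗[k] Pᵐᵒᵖ) :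
    legEval (AlgHom.id k P) (fun p => f (b * p)) z =
      legEval (AlgHom.id k P) f ((b ⊗ₜ 1) * z) := by
  apply tensor_hom_ext z (hf := by fun_prop) (hg := by fun_prop)
  intro p q
  rw [Algebra.TensorProduct.tmul_mul_tmul, legEval_tmul _ (by fun_prop), legEval_tmul _ hf,
    one_mul]

theorem legEval_const_mul {f : P → P} (hf : Lin k f) (b : P) (z : P ⊗[k] Pᵐᵒᵖ) :
    legEval (AlgHom.id k P) (fun p => b * f p) z = b * legEval (AlgHom.id k P) f z := by
  rw [legEval, legEval, mul_tlift _ (by fun_prop) (by fun_prop)]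
  simp only [mul_assoc]

theorem exists_pairing_eq (hι : Function.Injective ι)
    (hιrange : Set.range ι = {z : P ⊗[k] Pᵐᵒᵖ | ca.betaA z = z ⊗ₜ[k] (1 : H)})
    (hGal : ca.IsGalois) (hFF : ca.IsFaithfullyFlat)
    (hcomm : ∀ b, ca.ρ b = b ⊗ₜ[k] (1 : H) → ∀ p, p * b = b * p) {Θ : L0 → L0 → P}
    (h1 : ∀ Y, Lin k (fun X => Θ X Y)) (h2 : ∀ X, Lin k (fun Y => Θ X Y))
    (hl1 : ∀ b, ca.ρ b = b ⊗ₜ[k] (1 : H) → ∃ c, ι c = b ⊗ₜ[k] 1 ∧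
      ∀ X Y, Θ (c * X) Y = b * Θ X Y ∧ Θ X (c * Y) = b * Θ X Y)
    (hr : ∀ x y b, ca.ρ b = b ⊗ₜ[k] (1 : H) → ι y = legAct k P (MulOpposite.op b) (ι x) →
      ∀ Z, Θ y Z = Θ x Z * b ∧ Θ Z y = Θ Z x * b) :
    ∃ f : H ⊗[k] H →ₗ[k] P, ∀ X Y, ca.pairing f (ι X) (ι Y) = Θ X Y := by
  have hsurj := ca.legMul_surjective hι hιrange hGal hFF
  let F : P → P → P := fun p q => legExt hsurj (fun Y => legExt hsurj (fun X => Θ X Y) p) q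
  have g1 : ∀ q, Lin k (fun p => F p q) := fun q =>
    lin_legExt_fun hsurj (fun Y => lin_legExt hsurj _) (fun p => lin_legExt_fun hsurj h2 h1 p) q
  have g2 : ∀ p, Lin k (fun q => F p q) := fun p => lin_legExt hsurj _
  have hF : ∀ X Y, legEval₂ (AlgHom.id k P) F (ι X) (ι Y) = Θ X Y := by
    intro X Y
    rw [legEval₂, ← ca.legEval_legExt hι hιrange hGal hFF hsurj (h1 Y)
      (fun x y b hb h => (hr x y b hb h Y).1) X]
    congr 2
    ext p
    refine ca.legEval_legExt hι hιrange hGal hFF hsurj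
      (lin_legExt_fun hsurj (fun X => h2 X) (fun Y => h1 Y) p) ?_ Y
    intro x y b hb h
    have h3 : ∀ X, Θ X y = b * Θ X x := fun X => by rw [(hr x y b hb h X).2, hcomm b hb]
    simp only [h3, hcomm b hb]
    rw [legExt, legExt, mul_tlift _ (by fun_prop) (by fun_prop)]
    simp only [mul_assoc]
  obtain ⟨f, hf⟩ := ca.exists_twist_eq hGal hcomm g1 g2 (fun b hb => by
    obtain ⟨c, hc, hc'⟩ := hl1 b hb
    apply legEval₂_cancel hsurj (AlgHom.id k P) (by fun_prop) (by fun_prop) (by fun_prop)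
      (by fun_prop)
    intro X Y
    rw [legEval₂, legEval_mul_left (f := fun p => legEval _ (F p) (ι Y)) (by fun_prop), ← hc,
      ← map_mul]
    refine (hF _ _).trans ?_
    rw [(hc' X Y).1, ← hF, legEval₂, legEval₂, ← legEval_const_mul (by fun_prop)]
    congr 2
    ext p
    rw [legEval_const_mul (by fun_prop)]) (fun b hb => by
    obtain ⟨c, hc, hc'⟩ := hl1 b hb
    apply legEval₂_cancel hsurj (AlgHom.id k P) (by fun_prop) (by fun_prop) (by fun_prop)
      (by fun_prop)
    intro X Y
    have h5 : ∀ p, legEval (AlgHom.id k P) (fun q => F p (b * q)) (ι Y) =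
        legEval (AlgHom.id k P) (F p) (ι (c * Y)) := fun p => by
      rw [legEval_mul_left (by fun_prop), ← hc, ← map_mul]
    rw [legEval₂]
    simp only [h5]
    refine (hF _ _).trans ?_
    rw [(hc' X Y).2, ← hF, legEval₂, legEval₂, ← legEval_const_mul (by fun_prop)]
    congr 2
    ext p
    rw [legEval_const_mul (by fun_prop)])
  refine ⟨f, fun X Y => ?_⟩
  rw [← hF, pairing]
  simp only [hf]

end

end ComodAlg

namespace BgdST
variable {k B L : Type*} [Field k] [Ring B] [Algebra k B] [Ring L] [Algebra k L]
  (st : BgdST k B L) {Q R : Type*} [AddCommGroup Q] [Module k Q] [AddCommGroup R] [Module k R]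

theorem lift2_mk {f : L → L → Q} (h1 : ∀ y, Lin k (fun x => f x y))
    (h2 : ∀ x, Lin k (fun y => f x y)) (hb : ∀ b x y, f (st.t b * x) y = f x (st.s b * y))
    (z : L ⊗[k] L) : st.lift2 f (Submodule.Quotient.mk z) = tlift k f z := by
  refine qtlift_mk h1 h2 (fun z hz => ?_) z
  rw [← LinearMap.mem_ker]
  revert z
  change st.rel ≤ _
  rw [rel, Submodule.span_le]
  rintro z ⟨b, x, y, rfl⟩
  rw [SetLike.mem_coe, LinearMap.mem_ker, map_sub, tlift_tmul h1 h2, tlift_tmul h1 h2, hb, sub_self]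

theorem map_lift2 (φ : Q →ₗ[k] R) {f : L → L → Q} (h1 : ∀ y, Lin k (fun x => f x y))
    (h2 : ∀ x, Lin k (fun y => f x y)) (hb : ∀ b x y, f (st.t b * x) y = f x (st.s b * y))
    (z : st.T2) : φ (st.lift2 f z) = st.lift2 (fun x y => φ (f x y)) z := by
  obtain ⟨z, rfl⟩ := Submodule.Quotient.mk_surjective _ z
  rw [st.lift2_mk h1 h2 hb, st.lift2_mk (by fun_prop) (by fun_prop)
    (fun b x y => congrArg φ (hb b x y)),
    map_tlift (L := fun z => φ z) (by fun_prop) (by fun_prop) (by fun_prop)]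

end BgdST

namespace ComodAlg
variable {k : Type u} [Field k] {H P : Type v} [Ring H] [HopfAlgebra k H]
  [Ring P] [Algebra k P] (ca : ComodAlg k H P)

section
variable {V M : Type*} [AddCommGroup V] [Module k V] [AddCommGroup M] [Module k M]

/-- The map `p ⊗ q ↦ G(p₍₀₎ ⊗ u, v ⊗ q)` where `u ⊗ v` represents `τ(p₍₁₎)`. -/
def legDelta (hGal : ca.IsGalois) (G : P ⊗[k] Pᵐᵒᵖ → P ⊗[k] Pᵐᵒᵖ → V) :
    P ⊗[k] Pᵐᵒᵖ →ₗ[k] V :=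
  tlift k (fun p q => tlift k (fun p0 p1 => tlift k (fun u v =>
    G (p0 ⊗ₜ MulOpposite.op u) (v ⊗ₜ q)) (ca.tauLift hGal p1)) (ca.ρ p))

@[fun_prop] theorem lin_legDelta (hGal : ca.IsGalois)
    {G : M → P ⊗[k] Pᵐᵒᵖ → P ⊗[k] Pᵐᵒᵖ → V} (h0 : ∀ x y, Lin k (fun a => G a x y))
    (h1 : ∀ a y, Lin k (fun x => G a x y)) (h2 : ∀ a x, Lin k (fun y => G a x y))
    (z : P ⊗[k] Pᵐᵒᵖ) : Lin k (fun a => ca.legDelta hGal (G a) z) := by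
  unfold legDelta
  fun_prop

theorem legDelta_tmul (hGal : ca.IsGalois) {G : P ⊗[k] Pᵐᵒᵖ → P ⊗[k] Pᵐᵒᵖ → V}
    (h1 : ∀ y, Lin k (fun x => G x y)) (h2 : ∀ x, Lin k (fun y => G x y)) (p : P) (q : Pᵐᵒᵖ) :
    ca.legDelta hGal G (p ⊗ₜ q) = tlift k (fun p0 p1 => tlift k (fun u v =>
      G (p0 ⊗ₜ MulOpposite.op u) (v ⊗ₜ q)) (ca.tauLift hGal p1)) (ca.ρ p) := by
  rw [legDelta, tlift_tmul (by fun_prop) (by fun_prop)]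

/-- `G` is balanced over the coinvariants. -/
def IsBalanced (G : P ⊗[k] Pᵐᵒᵖ → P ⊗[k] Pᵐᵒᵖ → V) : Prop :=
  ∀ b, ca.ρ b = b ⊗ₜ[k] (1 : H) → ∀ x y,
    G ((1 ⊗ₜ MulOpposite.op b) * x) y = G x ((b ⊗ₜ 1) * y)

theorem esDeltaEval_eq (hGal : ca.IsGalois) {G : P ⊗[k] Pᵐᵒᵖ → P ⊗[k] Pᵐᵒᵖ → V}
    (h1 : ∀ y, Lin k (fun x => G x y)) (h2 : ∀ x, Lin k (fun y => G x y))
    (hb : ca.IsBalanced G) : ca.esDeltaEval G = ca.legDelta hGal G := by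
  rw [esDeltaEval, legDelta]
  congr 1
  ext p q
  congr 2
  ext p0 p1
  rw [← ca.mk_tauLift hGal]
  refine qtlift_mk (by fun_prop) (by fun_prop) (ca.tlift_relB (by fun_prop) (by fun_prop) ?_) _
  intro b hb' u v
  have := hb b hb' (p0 ⊗ₜ MulOpposite.op u) (v ⊗ₜ q)
  rwa [Algebra.TensorProduct.tmul_mul_tmul, Algebra.TensorProduct.tmul_mul_tmul, one_mul, one_mul,
    ← MulOpposite.op_mul] at this

end

theorem coact_counit {V : Type*} [AddCommGroup V] [Module k V] {f : P → V} (hf : Lin k f) (p : P) :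
    tlift k (fun p0 p1 => counit (R := k) p1 • f p0) (ca.ρ p) = f p := by
  conv_rhs => rw [← ca.counit_coact p]
  rw [map_tlift (L := fun z => f z) (by fun_prop) (by fun_prop) (by fun_prop)]
  simp only [hf.map_smul]

theorem pairing_tmul (f : H ⊗[k] H →ₗ[k] P) (p q : P) (p' q' : Pᵐᵒᵖ) :
    ca.pairing f (p ⊗ₜ p') (q ⊗ₜ q') = ca.twist (AlgHom.id k P) f p q *
      MulOpposite.unop q' * MulOpposite.unop p' := by
  rw [pairing, legEval₂, legEval_tmul _ (by fun_prop), legEval_tmul _ (by fun_prop)]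
  rfl

@[fun_prop] theorem lin_pairing_left (f : H ⊗[k] H →ₗ[k] P) (w : P ⊗[k] Pᵐᵒᵖ) :
    Lin k (fun z => ca.pairing f z w) := by
  unfold pairing legEval₂
  fun_prop

@[fun_prop] theorem lin_pairing_right (f : H ⊗[k] H →ₗ[k] P) (z : P ⊗[k] Pᵐᵒᵖ) :
    Lin k (fun w => ca.pairing f z w) := by
  unfold pairing legEval₂
  fun_prop

theorem legDelta_legDelta (hGal : ca.IsGalois) (f : H ⊗[k] H →ₗ[k] P)
    {ω : P → P ⊗[k] Pᵐᵒᵖ → P ⊗[k] Pᵐᵒᵖ → P} (h1 : ∀ x y, Lin k (fun c => ω c x y))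
    (h2 : ∀ c y, Lin k (fun x => ω c x y)) (h3 : ∀ c x, Lin k (fun y => ω c x y)) (p q : P)
    (p' q' : Pᵐᵒᵖ) :
    ca.legDelta hGal (fun w1 w2 => ca.legDelta hGal (fun x1 x2 =>
      ω (ca.pairing f x1 w1) x2 w2) (p ⊗ₜ p')) (q ⊗ₜ q') =
    tlift k (fun p0 p1 => tlift k (fun q0 q1 => tlift k (fun u' v' => tlift k (fun u v =>
      ω (ca.twist (AlgHom.id k P) f p0 q0 * u' * u) (v ⊗ₜ p') (v' ⊗ₜ q'))
        (ca.tauLift hGal p1)) (ca.tauLift hGal q1)) (ca.ρ q)) (ca.ρ p) := by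
  rw [ca.legDelta_tmul hGal (by fun_prop) (by fun_prop)]
  refine Eq.trans ?_ (tlift_swap (by fun_prop) (by fun_prop) (by fun_prop) (by fun_prop) _ _).symm
  congr 2
  ext q0 q1
  refine Eq.trans ?_ (tlift_swap (by fun_prop) (by fun_prop) (by fun_prop) (by fun_prop) _ _).symm
  congr 2
  ext u' v'
  rw [ca.legDelta_tmul hGal (by fun_prop) (by fun_prop)]
  simp only [pairing_tmul, MulOpposite.unop_op]

theorem legDelta_mul_pairing (hGal : ca.IsGalois) (f g : H ⊗[k] H →ₗ[k] P)
    (z w : P ⊗[k] Pᵐᵒᵖ) :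
    ca.legDelta hGal (fun w1 w2 => ca.legDelta hGal (fun x1 x2 =>
      ca.pairing f x1 w1 * ca.pairing g x2 w2) z) w = ca.pairing (cv f g) z w := by
  apply tensor_hom_ext z (hf := by fun_prop) (hg := by fun_prop)
  intro p p'
  apply tensor_hom_ext w (hf := by fun_prop) (hg := by fun_prop)
  intro q q'
  rw [ca.legDelta_legDelta hGal f (ω := fun c x y => c * ca.pairing g x y) (by fun_prop)
    (by fun_prop) (by fun_prop), pairing_tmul, twist_cv]
  simp (disch := fun_prop) only [tlift_mul]
  congr 2
  ext p0 p1
  congr 2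
  ext q0 q1
  set x := ca.twist (AlgHom.id k P) f p0 q0
  have h1 := ca.tauLift_coact hGal (φ := fun a b => x * a * g (b ⊗ₜ p1) *
    MulOpposite.unop q' * MulOpposite.unop p') (by fun_prop) (by fun_prop) q1
  rw [mul_one] at h1
  rw [← h1]
  congr 2
  ext u' v'
  have h2 : ∀ a b, tlift k (fun u v => tlift k (fun v0 v1 =>
      x * (u' * ((u * v0) * (a * g (b ⊗ₜ v1))))) (ca.ρ v)) (ca.tauLift hGal p1) = x * u' * a * g (b ⊗ₜ p1) := by
    intro a b
    rw [ca.tauLift_coact hGal (φ := fun c d => x * (u' * (c * (a * g (b ⊗ₜ d)))))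
      (by fun_prop) (by fun_prop) p1]
    simp only [one_mul, mul_assoc]
  simp only [← mul_assoc] at h2 ⊢
  simp only [← h2]
  simp (disch := fun_prop) only [tlift_mul, pairing_tmul, twist_apply, mul_tlift, AlgHom.id_apply]
  rw [← tlift_swap (by fun_prop) (by fun_prop) (by fun_prop) (by fun_prop)]
  congr 2
  ext u v
  rw [← tlift_swap (by fun_prop) (by fun_prop) (by fun_prop) (by fun_prop)]
  simp only [mul_assoc]

theorem legDelta_mul (hGal : ca.IsGalois) (f : H ⊗[k] H →ₗ[k] P) {K : P ⊗[k] Pᵐᵒᵖ → P}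
    (hK : Lin k K) (z w : P ⊗[k] Pᵐᵒᵖ) :
    ca.legDelta hGal (fun w1 w2 => ca.legDelta hGal (fun x1 x2 =>
      K ((ca.pairing f x1 w1 ⊗ₜ 1) * (x2 * w2))) z) w =
    tlift k (fun p p' => tlift k (fun q q' =>
      K (ca.twist (AlgHom.id k P) f p q ⊗ₜ (p' * q'))) w) z := by
  apply tensor_hom_ext z (hf := by fun_prop) (hg := by fun_prop)
  intro p p'
  apply tensor_hom_ext w (hf := by fun_prop) (hg := by fun_prop)
  intro q q'
  rw [ca.legDelta_legDelta hGal f (ω := fun c x y => K ((c ⊗ₜ 1) * (x * y))) (by fun_prop)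
    (by fun_prop) (by fun_prop), tlift_tmul (by fun_prop) (by fun_prop),
    tlift_tmul (by fun_prop) (by fun_prop)]
  refine Eq.trans ?_ (ca.coact_counit (f := fun p =>
    K (ca.twist (AlgHom.id k P) f p q ⊗ₜ (p' * q'))) (by fun_prop) p)
  congr 2
  ext p0 p1
  rw [← ca.coact_counit (f := fun q => K (ca.twist (AlgHom.id k P) f p0 q ⊗ₜ (p' * q')))
    (by fun_prop) q, map_tlift (L := fun z => counit (R := k) p1 • z)
    (by fun_prop) (by fun_prop) (by fun_prop)]
  congr 2
  ext q0 q1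
  set x := ca.twist (AlgHom.id k P) f p0 q0
  have h1 := ca.tauLift_mul hGal (f := fun a => counit (R := k) p1 •
    K ((x * a) ⊗ₜ (p' * q'))) (by fun_prop) q1
  rw [mul_one, smul_comm] at h1
  rw [← h1]
  congr 2
  ext u' v'
  have h2 := ca.tauLift_mul hGal (f := fun a =>
    K ((x * (u' * (a * v'))) ⊗ₜ (p' * q'))) (by fun_prop) p1
  rw [one_mul] at h2
  rw [← h2]
  simp only [Algebra.TensorProduct.tmul_mul_tmul, one_mul, mul_assoc]

end ComodAlg

namespace ComodAlg
variable {k : Type u} [Field k] {H P : Type v} [Ring H] [HopfAlgebra k H]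
  [Ring P] [Algebra k P] (ca : ComodAlg k H P)

theorem pairing_op_mul (f : H ⊗[k] H →ₗ[k] P) (b : P) (z w : P ⊗[k] Pᵐᵒᵖ) :
    ca.pairing f ((1 ⊗ₜ MulOpposite.op b) * z) w = ca.pairing f z w * b := by
  apply tensor_hom_ext z (hf := by fun_prop) (hg := by fun_prop)
  intro p p'
  apply tensor_hom_ext w (hf := by fun_prop) (hg := by fun_prop)
  intro q q'
  rw [Algebra.TensorProduct.tmul_mul_tmul, pairing_tmul, pairing_tmul, one_mul,
    MulOpposite.unop_mul, MulOpposite.unop_op, mul_assoc _ _ b]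

theorem pairing_coinv_mul (f : H ⊗[k] H →ₗ[k] P) {b : P} (hb : ca.ρ b = b ⊗ₜ[k] (1 : H))
    (z w : P ⊗[k] Pᵐᵒᵖ) : ca.pairing f ((b ⊗ₜ 1) * z) w = b * ca.pairing f z w := by
  apply tensor_hom_ext z (hf := by fun_prop) (hg := by fun_prop)
  intro p p'
  apply tensor_hom_ext w (hf := by fun_prop) (hg := by fun_prop)
  intro q q'
  rw [Algebra.TensorProduct.tmul_mul_tmul, pairing_tmul, pairing_tmul, one_mul,
    ca.twist_coinv_mul f hb, mul_assoc, mul_assoc, mul_assoc]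

theorem pairing_mul_coinv (f : H ⊗[k] H →ₗ[k] P) {b : P} (hb : ca.ρ b = b ⊗ₜ[k] (1 : H)) (c : P)
    (z w : P ⊗[k] Pᵐᵒᵖ) : ca.pairing f (z * (b ⊗ₜ 1) * (1 ⊗ₜ MulOpposite.op c)) w =
      ca.pairing f z ((b ⊗ₜ 1) * ((1 ⊗ₜ MulOpposite.op c) * w)) := by
  apply tensor_hom_ext z (hf := by fun_prop) (hg := by fun_prop)
  intro p p'
  apply tensor_hom_ext w (hf := by fun_prop) (hg := by fun_prop)
  intro q q'
  simp only [Algebra.TensorProduct.tmul_mul_tmul, pairing_tmul, one_mul, mul_one,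
    MulOpposite.unop_mul, MulOpposite.unop_op, mul_assoc]
  rw [ca.twist_mul_coinv f hb]

variable {ca}

theorem tmul_comm_of_comm {b : P} (hb : ∀ p, p * b = b * p) (z : P ⊗[k] Pᵐᵒᵖ) :
    z * (b ⊗ₜ 1) = (b ⊗ₜ 1) * z := by
  apply tensor_hom_ext z (hf := by fun_prop) (hg := by fun_prop)
  intro p p'
  rw [Algebra.TensorProduct.tmul_mul_tmul, Algebra.TensorProduct.tmul_mul_tmul, one_mul, mul_one,
    hb]

theorem op_tmul_comm_of_comm {b : P} (hb : ∀ p, p * b = b * p) (z : P ⊗[k] Pᵐᵒᵖ) :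
    z * (1 ⊗ₜ MulOpposite.op b) = (1 ⊗ₜ MulOpposite.op b) * z := by
  apply tensor_hom_ext z (hf := by fun_prop) (hg := by fun_prop)
  intro p p'
  obtain ⟨p', rfl⟩ := MulOpposite.op_surjective p'
  rw [Algebra.TensorProduct.tmul_mul_tmul, Algebra.TensorProduct.tmul_mul_tmul, one_mul, mul_one,
    ← MulOpposite.op_mul, ← MulOpposite.op_mul, hb]

theorem pairing_mul_tmul_one {b : P} (hb : ca.ρ b = b ⊗ₜ[k] (1 : H)) (hb' : ∀ p, p * b = b * p)
    (f : H ⊗[k] H →ₗ[k] P) (z w : P ⊗[k] Pᵐᵒᵖ) :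
    ca.pairing f z ((b ⊗ₜ 1) * w) = b * ca.pairing f z w := by
  have h := ca.pairing_mul_coinv f hb 1 z w
  rw [MulOpposite.op_one, ← Algebra.TensorProduct.one_def, mul_one, one_mul] at h
  rw [← h, tmul_comm_of_comm hb', pairing_coinv_mul ca f hb]

theorem pairing_mul_one_tmul {b : P} (hb' : ∀ p, p * b = b * p)
    (f : H ⊗[k] H →ₗ[k] P) (z w : P ⊗[k] Pᵐᵒᵖ) :
    ca.pairing f z ((1 ⊗ₜ MulOpposite.op b) * w) = b * ca.pairing f z w := by
  have h := ca.pairing_mul_coinv f (b := 1) ca.coact_one b z w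
  rw [← Algebra.TensorProduct.one_def, mul_one, one_mul] at h
  rw [← h, op_tmul_comm_of_comm hb', pairing_op_mul, hb']

theorem legEval_one_iff {L0 : Type v} [Ring L0] [Algebra k L0] {ι : L0 →ₐ[k] (P ⊗[k] Pᵐᵒᵖ)}
    (hsurj : Function.Surjective (legMul (k := k) ι)) {f : P → P} (hf : Lin k f) :
    (∀ X, legEval (AlgHom.id k P) f (ι X) = mulA (ι X)) ↔ ∀ p, f p = p :=
  ⟨fun h p => legEval_cancel hsurj (AlgHom.id k P) hf (g := fun p => p) (by fun_prop) h p,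
    fun h X => by rw [legEval]; simp only [h]; rfl⟩

theorem pairing_one_left (f : H ⊗[k] H →ₗ[k] P) (w : P ⊗[k] Pᵐᵒᵖ) :
    ca.pairing f 1 w = legEval (AlgHom.id k P) (fun q => ca.twist (AlgHom.id k P) f 1 q) w := by
  rw [pairing, legEval₂, Algebra.TensorProduct.one_def, legEval_tmul _ (by fun_prop),
    MulOpposite.unop_one, AlgHom.id_apply, mul_one]

theorem pairing_one_right (f : H ⊗[k] H →ₗ[k] P) (z : P ⊗[k] Pᵐᵒᵖ) :
    ca.pairing f z 1 = legEval (AlgHom.id k P) (fun q => ca.twist (AlgHom.id k P) f q 1) z := by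
  rw [pairing, legEval₂, Algebra.TensorProduct.one_def]
  congr 2
  ext p
  rw [legEval_tmul _ (by fun_prop), MulOpposite.unop_one, AlgHom.id_apply, mul_one]

theorem pairing_cvOne (z w : P ⊗[k] Pᵐᵒᵖ) :
    ca.pairing (cvOne k H P) z w = mulA (z * w) := by
  apply tensor_hom_ext z (hf := by fun_prop) (hg := by fun_prop)
  intro p p'
  apply tensor_hom_ext w (hf := by fun_prop) (hg := by fun_prop)
  intro q q'
  rw [pairing_tmul, Algebra.TensorProduct.tmul_mul_tmul, mulA, tlift_tmul (by fun_prop)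
    (by fun_prop), MulOpposite.unop_mul, ← mul_assoc]
  congr 2
  rw [twist_apply]
  refine Eq.trans ?_ (ca.coact_counit (f := fun p => p * q) (by fun_prop) p)
  congr 2
  ext p0 p1
  refine Eq.trans ?_ (ca.coact_counit (f := fun q => counit (R := k) p1 • (p0 * q)) (by fun_prop) q)
  congr 2
  ext q0 q1
  rw [cvOne_tmul]
  simp [Algebra.algebraMap_eq_smul_one, smul_smul]

/-- The map `(p ⊗ p', q ⊗ q') ↦ p₍₀₎ q₍₀₎ f(q₍₁₎ ⊗ p₍₁₎) ⊗ q'p'`. -/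
def prodA (ca : ComodAlg k H P) (f : H ⊗[k] H →ₗ[k] P) (z w : P ⊗[k] Pᵐᵒᵖ) : P ⊗[k] Pᵐᵒᵖ :=
  tlift k (fun p p' => tlift k (fun q q' =>
      ca.twist (AlgHom.id k P) f p q ⊗ₜ (p' * q')) w) z

theorem pairing_prodA_right (f : H ⊗[k] H →ₗ[k] P) (x z w : P ⊗[k] Pᵐᵒᵖ) :
    ca.pairing f x (ca.prodA f z w) = legEval (AlgHom.id k P) (fun p =>
      legEval (AlgHom.id k P) (fun q => legEval (AlgHom.id k P) (fun r =>
        ca.twist (AlgHom.id k P) f p (ca.twist (AlgHom.id k P) f q r)) w) z) x := by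
  unfold prodA
  apply tensor_hom_ext x (hf := by fun_prop) (hg := by fun_prop)
  intro p p'
  apply tensor_hom_ext z (hf := by fun_prop) (hg := by fun_prop)
  intro q q'
  apply tensor_hom_ext w (hf := by fun_prop) (hg := by fun_prop)
  intro r r'
  simp (disch := fun_prop) only [tlift_tmul, legEval_tmul, pairing_tmul, MulOpposite.unop_mul,
    mul_assoc, AlgHom.id_apply]

theorem pairing_prodA_left (f : H ⊗[k] H →ₗ[k] P) (x z w : P ⊗[k] Pᵐᵒᵖ) :
    ca.pairing f (ca.prodA f x z) w = legEval (AlgHom.id k P) (fun p =>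
      legEval (AlgHom.id k P) (fun q => legEval (AlgHom.id k P) (fun r =>
        ca.twist (AlgHom.id k P) f (ca.twist (AlgHom.id k P) f p q) r) w) z) x := by
  unfold prodA
  apply tensor_hom_ext x (hf := by fun_prop) (hg := by fun_prop)
  intro p p'
  apply tensor_hom_ext z (hf := by fun_prop) (hg := by fun_prop)
  intro q q'
  apply tensor_hom_ext w (hf := by fun_prop) (hg := by fun_prop)
  intro r r'
  simp (disch := fun_prop) only [tlift_tmul, legEval_tmul, pairing_tmul, MulOpposite.unop_mul,
    mul_assoc, AlgHom.id_apply]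

theorem assoc_iff {L0 : Type v} [Ring L0] [Algebra k L0] {ι : L0 →ₐ[k] (P ⊗[k] Pᵐᵒᵖ)}
    (hsurj : Function.Surjective (legMul (k := k) ι)) (f : H ⊗[k] H →ₗ[k] P) :
    (∀ X Y Z, ca.pairing f (ι X) (ca.prodA f (ι Y) (ι Z)) =
      ca.pairing f (ca.prodA f (ι X) (ι Y)) (ι Z)) ↔
    ∀ p q r, ca.twist (AlgHom.id k P) f p (ca.twist (AlgHom.id k P) f q r) =
      ca.twist (AlgHom.id k P) f (ca.twist (AlgHom.id k P) f p q) r := by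
  simp only [pairing_prodA_left, pairing_prodA_right]
  constructor
  · intro h p q r
    refine legEval_cancel hsurj (AlgHom.id k P)
      (f := fun r => ca.twist (AlgHom.id k P) f p (ca.twist (AlgHom.id k P) f q r))
      (g := fun r => ca.twist (AlgHom.id k P) f (ca.twist (AlgHom.id k P) f p q) r)
      (by fun_prop) (by fun_prop) (fun Z => ?_) r
    exact legEval₂_cancel hsurj (AlgHom.id k P) (by fun_prop) (by fun_prop) (by fun_prop)
      (by fun_prop) (fun X Y => h X Y Z) p q
  · intro h X Y Z
    simp only [h]

end ComodAlg

namespace ComodAlg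
variable {k : Type u} [Field k] {H P : Type v} [Ring H] [HopfAlgebra k H]
  [Ring P] [Algebra k P] {ca : ComodAlg k H P}
  {B0 L0 : Type v} [Ring B0] [Algebra k B0] [Ring L0] [Algebra k L0]
  {ιB : B0 →ₐ[k] P} {ι : L0 →ₐ[k] (P ⊗[k] Pᵐᵒᵖ)} {st : BgdST k B0 L0} {cop : L0 →ₗ[k] st.T2}
  {cou : L0 →ₗ[k] B0}

/-- `L0` is the Ehresmann–Schauenburg bialgebroid, over the central subalgebra `B0` of
coinvariants, of a faithfully flat Hopf–Galois extension. -/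
structure IsEhresmannSchauenburg (ca : ComodAlg k H P) (ιB : B0 →ₐ[k] P)
    (ι : L0 →ₐ[k] (P ⊗[k] Pᵐᵒᵖ)) (st : BgdST k B0 L0) (cop : L0 →ₗ[k] st.T2)
    (cou : L0 →ₗ[k] B0) : Prop where
  gal : ca.IsGalois
  flat : ca.IsFaithfullyFlat
  injB : Function.Injective ιB
  rangeB : Set.range ιB = {p : P | ca.ρ p = p ⊗ₜ[k] (1 : H)}
  inj : Function.Injective ι
  range : Set.range ι = {z : P ⊗[k] Pᵐᵒᵖ | ca.betaA z = z ⊗ₜ[k] (1 : H)}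
  source : ∀ b, ι (st.s b) = ιB b ⊗ₜ 1
  target : ∀ b, ι (st.t b) = 1 ⊗ₜ MulOpposite.op (ιB b)
  counit : ∀ z, ιB (cou z) = mulA (ι z)
  comul : ∀ (V : Type v) [AddCommGroup V] [Module k V]
    (G : (P ⊗[k] Pᵐᵒᵖ) →ₗ[k] (P ⊗[k] Pᵐᵒᵖ) →ₗ[k] V),
    (∀ (b : B0) (X Y : P ⊗[k] Pᵐᵒᵖ),
      G ((1 ⊗ₜ MulOpposite.op (ιB b)) * X) Y = G X ((ιB b ⊗ₜ 1) * Y)) →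
    ∀ z : L0, st.lift2 (fun x y => G (ι x) (ι y)) (cop z) =
      ca.esDeltaEval (fun x y => G x y) (ι z)
  comm : ∀ b, ca.ρ b = b ⊗ₜ[k] (1 : H) → ∀ p, p * b = b * p

/-- `Γ` is the bilinear map `(p ⊗ p', q ⊗ q') ↦ p₍₀₎ q₍₀₎ f(q₍₁₎ ⊗ p₍₁₎) q'p'`. -/
def Represents (ca : ComodAlg k H P) (ιB : B0 →ₐ[k] P) (ι : L0 →ₐ[k] (P ⊗[k] Pᵐᵒᵖ))
    (f : H ⊗[k] H →ₗ[k] P) (Γ : L0 → L0 → B0) : Prop :=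
  ∀ X Y, ιB (Γ X Y) = ca.pairing f (ι X) (ι Y)

namespace IsEhresmannSchauenburg
variable (D : IsEhresmannSchauenburg ca ιB ι st cop cou)
include D

theorem coact_ιB (b : B0) : ca.ρ (ιB b) = ιB b ⊗ₜ[k] (1 : H) := D.rangeB.le ⟨b, rfl⟩

theorem comm_ιB (b : B0) (p : P) : p * ιB b = ιB b * p := D.comm _ (D.coact_ιB b) p

theorem legMul_surjective : Function.Surjective (legMul (k := k) ι) :=
  ca.legMul_surjective D.inj D.range D.gal D.flat

theorem lift2_comul {Φ : L0 → L0 → B0} {G : P ⊗[k] Pᵐᵒᵖ → P ⊗[k] Pᵐᵒᵖ → P}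
    (h1 : ∀ y, Lin k (fun x => G x y)) (h2 : ∀ x, Lin k (fun y => G x y))
    (hb : ca.IsBalanced G) (h : ∀ x y, ιB (Φ x y) = G (ι x) (ι y)) (z : L0) :
    ιB (st.lift2 Φ (cop z)) = ca.legDelta D.gal G (ι z) := by
  have e1 : ∀ y, Lin k (fun x => Φ x y) := fun y =>
    ⟨fun a b => D.injB (by rw [map_add, h, h, h, map_add, (h1 _).map_add]),
      fun c a => D.injB (by rw [map_smul, h, h, map_smul, (h1 _).map_smul])⟩
  have e2 : ∀ x, Lin k (fun y => Φ x y) := fun x =>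
    ⟨fun a b => D.injB (by rw [map_add, h, h, h, map_add, (h2 _).map_add]),
      fun c a => D.injB (by rw [map_smul, h, h, map_smul, (h2 _).map_smul])⟩
  have e3 : ∀ b x y, Φ (st.t b * x) y = Φ x (st.s b * y) := fun b x y => D.injB (by
    rw [h, h, map_mul, map_mul, D.target, D.source, hb _ (D.coact_ιB b)])
  refine (st.map_lift2 ιB.toLinearMap e1 e2 e3 _).trans ?_
  rw [← ca.esDeltaEval_eq D.gal h1 h2 hb]
  refine Eq.trans ?_ (D.comul P (Lin.toMap₂ h1 h2) (fun b X Y => hb _ (D.coact_ιB b) X Y) z)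
  congr 2
  ext x y
  exact h x y

theorem represents_cvOne : Represents ca ιB ι (cvOne k H P) (BgdST.unit2 cou) := fun X Y => by
  rw [pairing_cvOne, BgdST.unit2, D.counit, map_mul]

theorem represents_conv2 {f g : H ⊗[k] H →ₗ[k] P} {Γ Γ' : L0 → L0 → B0}
    (h : Represents ca ιB ι f Γ) (h' : Represents ca ιB ι g Γ') :
    Represents ca ιB ι (cv f g) (st.conv2 cop Γ Γ') := fun X Y => by
  rw [← ca.legDelta_mul_pairing D.gal, BgdST.conv2]
  refine D.lift2_comul (by fun_prop) (by fun_prop) (fun b hb w1 w2 => ?_) (fun y1 y2 => ?_) Y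
  · refine DFunLike.congr_fun (congrArg (ca.legDelta D.gal) (funext₂ fun x1 x2 => ?_)) _
    rw [pairing_mul_one_tmul (D.comm b hb), pairing_mul_tmul_one hb (D.comm b hb),
      ← D.comm b hb, mul_assoc]
  · refine D.lift2_comul (by fun_prop) (by fun_prop) (fun b hb x1 x2 => ?_) (fun x1 x2 => ?_) X
    · rw [pairing_op_mul, pairing_coinv_mul _ _ hb, mul_assoc]
    · rw [map_mul, h, h']

/-- The common shape of both sides of the cocycle condition. -/
theorem lift2_lift2 {f : H ⊗[k] H →ₗ[k] P} {Γ : L0 → L0 → B0} (h : Represents ca ιB ι f Γ)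
    {K : P ⊗[k] Pᵐᵒᵖ → P} (hK : Lin k K) {Φ : L0 → B0} (hΦ : ∀ X, ιB (Φ X) = K (ι X)) (X Y : L0) :
    ιB (st.lift2 (fun y1 y2 => st.lift2 (fun x1 x2 => Φ (st.s (Γ x1 y1) * (x2 * y2))) (cop X))
      (cop Y)) = K (ca.prodA f (ι X) (ι Y)) := by
  rw [prodA, map_tlift hK (by fun_prop) (by fun_prop)]
  simp (disch := fun_prop) only [map_tlift hK]
  rw [← ca.legDelta_mul D.gal f hK]
  have e : ∀ u b : P, (u * b) ⊗ₜ[k] (1 : Pᵐᵒᵖ) = (u ⊗ₜ 1) * (b ⊗ₜ 1) := fun u b => by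
    rw [Algebra.TensorProduct.tmul_mul_tmul, mul_one]
  refine D.lift2_comul (by fun_prop) (by fun_prop) (fun b hb w1 w2 => ?_) (fun y1 y2 => ?_) Y
  · refine DFunLike.congr_fun (congrArg (ca.legDelta D.gal) (funext₂ fun x1 x2 => ?_)) _
    rw [pairing_mul_one_tmul (D.comm b hb), ← D.comm b hb, ← mul_assoc x2,
      tmul_comm_of_comm (D.comm b hb), e, mul_assoc, mul_assoc]
  · refine D.lift2_comul (by fun_prop) (by fun_prop) (fun b hb x1 x2 => ?_) (fun x1 x2 => ?_) X
    · simp only [pairing_op_mul, e, mul_assoc]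
    · rw [hΦ, map_mul, map_mul, D.source, h]

theorem cocL_eq {f : H ⊗[k] H →ₗ[k] P} {Γ : L0 → L0 → B0} (h : Represents ca ιB ι f Γ)
    (X Y Z : L0) : ιB (st.cocL cop Γ X Y Z) = ca.pairing f (ι X) (ca.prodA f (ι Y) (ι Z)) :=
  D.lift2_lift2 h (K := fun z => ca.pairing f (ι X) z) (by fun_prop) (h X) Y Z

theorem cocR_eq {f : H ⊗[k] H →ₗ[k] P} {Γ : L0 → L0 → B0} (h : Represents ca ιB ι f Γ)
    (X Y Z : L0) : ιB (st.cocR cop Γ X Y Z) = ca.pairing f (ca.prodA f (ι X) (ι Y)) (ι Z) :=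
  D.lift2_lift2 h (K := fun z => ca.pairing f z (ι Z)) (Φ := fun X => Γ X Z) (by fun_prop)
    (fun X => h X Z) X Y

theorem represents_colin {f : H ⊗[k] H →ₗ[k] P} {Γ : L0 → L0 → B0}
    (h : Represents ca ιB ι f Γ) : ca.Colin f :=
  (ca.colin_iff_pairing D.legMul_surjective D.range f).2 fun X Y => by
    rw [← h, D.coact_ιB]

theorem exists_represents_of_colin {f : H ⊗[k] H →ₗ[k] P} (hf : ca.Colin f) :
    ∃ Γ, Represents ca ιB ι f Γ := by
  have h : ∀ X Y, ∃ b, ιB b = ca.pairing f (ι X) (ι Y) := fun X Y =>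
    D.rangeB.ge ((ca.colin_iff_pairing D.legMul_surjective D.range f).1 hf X Y)
  choose Γ hΓ using h
  exact ⟨Γ, hΓ⟩

theorem isBihom_of_represents {f : H ⊗[k] H →ₗ[k] P} {Γ : L0 → L0 → B0}
    (h : Represents ca ιB ι f Γ) : st.IsBihom Γ := by
  have h1 : ∀ Y, Lin k (fun X => Γ X Y) := fun Y =>
    ⟨fun a b => D.injB (by rw [map_add, h, h, h, map_add, (ca.lin_pairing_left f _).map_add]),
      fun c a => D.injB (by rw [map_smul, h, h, map_smul, (ca.lin_pairing_left f _).map_smul])⟩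
  have h2 : ∀ X, Lin k (fun Y => Γ X Y) := fun X =>
    ⟨fun a b => D.injB (by rw [map_add, h, h, h, map_add, (ca.lin_pairing_right f _).map_add]),
      fun c a => D.injB (by rw [map_smul, h, h, map_smul, (ca.lin_pairing_right f _).map_smul])⟩
  refine ⟨⟨Lin.toMap₂ h1 h2, fun X Y => rfl⟩, fun b c X Y => D.injB ?_, fun b c X Y => D.injB ?_⟩
  · rw [h, map_mul, map_mul, D.source, D.target, pairing_coinv_mul _ _ (D.coact_ιB b),
      pairing_op_mul, map_mul, map_mul, h, mul_assoc]
  · rw [h, h, map_mul, map_mul, map_mul, map_mul, D.source, D.target,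
      pairing_mul_coinv _ _ (D.coact_ιB b)]

theorem source_comm (b : B0) (X : L0) : X * st.s b = st.s b * X := D.inj (by
  rw [map_mul, map_mul, D.source, tmul_comm_of_comm (D.comm_ιB b)])

theorem target_comm (b : B0) (X : L0) : X * st.t b = st.t b * X := D.inj (by
  rw [map_mul, map_mul, D.target, op_tmul_comm_of_comm (D.comm_ιB b)])

theorem exists_represents_of_isBihom {Γ : L0 → L0 → B0} (hΓ : st.IsBihom Γ) :
    ∃ f, Represents ca ιB ι f Γ := by
  obtain ⟨⟨Γ', hΓ'⟩, hl, hm⟩ := hΓ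
  have hs : ∀ b X Y, Γ (st.s b * X) Y = b * Γ X Y := fun b X Y => by
    simpa only [st.t_one, one_mul, mul_one] using hl b 1 X Y
  have ht : ∀ b X Y, Γ (st.t b * X) Y = Γ X Y * b := fun b X Y => by
    simpa only [map_one, one_mul] using hl 1 b X Y
  have hs' : ∀ b X Y, Γ X (st.s b * Y) = b * Γ X Y := fun b X Y => by
    have := hm b 1 X Y
    rw [st.t_one, one_mul, mul_one, D.source_comm, hs] at this
    exact this.symm
  have ht' : ∀ b X Y, Γ X (st.t b * Y) = Γ X Y * b := fun b X Y => by
    have := hm 1 b X Y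
    rw [map_one, one_mul, mul_one, D.target_comm, ht] at this
    exact this.symm
  obtain ⟨f, hf⟩ := ca.exists_pairing_eq D.inj D.range D.gal D.flat D.comm
    (Θ := fun X Y => ιB (Γ X Y))
    (fun Y => ⟨fun a b => by simp only [← hΓ', map_add, LinearMap.add_apply],
      fun c a => by simp only [← hΓ', map_smul, LinearMap.smul_apply]⟩)
    (fun X => ⟨fun a b => by simp only [← hΓ', map_add],
      fun c a => by simp only [← hΓ', map_smul]⟩)
    (fun b hb => by
      obtain ⟨b, rfl⟩ := D.rangeB.ge hb
      exact ⟨st.s b, D.source b, fun X Y => by rw [hs, hs', map_mul]; exact ⟨rfl, rfl⟩⟩)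
    (fun x y b hb hy Z => by
      obtain ⟨b, rfl⟩ := D.rangeB.ge hb
      obtain rfl : y = st.t b * x := D.inj (by rw [hy, map_mul, D.target]; rfl)
      rw [ht, ht', map_mul, map_mul]
      exact ⟨rfl, rfl⟩)
  exact ⟨f, fun X Y => (hf X Y).symm⟩

theorem represents_inj {f g : H ⊗[k] H →ₗ[k] P} {Γ : L0 → L0 → B0}
    (hf : Represents ca ιB ι f Γ) (hg : Represents ca ιB ι g Γ) : f = g :=
  ca.pairing_cancel D.gal D.legMul_surjective fun X Y => (hf X Y).symm.trans (hg X Y)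

theorem cv_eq_cvOne_iff {f g : H ⊗[k] H →ₗ[k] P} {Γ Γ' : L0 → L0 → B0}
    (h : Represents ca ιB ι f Γ) (h' : Represents ca ιB ι g Γ') :
    (∀ X Y, st.conv2 cop Γ Γ' X Y = BgdST.unit2 cou X Y) ↔ cv f g = cvOne k H P := by
  constructor
  · intro e
    have e' : st.conv2 cop Γ Γ' = BgdST.unit2 cou := by
      ext X Y
      exact e X Y
    exact D.represents_inj (D.represents_conv2 h h') (e' ▸ D.represents_cvOne)
  · intro e X Y
    apply D.injB
    rw [D.represents_conv2 h h', e, D.represents_cvOne]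

theorem isZ2_iff {f : H ⊗[k] H →ₗ[k] P} {Γ : L0 → L0 → B0} (h : Represents ca ιB ι f Γ) :
    st.IsZ2 cop cou Γ ↔ ca.IsTwist f := by
  have hsurj := D.legMul_surjective
  have hl : (∀ X, Γ 1 X = cou X) ↔ ∀ q, ca.twist (AlgHom.id k P) f 1 q = q := by
    rw [← legEval_one_iff hsurj (by fun_prop)]
    refine forall_congr' fun X => ?_
    rw [← D.injB.eq_iff, h, D.counit, map_one, pairing_one_left]
  have hr : (∀ X, Γ X 1 = cou X) ↔ ∀ q, ca.twist (AlgHom.id k P) f q 1 = q := by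
    rw [← legEval_one_iff hsurj (by fun_prop)]
    refine forall_congr' fun X => ?_
    rw [← D.injB.eq_iff, h, D.counit, map_one, pairing_one_right]
  have ha := assoc_iff (ca := ca) hsurj f
  simp only [← D.cocL_eq h, ← D.cocR_eq h, D.injB.eq_iff] at ha
  constructor
  · rintro ⟨-, h1, h2, -, h3, Γi, hi, h4, h5⟩
    obtain ⟨fi, hfi⟩ := D.exists_represents_of_isBihom hi
    exact ⟨D.represents_colin h, hl.1 h1, hr.1 h2, ha.1 h3, fi, (D.cv_eq_cvOne_iff h hfi).1 h4,
      (D.cv_eq_cvOne_iff hfi h).1 h5⟩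
  · rintro ⟨hc, h1, h2, h3, fi, h4, h5⟩
    obtain ⟨Γi, hi⟩ := D.exists_represents_of_colin (hc.inv ca D.gal h4 h5)
    refine ⟨D.isBihom_of_represents h, hl.2 h1, hr.2 h2, fun b X Y => D.injB ?_, ha.2 h3, Γi,
      D.isBihom_of_represents hi, (D.cv_eq_cvOne_iff h hi).2 h4, (D.cv_eq_cvOne_iff hi h).2 h5⟩
    rw [D.source_comm, D.target_comm, h, h, map_mul, map_mul, D.source, D.target,
      pairing_mul_tmul_one (D.coact_ιB b) (D.comm_ιB b), pairing_mul_one_tmul (D.comm_ιB b)]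

end IsEhresmannSchauenburg
end ComodAlg

end

/-- For a faithfully flat Hopf–Galois extension `B ⊆ P` with `P` a
◁-commutative right `H`-module algebra, `Z̃²(H,P)` is in one-to-one correspondence with
`Z²(L(P,H),B)`, via `γ ↦ Γ_γ`, `Γ_γ(p⊗p', q⊗q') = p₍₀₎q₍₀₎ γ(q₍₁₎,p₍₁₎) q'p'`. -/
theorem Zt2_corresponds_to_Z2
    {k : Type u} [Field k] {H P : Type v} [Ring H] [HopfAlgebra k H] [Ring P] [Algebra k P]
    (ca : ComodAlg k H P) (hGal : ca.IsGalois) (hFF : ca.IsFaithfullyFlat)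
    {B0 L0 : Type v} [Ring B0] [Algebra k B0] [Ring L0] [Algebra k L0]
    (ιB : B0 →ₐ[k] P) (hιB : Function.Injective ιB)
    (hιBrange : Set.range ιB = {p : P | ca.ρ p = p ⊗ₜ[k] (1 : H)})
    (ι : L0 →ₐ[k] (P ⊗[k] Pᵐᵒᵖ)) (hι : Function.Injective ι)
    (hιrange : Set.range ι = {z : P ⊗[k] Pᵐᵒᵖ | ca.betaA z = z ⊗ₜ[k] (1 : H)})
    (st : BgdST k B0 L0) (cop : L0 →ₗ[k] st.T2) (cou : L0 →ₗ[k] B0)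
    (hbgd : st.IsLeftBialgebroid cop cou)
    (hs : ∀ b : B0, ι (st.s b) = (ιB b) ⊗ₜ[k] MulOpposite.op (1 : P))
    (ht : ∀ b : B0, ι (st.t b) = (1 : P) ⊗ₜ[k] MulOpposite.op (ιB b))
    (hcou : ∀ z : L0, ιB (cou z) = ComodAlg.mulA (ι z))
    (hcop : ∀ (V : Type v) [AddCommGroup V] [Module k V]
      (G : (P ⊗[k] Pᵐᵒᵖ) →ₗ[k] (P ⊗[k] Pᵐᵒᵖ) →ₗ[k] V),
      (∀ (b : B0) (X Y : P ⊗[k] Pᵐᵒᵖ),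
        G ((((1 : P) ⊗ₜ[k] MulOpposite.op (ιB b)) : P ⊗[k] Pᵐᵒᵖ) * X) Y =
          G X ((((ιB b) ⊗ₜ[k] MulOpposite.op (1 : P)) : P ⊗[k] Pᵐᵒᵖ) * Y)) →
      ∀ z : L0, st.lift2 (fun x y => G (ι x) (ι y)) (cop z) =
        ca.esDeltaEval (fun x y => G x y) (ι z))
    (act : P →ₗ[k] H →ₗ[k] P)
    (hact_one : ∀ p : P, act p 1 = p)
    (hact_mulH : ∀ (p : P) (g h : H), act (act p g) h = act p (g * h))
    (hone_act : ∀ h : H, act 1 h = algebraMap k P (Coalgebra.counit (R := k) h))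
    (hmul_act : ∀ (p q : P) (h : H), act (p * q) h =
      tlift k (fun h1 h2 => act p h1 * act q h2) (Coalgebra.comul (R := k) h))
    (hbraid : ∀ p q : P, p * q = tlift k (fun q0 q1 => q0 * act p q1) (ca.ρ q)) :
    ∃ e : {γ : H → H → P // ComodAlg.IsZt2 ca act γ} ≃ {Γ : L0 → L0 → B0 // st.IsZ2 cop cou Γ},
      ∀ (γs : {γ : H → H → P // ComodAlg.IsZt2 ca act γ}) (z w : L0),
        ιB ((e γs).1 z w) = GammaOf ca ι γs.1 z w := by
  have D : ca.IsEhresmannSchauenburg ιB ι st cop cou :=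
    ⟨hGal, hFF, hιB, hιBrange, hι, hιrange, hs, ht, hcou, hcop,
      fun b hb p => ca.coinv_comm hact_one hbraid hb p⟩
  have h1 : ∀ γ : {γ : H → H → P // ComodAlg.IsZt2 ca act γ},
      ∃ Γ : {Γ : L0 → L0 → B0 // st.IsZ2 cop cou Γ},
        ∀ z w, ιB (Γ.1 z w) = GammaOf ca ι γ.1 z w := by
    rintro ⟨γ, hγ⟩
    obtain ⟨f, rfl⟩ := ca.exists_eq_tmul hγ
    have hf := (ca.isZt2_tmul_iff hGal hbraid f).1 hγ
    obtain ⟨Γ, hΓ⟩ := D.exists_represents_of_colin hf.colin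
    exact ⟨⟨Γ, (D.isZ2_iff hΓ).2 hf⟩, fun z w => by rw [hΓ, ca.gammaOf_eq]⟩
  choose Ψ hΨ using h1
  refine ⟨Equiv.ofBijective Ψ ⟨?_, ?_⟩, hΨ⟩
  · rintro ⟨γ, hγ⟩ ⟨γ', hγ'⟩ h
    obtain ⟨f, rfl⟩ := ca.exists_eq_tmul hγ
    obtain ⟨g, rfl⟩ := ca.exists_eq_tmul hγ'
    have hfg : f = g := ca.pairing_cancel hGal D.legMul_surjective fun X Y => by
      rw [← ca.gammaOf_eq, ← ca.gammaOf_eq, ← hΨ ⟨_, hγ⟩, ← hΨ ⟨_, hγ'⟩, h]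
    subst hfg
    rfl
  · rintro ⟨Γ, hΓ⟩
    obtain ⟨f, hf⟩ := D.exists_represents_of_isBihom hΓ.bihom
    refine ⟨⟨_, (ca.isZt2_tmul_iff hGal hbraid f).2 ((D.isZ2_iff hf).1 hΓ)⟩, ?_⟩
    ext X Y
    apply hιB
    rw [hΨ, hf, ca.gammaOf_eq]
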